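/- arXiv:2011.04483 — 2 statements merged into one kernel-verified Lean document; each statement's English description precedes it below -/
import Mathlib

section
/- Theorem 1.9 (characterization of universal rates): Let 𝒳 be a Polish space and let ℋ be a measurable concept class with |ℋ| ≥ 3. Then: (i) if ℋ does not have an infinite Littlestone tree, then ℋ is learnable with optimal rate R(n) = e^{-n}; (ii) if ℋ has an infinite Littlestone tree but does not have an infinite VCL tree, then ℋ is learnable with optimal rate R(n) = 1/max(n,1); (iii) if ℋ has an infinite VCL tree, then ℋ requires arbitrarily slow rates. -/
open scoped ENNReal

/-- A function is universally measurable if it is measurable with respect to (the completion of)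
every Borel probability measure on its domain. -/
def UniversallyMeasurable {α β : Type*} [MeasurableSpace α] [MeasurableSpace β] (f : α → β) : Prop :=
  ∀ μ : MeasureTheory.Measure α, MeasureTheory.IsProbabilityMeasure μ →
    MeasureTheory.NullMeasurable f μ

variable {𝒳 : Type*}

/-- The error of a classifier `h` under distribution `P` on `𝒳 × {0,1}`. -/
noncomputable def errP [MeasurableSpace 𝒳] (P : MeasureTheory.Measure (𝒳 × Bool))
    (h : 𝒳 → Bool) : ℝ≥0∞ :=
  P {p : 𝒳 × Bool | h p.1 ≠ p.2}

/-- `P` is realizable w.r.t. the concept class `ℋ`: `inf_{h ∈ ℋ} er_P(h) = 0`. -/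
def Realizable [MeasurableSpace 𝒳] (ℋ : Set (𝒳 → Bool))
    (P : MeasureTheory.Measure (𝒳 × Bool)) : Prop :=
  (⨅ h ∈ ℋ, errP P h) = 0

/-- A learning algorithm: a sequence of universally measurable maps
`H_n : (𝒳 × {0,1})^n × 𝒳 → {0,1}`. -/
structure LearningAlgorithm (𝒳 : Type*) [MeasurableSpace 𝒳] where
  H : ∀ n : ℕ, (Fin n → 𝒳 × Bool) → 𝒳 → Bool
  meas : ∀ n : ℕ, UniversallyMeasurable fun q : (Fin n → 𝒳 × Bool) × 𝒳 => H n q.1 q.2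

/-- Expected error `E[er_P(ĥ_n)]` of the output of a learning algorithm on an i.i.d. sample of
size `n` from `P`, i.e. integration with respect to `P^{⊗n}`. -/
noncomputable def expErr [MeasurableSpace 𝒳] (P : MeasureTheory.Measure (𝒳 × Bool))
    (A : LearningAlgorithm 𝒳) (n : ℕ) : ℝ≥0∞ :=
  MeasureTheory.lintegral (MeasureTheory.Measure.pi fun _ : Fin n => P)
    fun s => errP P (A.H n s)

/-- A rate function: `R : ℕ → [0,1]` with `R(n) → 0`. -/
def IsRate (R : ℕ → ℝ) : Prop :=
  (∀ n, R n ∈ Set.Icc (0 : ℝ) 1) ∧ Filter.Tendsto R Filter.atTop (nhds 0)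

/-- `ℋ` is learnable at rate `R`. -/
def LearnableAtRate [MeasurableSpace 𝒳] (ℋ : Set (𝒳 → Bool)) (R : ℕ → ℝ) : Prop :=
  ∃ A : LearningAlgorithm 𝒳,
    ∀ P : MeasureTheory.Measure (𝒳 × Bool),
      MeasureTheory.IsProbabilityMeasure P → Realizable ℋ P →
        ∃ C > (0 : ℝ), ∃ c > (0 : ℝ), ∀ n : ℕ,
          expErr P A n ≤ ENNReal.ofReal (C * R ⌈c * (n : ℝ)⌉₊)

/-- `ℋ` is not learnable at rate faster than `R`. -/
def NotLearnableFasterThan [MeasurableSpace 𝒳] (ℋ : Set (𝒳 → Bool)) (R : ℕ → ℝ) : Prop :=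
  ∀ A : LearningAlgorithm 𝒳,
    ∃ P : MeasureTheory.Measure (𝒳 × Bool),
      MeasureTheory.IsProbabilityMeasure P ∧ Realizable ℋ P ∧
        ∃ C > (0 : ℝ), ∃ c > (0 : ℝ),
          {n : ℕ | ENNReal.ofReal (C * R ⌈c * (n : ℝ)⌉₊) ≤ expErr P A n}.Infinite

/-- `ℋ` is learnable with optimal rate `R`. -/
def LearnableWithOptimalRate [MeasurableSpace 𝒳] (ℋ : Set (𝒳 → Bool)) (R : ℕ → ℝ) : Prop :=
  LearnableAtRate ℋ R ∧ NotLearnableFasterThan ℋ R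

/-- `ℋ` requires arbitrarily slow rates. -/
def RequiresArbitrarilySlowRates [MeasurableSpace 𝒳] (ℋ : Set (𝒳 → Bool)) : Prop :=
  ∀ R : ℕ → ℝ, IsRate R → NotLearnableFasterThan ℋ R

/-- Witness that `ℋ` is a measurable class: it is parameterized by a Polish space `Θ` via a
Borel measurable map `𝗁 : Θ × 𝒳 → {0,1}`. -/
structure MeasurableClassWitness (𝒳 : Type*) [MeasurableSpace 𝒳] (ℋ : Set (𝒳 → Bool)) where
  Θ : Type
  [tΘ : TopologicalSpace Θ]
  [mΘ : MeasurableSpace Θ]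
  [polish : PolishSpace Θ]
  [borel : BorelSpace Θ]
  f : Θ → 𝒳 → Bool
  meas : Measurable (Function.uncurry f)
  range_eq : ℋ = Set.range f

/-- `ℋ` is a measurable class (image admissible Suslin). -/
def MeasurableClass (𝒳 : Type*) [MeasurableSpace 𝒳] (ℋ : Set (𝒳 → Bool)) : Prop :=
  Nonempty (MeasurableClassWitness 𝒳 ℋ)

/-- `ℋ` has an infinite Littlestone tree: nodes are indexed by finite binary strings, and every
finite branch is consistent with some concept in `ℋ`. -/
def HasInfiniteLittlestoneTree (ℋ : Set (𝒳 → Bool)) : Prop :=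
  ∃ x : List Bool → 𝒳, ∀ (y : ℕ → Bool) (n : ℕ),
    ∃ h ∈ ℋ, ∀ k ≤ n, h (x (List.ofFn fun i : Fin k => y i)) = y k

/-- `ℋ` has an infinite VCL tree: the node at depth `k` along a branch is a `(k+1)`-tuple of
points, edges out of it are labelled by `{0,1}^{k+1}`, and every finite branch is consistent
with some concept in `ℋ`. -/
def HasInfiniteVCLTree (ℋ : Set (𝒳 → Bool)) : Prop :=
  ∃ x : ∀ k : ℕ, (∀ j : Fin k, Fin (j.val + 1) → Bool) → Fin (k + 1) → 𝒳,
    ∀ (y : ∀ k : ℕ, Fin (k + 1) → Bool) (n : ℕ),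
      ∃ h ∈ ℋ, ∀ k ≤ n, ∀ i : Fin (k + 1),
        h (x k (fun j => y j.val) i) = y k i

open MeasureTheory Set Filter Topology

/-- The σ-algebra of universally measurable subsets of `α`. -/
@[reducible] def univMS (α : Type*) [MeasurableSpace α] : MeasurableSpace α where
  MeasurableSet' s := ∀ μ : Measure α, IsProbabilityMeasure μ → NullMeasurableSet s μ
  measurableSet_empty _ _ := nullMeasurableSet_empty
  measurableSet_compl _ hs μ hμ := (hs μ hμ).compl
  measurableSet_iUnion _ hs μ hμ := NullMeasurableSet.iUnion fun i => hs i μ hμ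

theorem nullMeasurableSet_of_univMS {α : Type*} [MeasurableSpace α] {s : Set α}
    (hs : MeasurableSet[univMS α] s) (μ : Measure α) [hμ : IsProbabilityMeasure μ] :
    NullMeasurableSet s μ :=
  hs μ hμ

theorem universallyMeasurable_iff {α β : Type*} [MeasurableSpace α] [MeasurableSpace β]
    {f : α → β} : UniversallyMeasurable f ↔ Measurable[univMS α] f :=
  ⟨fun h _ ht μ hμ => h μ hμ ht, fun h μ hμ _ ht => h ht μ hμ⟩

theorem Measurable.univMS {α β : Type*} [MeasurableSpace α] [MeasurableSpace β] {f : α → β}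
    (hf : Measurable f) : Measurable[univMS α, univMS β] f := by
  intro s hs μ hμ
  have : IsProbabilityMeasure (μ.map f) := Measure.isProbabilityMeasure_map hf.aemeasurable
  exact (hs (μ.map f) this).preimage (hf.quasiMeasurePreserving μ)

theorem MeasurableSet.univMS {α : Type*} [MeasurableSpace α] {s : Set α}
    (hs : MeasurableSet s) : MeasurableSet[univMS α] s :=
  fun _ _ => hs.nullMeasurableSet

section Slices

variable {α β : Type*} [MeasurableSpace α] [MeasurableSpace β]

theorem aemeasurable_measure_slice {μ : Measure α} {ν : Measure β} [SFinite ν]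
    {s : Set (α × β)} (hs : NullMeasurableSet s (μ.prod ν)) :
    AEMeasurable (fun a => ν (Prod.mk a ⁻¹' s)) μ := by
  refine ⟨fun a => ν (Prod.mk a ⁻¹' toMeasurable (μ.prod ν) s),
    measurable_measure_prodMk_left (measurableSet_toMeasurable _ _), ?_⟩
  have h := Measure.ae_ae_of_ae_prod hs.toMeasurable_ae_eq
  filter_upwards [h] with a ha
  exact (measure_congr ha).symm

theorem lintegral_measure_slice {μ : Measure α} {ν : Measure β} [SFinite ν]
    {s : Set (α × β)} (hs : NullMeasurableSet s (μ.prod ν)) :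
    ∫⁻ a, ν (Prod.mk a ⁻¹' s) ∂μ = μ.prod ν s := by
  have h := Measure.ae_ae_of_ae_prod hs.toMeasurable_ae_eq
  rw [← measure_toMeasurable s, Measure.prod_apply (measurableSet_toMeasurable _ _)]
  refine lintegral_congr_ae ?_
  filter_upwards [h] with a ha
  exact (measure_congr ha).symm

end Slices

/-! ### Analytic sets are universally measurable -/

theorem MeasureTheory.AnalyticSet.measurableSet_univMS {α : Type*} [TopologicalSpace α]
    [TopologicalSpace.MetrizableSpace α] [MeasurableSpace α] [BorelSpace α] {s : Set α} (hs : AnalyticSet s) :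
    MeasurableSet[univMS α] s := by
  intro μ hμ
  rw [AnalyticSet] at hs
  rcases hs with rfl | ⟨f, hf, rfl⟩
  · exact nullMeasurableSet_empty
  -- it suffices to find compact subsets of almost full measure
  suffices H : ∀ ε : ℝ≥0∞, ε ≠ 0 → ∃ K ⊆ range f, IsCompact K ∧ μ (range f) ≤ μ K + ε by
    have hε : ∀ n : ℕ, ((n : ℝ≥0∞) + 1)⁻¹ ≠ 0 := fun n => by simp
    choose K hKs hK hKμ using fun n : ℕ => H _ (hε n)
    have hsub : (⋃ n, K n) ⊆ range f := iUnion_subset hKs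
    have hm : MeasurableSet (⋃ n, K n) := .iUnion fun n => (hK n).measurableSet
    refine hm.nullMeasurableSet.congr (ae_eq_of_subset_of_measure_ge hsub ?_ hm.nullMeasurableSet
      (measure_ne_top _ _))
    refine ENNReal.le_of_forall_pos_le_add fun ε hε' _ => ?_
    obtain ⟨n, hn⟩ := ENNReal.exists_inv_nat_lt (a := ε) (by simpa using hε'.ne')
    refine (hKμ n).trans (add_le_add (measure_mono (subset_iUnion K n)) ?_)
    refine le_trans ?_ hn.le
    exact ENNReal.inv_le_inv.2 le_self_add
  intro ε hε
  obtain ⟨δ, hδ, hδε⟩ := ENNReal.exists_pos_sum_of_countable' hε ℕ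
  -- cut off the coordinates one after the other
  let B : (n : ℕ) → (ℕ → ℕ) → Set (ℕ → ℕ) := fun n N => {x | ∀ i < n, x i ≤ N i}
  have hB0 : ∀ N, B 0 N = univ := fun N => by ext; simp [B]
  have step : ∀ n (N : ℕ → ℕ), ∃ m, μ (f '' B n N) ≤
      μ (f '' (B n N ∩ {x | x n ≤ m})) + δ n := by
    intro n N
    have hmono : Monotone fun m => f '' (B n N ∩ {x | x n ≤ m}) := by
      intro a b hab
      refine image_mono (inter_subset_inter_right _ fun x (hx : x n ≤ a) => hx.trans hab)
    have hU : (⋃ m, f '' (B n N ∩ {x | x n ≤ m})) = f '' B n N := by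
      rw [← image_iUnion, ← inter_iUnion]
      congr 1
      refine inter_eq_left.2 fun x _ => mem_iUnion.2 ⟨x n, le_refl (x n)⟩
    have hlim := tendsto_measure_iUnion_atTop (μ := μ) hmono
    rw [hU] at hlim
    by_contra! hcon
    have h1 : ∀ m, μ (f '' (B n N ∩ {x | x n ≤ m})) + δ n ≤ μ (f '' B n N) := fun m => (hcon m).le
    have h2 := le_of_tendsto (hlim.add_const (δ n)) (Eventually.of_forall h1)
    have := ENNReal.lt_add_right (measure_ne_top μ (f '' B n N)) (hδ n).ne'
    exact absurd h2 this.not_ge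
  choose m hm using step
  let N : ℕ → ℕ → ℕ := fun n => n.rec (fun _ => 0) fun n N => Function.update N n (m n N)
  have hNs : ∀ n, N (n + 1) = Function.update (N n) n (m n (N n)) := fun n => rfl
  let M : ℕ → ℕ := fun i => N (i + 1) i
  have hNM : ∀ n, ∀ i < n, N n i = M i := by
    intro n
    induction n with
    | zero => simp
    | succ n ih =>
      intro i hi
      rcases Nat.lt_succ_iff_lt_or_eq.1 hi with h | rfl
      · rw [hNs, Function.update_of_ne h.ne, ih i h]
      · rfl
  have hBM : ∀ n, B n (N n) = B n M := by
    intro n; ext x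
    refine forall₂_congr fun i hi => ?_
    rw [hNM n i hi]
  have hBs : ∀ n, B n M ∩ {x | x n ≤ m n (N n)} = B (n + 1) M := by
    intro n; ext x
    have : M n = m n (N n) := by simp [M, hNs]
    simp only [B, mem_inter_iff, mem_ofPred_eq, Nat.lt_succ_iff_lt_or_eq]
    constructor
    · rintro ⟨h, h'⟩ i (hi | rfl)
      · exact h i hi
      · rwa [this]
    · intro h
      exact ⟨fun i hi => h i (.inl hi), this ▸ h n (.inr rfl)⟩
  have hsum : ∀ n, μ (range f) ≤ μ (f '' B n M) + ∑ i ∈ Finset.range n, δ i := by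
    intro n
    induction n with
    | zero => simp [hB0]
    | succ n ih =>
      have := hm n (N n)
      rw [hBM, hBs] at this
      calc μ (range f) ≤ μ (f '' B n M) + ∑ i ∈ Finset.range n, δ i := ih
        _ ≤ (μ (f '' B (n + 1) M) + δ n) + ∑ i ∈ Finset.range n, δ i := by gcongr
        _ = _ := by rw [Finset.sum_range_succ]; ring
  let K : Set (ℕ → ℕ) := Set.pi univ fun i => Iic (M i)
  have hK : IsCompact K := isCompact_univ_pi fun i => (finite_Iic (M i)).isCompact
  have hfK : IsCompact (f '' K) := hK.image hf
  refine ⟨f '' K, image_subset_range _ _, hfK, ?_⟩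
  -- every open neighbourhood of the compact set contains some `f '' B n M`
  have hopen : ∀ U, IsOpen U → f '' K ⊆ U → ∃ n, f '' B n M ⊆ U := by
    intro U hU hKU
    by_contra! hcon
    have : ∀ n, ∃ x ∈ B n M, f x ∉ U := fun n => by
      obtain ⟨_, ⟨x, hx, rfl⟩, hy⟩ := not_subset.1 (hcon n)
      exact ⟨x, hx, hy⟩
    choose x hx hxU using this
    let y : ℕ → ℕ → ℕ := fun n i => min (x n i) (M i)
    have hy : ∀ n, y n ∈ K := fun n i _ => min_le_right (x n i) (M i)
    obtain ⟨z, hz, φ, hφ, hlim⟩ := hK.tendsto_subseq hy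
    have hlim' : Tendsto (x ∘ φ) atTop (𝓝 z) := by
      rw [tendsto_pi_nhds] at hlim ⊢
      intro i
      refine (hlim i).congr' ?_
      filter_upwards [eventually_gt_atTop i] with n hn
      exact min_eq_left (hx (φ n) i (hn.trans_le (hφ.id_le n)))
    have := ((hf.tendsto z).comp hlim').eventually (hU.mem_nhds (hKU ⟨z, hz, rfl⟩))
    obtain ⟨n, hn⟩ := this.exists
    exact hxU _ hn
  refine ENNReal.le_of_forall_pos_le_add fun η hη _ => ?_
  have hlt : μ (f '' K) < μ (f '' K) + η :=
    ENNReal.lt_add_right (measure_ne_top _ _) (by simpa using hη.ne')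
  obtain ⟨U, hKU, hU, hμU⟩ := (f '' K).exists_isOpen_lt_of_lt _ hlt
  obtain ⟨n, hn⟩ := hopen U hU hKU
  calc μ (range f) ≤ μ (f '' B n M) + ∑ i ∈ Finset.range n, δ i := hsum n
    _ ≤ (μ (f '' K) + η) + ε :=
      add_le_add ((measure_mono hn).trans hμU.le) ((ENNReal.sum_le_tsum _).trans hδε.le)
    _ = _ := by ring

/-! ### Game histories -/

/-- Histories of `k` rounds of the game in which round `j` produces `d j` labelled points. -/
abbrev Hist (X : Type*) (d : ℕ → ℕ) (k : ℕ) := (j : Fin k) → Fin (d j) → X × Bool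

/-- Label histories of `k` rounds. -/
abbrev Lab (d : ℕ → ℕ) (k : ℕ) := (j : Fin k) → Fin (d j) → Bool

section Hist

variable {X : Type*} {d : ℕ → ℕ} {k : ℕ}

/-- Append a round to a history. -/
def Hist.snoc (v : Hist X d k) (b : Fin (d k) → X × Bool) : Hist X d (k + 1) :=
  Fin.snoc (α := fun j : Fin (k + 1) => Fin (d j) → X × Bool) v b

/-- Append a round to a label history. -/
def Lab.snoc (y : Lab d k) (b : Fin (d k) → Bool) : Lab d (k + 1) :=
  Fin.snoc (α := fun j : Fin (k + 1) => Fin (d j) → Bool) y b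

/-- Forget the last round of a label history. -/
def Lab.dropLast (y : Lab d (k + 1)) : Lab d k := fun j => y j.castSucc

@[simp] theorem Hist.snoc_castSucc (v : Hist X d k) (b : Fin (d k) → X × Bool) (j : Fin k) :
    Hist.snoc v b j.castSucc = v j :=
  Fin.snoc_castSucc (α := fun j : Fin (k + 1) => Fin (d j) → X × Bool) ..

@[simp] theorem Hist.snoc_last (v : Hist X d k) (b : Fin (d k) → X × Bool) :
    Hist.snoc v b (Fin.last k) = b :=
  Fin.snoc_last (α := fun j : Fin (k + 1) => Fin (d j) → X × Bool) ..

@[simp] theorem Lab.snoc_last (y : Lab d k) (b : Fin (d k) → Bool) :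
    Lab.snoc y b (Fin.last k) = b :=
  Fin.snoc_last (α := fun j : Fin (k + 1) => Fin (d j) → Bool) ..

@[simp] theorem Lab.dropLast_snoc (y : Lab d k) (b : Fin (d k) → Bool) : (Lab.snoc y b).dropLast = y := by
  funext j
  exact Fin.snoc_castSucc (α := fun j : Fin (k + 1) => Fin (d j) → Bool) ..

theorem Hist.ext_snoc {v w : Hist X d (k + 1)} (h : ∀ j : Fin k, v j.castSucc = w j.castSucc)
    (h' : v (Fin.last k) = w (Fin.last k)) : v = w := by
  funext j
  induction j using Fin.lastCases with
  | last => exact h'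
  | cast j => exact h j

theorem Hist.continuous_snoc [TopologicalSpace X] :
    Continuous fun p : Hist X d k × (Fin (d k) → X × Bool) => Hist.snoc p.1 p.2 := by
  refine continuous_pi fun j => ?_
  induction j using Fin.lastCases with
  | last => simpa using continuous_snd
  | cast j =>
    simp only [Hist.snoc_castSucc]
    exact (continuous_apply j).comp continuous_fst

/-- The history along a branch of a tree of points. -/
def branch (x : ∀ k, Lab d k → Fin (d k) → X) (y : Lab d k) : Hist X d k :=
  fun j i => (x j (fun l => y (Fin.castLE j.2.le l)) i, y j i)

theorem branch_eq_snoc (x : ∀ k, Lab d k → Fin (d k) → X) (y : Lab d (k + 1)) :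
    branch x y = Hist.snoc (branch x y.dropLast) fun i => (x k y.dropLast i, y (Fin.last k) i) := by
  refine Hist.ext_snoc (fun j => ?_) ?_
  · rw [Hist.snoc_castSucc]; rfl
  · rw [Hist.snoc_last]; rfl

theorem branch_congr {x x' : ∀ k, Lab d k → Fin (d k) → X} (h : ∀ j < k, x j = x' j)
    (y : Lab d k) : branch x y = branch x' y := by
  funext j i
  simp [branch, h j j.2]

theorem branch_last_fst (x : ∀ k, Lab d k → Fin (d k) → X) (y : Lab d k) (b : Fin (d k) → Bool)
    (i : Fin (d k)) : (branch x (Lab.snoc y b) (Fin.last k) i).1 = x k y i := by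
  rw [branch_eq_snoc, Hist.snoc_last, Lab.dropLast_snoc]

/-- The value sets of the game with target sets `base`: from a history in `valueSet base κ k` the
adversary can keep the history in the target sets while moving down through the ordinals
below `κ`. -/
def valueSet (base : ∀ k, Set (Hist X d k)) (κ : Ordinal.{0}) : ∀ k, Set (Hist X d k) := fun k =>
  {v | v ∈ base k ∧ ∀ l, ∀ _ : l < κ, ∃ x : Fin (d k) → X, ∀ y : Fin (d k) → Bool,
    Hist.snoc v (fun i => (x i, y i)) ∈ valueSet base l (k + 1)}
termination_by κ

theorem mem_valueSet {base : ∀ k, Set (Hist X d k)} {κ : Ordinal.{0}} {v : Hist X d k} :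
    v ∈ valueSet base κ k ↔ v ∈ base k ∧ ∀ l < κ, ∃ x : Fin (d k) → X, ∀ y : Fin (d k) → Bool,
      Hist.snoc v (fun i => (x i, y i)) ∈ valueSet base l (k + 1) := by
  rw [valueSet]
  rfl

theorem valueSet_anti (base : ∀ k, Set (Hist X d k)) {κ l : Ordinal.{0}} (h : l ≤ κ) :
    valueSet base κ k ⊆ valueSet base l k := by
  intro v hv
  rw [mem_valueSet] at hv ⊢
  exact ⟨hv.1, fun m hm => hv.2 m (hm.trans_le h)⟩

theorem analyticSet_valueSet [TopologicalSpace X] [PolishSpace X] {base : ∀ k, Set (Hist X d k)}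
    (hbase : ∀ k, AnalyticSet (base k)) (κ : Ordinal.{0}) (hκ : (Iic κ).Countable) :
    ∀ k, AnalyticSet (valueSet base κ k) := by
  induction κ using WellFoundedLT.induction with
  | ind κ ih =>
    intro k
    have : Countable (Iio κ) := (hκ.mono Iio_subset_Iic_self).to_subtype
    have hstep : ∀ l : Iio κ, AnalyticSet {v : Hist X d k | ∃ x : Fin (d k) → X,
        ∀ y : Fin (d k) → Bool, Hist.snoc v (fun i => (x i, y i)) ∈ valueSet base l (k + 1)} := by
      intro l
      have h1 : AnalyticSet (⋂ y : Fin (d k) → Bool, (fun p : Hist X d k × (Fin (d k) → X) =>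
          Hist.snoc p.1 fun i => (p.2 i, y i)) ⁻¹' valueSet base l (k + 1)) := by
        refine AnalyticSet.iInter fun y => ?_
        refine (ih l l.2 (hκ.mono (Iic_subset_Iic.2 (le_of_lt l.2))) (k + 1)).preimage ?_
        exact Hist.continuous_snoc.comp (continuous_fst.prodMk (by fun_prop))
      convert h1.image_of_continuous continuous_fst
      ext v
      simp
    have h2 : valueSet base κ k = ⋂ o : Option (Iio κ), o.elim (base k) fun l =>
        {v : Hist X d k | ∃ x : Fin (d k) → X,
          ∀ y : Fin (d k) → Bool, Hist.snoc v (fun i => (x i, y i)) ∈ valueSet base l (k + 1)} := by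
      ext v
      rw [mem_valueSet, mem_iInter, Option.forall]
      simp
    rw [h2]
    refine AnalyticSet.iInter fun o => ?_
    cases o with
    | none => exact hbase k
    | some l => exact hstep l

end Hist

/-! ### Countability of the game value -/

/-- A well-foundedness rank for a tree of finite approximations (Kunen–Martin). -/
theorem exists_countable_rank {J : Type} (S : ℕ → Set (J → ℕ)) (F : ℕ → Set J)
    (hF : ∀ n, (F n).Finite) (hmono : Monotone F) (hcov : ∀ j, ∃ n, j ∈ F n) (hanti : Antitone S)
    (hS : ¬ ∃ W : J → ℕ, ∀ n, ∃ W' ∈ S n, ∀ j ∈ F n, W' j = W j) :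
    ∃ ρ : ℕ → (J → ℕ) → Ordinal.{0}, (∀ n W, (Iic (ρ n W)).Countable) ∧
      ∀ n W W', W ∈ S n → W' ∈ S (n + 1) → (∀ j ∈ F n, W' j = W j) → ρ (n + 1) W' < ρ n W := by
  have : ∀ n, Finite (F n) := fun n => (hF n).to_subtype
  let T := Σ n, (F n → ℕ)
  let ap : ℕ → (J → ℕ) → T := fun n W => ⟨n, fun j => W j⟩
  let r : T → T → Prop := fun t' t => ∃ n W W', W ∈ S n ∧ W' ∈ S (n + 1) ∧
    (∀ j ∈ F n, W' j = W j) ∧ t = ap n W ∧ t' = ap (n + 1) W'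
  have hap : ∀ {n m W W'}, ap n W = ap m W' → n = m ∧ ∀ j ∈ F n, W j = W' j := by
    intro n m W W' h
    obtain rfl : n = m := congrArg Sigma.fst h
    exact ⟨rfl, fun j hj => congrFun (eq_of_heq (Sigma.mk.inj h).2) ⟨j, hj⟩⟩
  have hr : IsWellFounded T r := by
    refine ⟨wellFounded_iff_isEmpty_descending_chain.2 ⟨fun ⟨e, he⟩ => hS ?_⟩⟩
    choose n W W' hW hW' hWW hn hn' using he
    have hnn : ∀ i, n (i + 1) = n i + 1 ∧ ∀ j ∈ F (n (i + 1)), W (i + 1) j = W' i j := fun i =>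
      hap ((hn (i + 1)).symm.trans (hn' i))
    have hlev : ∀ i, i ≤ n i := by
      intro i
      induction i with
      | zero => exact Nat.zero_le _
      | succ i ih => rw [(hnn i).1]; omega
    have hstep : ∀ i, ∀ j ∈ F (n i), W (i + 1) j = W i j := fun i j hj => by
      rw [(hnn i).2 j (hmono (by rw [(hnn i).1]; omega) hj), hWW i j hj]
    have hnm : Monotone n := monotone_nat_of_le_succ fun i => by rw [(hnn i).1]; omega
    have hstab : ∀ i m, i ≤ m → ∀ j ∈ F (n i), W m j = W i j := by
      intro i m him
      induction m, him using Nat.le_induction with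
      | base => exact fun _ _ => rfl
      | succ m hm ih => exact fun j hj => (hstep m j (hmono (hnm hm) hj)).trans (ih j hj)
    choose lev hl using hcov
    refine ⟨fun j => W (lev j) j, fun m => ⟨W m, hanti (hlev m) (hW m), fun j hj => ?_⟩⟩
    rcases le_total m (lev j) with h | h
    · exact (hstab m _ h j (hmono (hlev m) hj)).symm
    · exact hstab _ m h j (hmono (hlev _) (hl j))
  refine ⟨fun n W => IsWellFounded.rank r (ap n W), fun n W => ?_, fun n W W' hW hW' h =>
    IsWellFounded.rank_lt_of_rel ⟨n, W, W', hW, hW', h, rfl, rfl⟩⟩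
  refine (countable_range (IsWellFounded.rank r)).mono fun o ho => ?_
  exact IsWellFounded.mem_range_rank_of_le ho

/-- If there is no infinite tree all of whose branches stay in the (analytic) target sets, then
the value of the game is a countable ordinal. -/
theorem exists_countable_value {X : Type*} [TopologicalSpace X] [T2Space X] [Nonempty X]
    (d : ℕ → ℕ) (base : ∀ k, Set (Hist X d k)) (hbase : ∀ k, AnalyticSet (base k))
    (hne : ∀ k, (base k).Nonempty)
    (hno : ¬ ∃ x : ∀ k, Lab d k → Fin (d k) → X, ∀ k (y : Lab d k), branch x y ∈ base k) :
    ∃ α : Ordinal.{0}, (Iic α).Countable ∧ ∀ v : Hist X d 0, v ∉ valueSet base α 0 := by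
  classical
  have hg : ∀ k, ∃ g : (ℕ → ℕ) → Hist X d k, Continuous g ∧ range g = base k := fun k => by
    have := hbase k
    rw [AnalyticSet] at this
    exact this.resolve_left (hne k).ne_empty
  choose g hgc hgr using hg
  let J := (Σ k, Lab d k) × ℕ
  obtain ⟨e, he⟩ := exists_injective_nat J
  let valid : ℕ → (∀ k, Lab d k → Fin (d k) → X) → (J → ℕ) → Prop := fun n x W =>
    ∀ k ≤ n, ∀ y : Lab d k, g k (fun i => W (⟨k, y⟩, i)) = branch x y
  let S : ℕ → Set (J → ℕ) := fun n => {W | ∃ x, valid n x W}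
  let F : ℕ → Set J := fun n => {j | j.1.1 ≤ n ∧ e j ≤ n}
  obtain ⟨ρ, hρc, hρ⟩ := exists_countable_rank S F
    (fun n => ((finite_Iic n).preimage he.injOn).subset fun j hj => hj.2)
    (fun n m hnm j hj => ⟨hj.1.trans hnm, hj.2.trans hnm⟩)
    (fun j => ⟨max j.1.1 (e j), le_max_left _ _, le_max_right _ _⟩)
    (fun n m hnm W hW => by
      obtain ⟨x, hx⟩ := hW
      exact ⟨x, fun k hk => hx k (hk.trans hnm)⟩)
    (by
      rintro ⟨W, hW⟩
      choose V hV hVW using hW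
      choose x hx using hV
      have hlim : ∀ k (y : Lab d k), Tendsto (fun n => branch (x n) y) atTop
          (𝓝 (g k fun i => W (⟨k, y⟩, i))) := by
        intro k y
        have h1 : Tendsto (fun n => g k fun i => V n (⟨k, y⟩, i)) atTop
            (𝓝 (g k fun i => W (⟨k, y⟩, i))) := by
          refine ((hgc k).tendsto _).comp (tendsto_pi_nhds.2 fun i => ?_)
          refine tendsto_nhds_of_eventually_eq ?_
          filter_upwards [eventually_ge_atTop (max k (e (⟨k, y⟩, i)))] with n hn
          exact hVW n _ ⟨(le_max_left _ _).trans hn, (le_max_right _ _).trans hn⟩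
        refine h1.congr' ?_
        filter_upwards [eventually_ge_atTop k] with n hn
        exact hx n k hn y
      refine hno ⟨fun k y i => (g (k + 1) (fun l => W (⟨k + 1, Lab.snoc y fun _ => false⟩, l))
        (Fin.last k) i).1, fun k y => ?_⟩
      have hpt : ∀ k (y : Lab d k) i, Tendsto (fun n => x n k y i) atTop (𝓝
          (g (k + 1) (fun l => W (⟨k + 1, Lab.snoc y fun _ => false⟩, l)) (Fin.last k) i).1) := by
        intro k y i
        have h2 := (tendsto_pi_nhds.1 ((tendsto_pi_nhds.1
          (hlim (k + 1) (Lab.snoc y fun _ => false))) (Fin.last k))) i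
        refine ((continuous_fst.tendsto _).comp h2).congr fun n => ?_
        exact branch_last_fst _ _ _ _
      rw [← hgr k]
      refine ⟨_, tendsto_nhds_unique (hlim k y) ?_⟩
      refine tendsto_pi_nhds.2 fun j => tendsto_pi_nhds.2 fun i => ?_
      exact (hpt _ _ _).prodMk_nhds tendsto_const_nhds)
  have key : ∀ o : Ordinal.{0}, ∀ n x W, valid n x W → ρ n W = o →
      ¬ ∀ y : Lab d n, branch x y ∈ valueSet base (Order.succ o) n := by
    intro o
    induction o using WellFoundedLT.induction with
    | ind o ih =>
      intro n x W hv ho hy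
      have h1 := fun y => (mem_valueSet.1 (hy y)).2 o (Order.lt_succ o)
      choose x₁ hx₁ using h1
      let x' := Function.update x n x₁
      have hxx : ∀ k ≤ n, ∀ y : Lab d k, branch x' y = branch x y := fun k hk y =>
        branch_congr (fun j hj => Function.update_of_ne (by omega) _ _) y
      have hb : ∀ y : Lab d (n + 1), branch x' y ∈ valueSet base o (n + 1) := by
        intro y
        rw [branch_eq_snoc, hxx n le_rfl]
        simpa [x'] using hx₁ y.dropLast fun i => y (Fin.last n) i
      have hW : ∀ y : Lab d (n + 1), ∃ w, g (n + 1) w = branch x' y := fun y => by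
        rw [← mem_range, hgr]
        exact (mem_valueSet.1 (hb y)).1
      choose w hw using hW
      let W' : J → ℕ := fun j => if h : j.1.1 = n + 1 then w (h ▸ j.1.2) j.2 else W j
      have hv' : valid (n + 1) x' W' := by
        intro k hk y
        rcases Nat.le_succ_iff_eq_or_le.1 hk with rfl | hk
        · rw [← hw]
          simp [W']
        · rw [hxx k hk, ← hv k hk]
          have : k ≠ n + 1 := by omega
          simp [W', this]
      have hlt : ρ (n + 1) W' < o := by
        rw [← ho]
        refine hρ n W W' ⟨x, hv⟩ ⟨x', hv'⟩ fun j hj => ?_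
        have : j.1.1 ≠ n + 1 := by have := hj.1; omega
        simp [W', this]
      exact ih _ hlt (n + 1) x' W' hv' rfl fun y => valueSet_anti base (Order.succ_le_of_lt hlt) (hb y)
  obtain ⟨v₀, hv₀⟩ := hne 0
  rw [← hgr 0] at hv₀
  obtain ⟨w, hw⟩ := hv₀
  let x₀ : ∀ k, Lab d k → Fin (d k) → X := fun _ _ _ => Classical.arbitrary X
  refine ⟨Order.succ (ρ 0 fun j => w j.2), ?_, fun v hv => ?_⟩
  · rw [Order.Iic_succ]
    exact (hρc _ _).insert _
  · refine key _ 0 x₀ (fun j => w j.2) (fun k hk y => ?_) rfl fun y => ?_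
    · obtain rfl : k = 0 := by omega
      exact funext fun j => j.elim0
    · convert hv

section Strategy

variable {X : Type*} {d : ℕ → ℕ} {k : ℕ}

/-- Answers of the learner which minimise the remaining value of the game. -/
def bestAnswers (base : ∀ k, Set (Hist X d k)) (α : Ordinal.{0}) (v : Hist X d k)
    (x : Fin (d k) → X) : Set (Fin (d k) → Bool) :=
  {y | ∀ (y' : Fin (d k) → Bool) (κ : Iic α), Hist.snoc v (fun i => (x i, y' i)) ∉ valueSet base κ (k + 1) →
    Hist.snoc v (fun i => (x i, y i)) ∉ valueSet base κ (k + 1)}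

theorem bestAnswers_nonempty (base : ∀ k, Set (Hist X d k)) (α : Ordinal.{0}) (v : Hist X d k)
    (x : Fin (d k) → X) : (bestAnswers base α v x).Nonempty := by
  let s : (Fin (d k) → Bool) → Set Ordinal.{0} := fun y =>
    {κ : Ordinal.{0} | Hist.snoc v (fun i => (x i, y i)) ∉ valueSet base κ (k + 1)} ∪ {Order.succ α}
  have hs : ∀ y, sInf (s y) ∈ s y := fun y => csInf_mem ⟨_, .inr rfl⟩
  obtain ⟨y, hy⟩ := Finite.exists_min fun y => sInf (s y)
  refine ⟨y, fun y' κ h => ?_⟩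
  have h1 : sInf (s y) ≤ κ := (hy y').trans (csInf_le' (.inl h))
  rcases hs y with h2 | h2
  · exact fun h3 => h2 (valueSet_anti base h1 h3)
  · rw [mem_singleton_iff] at h2
    rw [h2] at h1
    exact absurd (h1.trans κ.2) (Order.lt_succ α).not_ge

open Classical in
/-- A choice function on sets of answers. -/
noncomputable def pickAnswer {n : ℕ} (s : Set (Fin n → Bool)) : Fin n → Bool :=
  if h : s.Nonempty then h.some else fun _ => false

/-- The strategy of the learner: give an answer which minimises the remaining value. -/
noncomputable def strategy (base : ∀ k, Set (Hist X d k)) (α : Ordinal.{0}) (v : Hist X d k)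
    (x : Fin (d k) → X) : Fin (d k) → Bool :=
  pickAnswer (bestAnswers base α v x)

theorem strategy_mem (base : ∀ k, Set (Hist X d k)) (α : Ordinal.{0}) (v : Hist X d k)
    (x : Fin (d k) → X) : strategy base α v x ∈ bestAnswers base α v x := by
  rw [strategy, pickAnswer, dif_pos (bestAnswers_nonempty base α v x)]
  exact Nonempty.some_mem _

theorem exists_lt_strategy_notMem {base : ∀ k, Set (Hist X d k)} {α κ : Ordinal.{0}}
    {v : Hist X d k} (hκ : κ ≤ α) (hb : v ∈ base k) (hv : v ∉ valueSet base κ k) :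
    ∃ l < κ, ∀ x : Fin (d k) → X,
      Hist.snoc v (fun i => (x i, strategy base α v x i)) ∉ valueSet base l (k + 1) := by
  rw [mem_valueSet] at hv
  push Not at hv
  obtain ⟨l, hl, h⟩ := hv hb
  refine ⟨l, hl, fun x => ?_⟩
  obtain ⟨y, hy⟩ := h x
  exact strategy_mem base α v x y ⟨l, hl.le.trans hκ⟩ hy

theorem measurable_strategy [TopologicalSpace X] [PolishSpace X] [MeasurableSpace X] [BorelSpace X]
    {base : ∀ k, Set (Hist X d k)} (hbase : ∀ k, AnalyticSet (base k)) {α : Ordinal.{0}}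
    (hα : (Iic α).Countable) :
    Measurable[univMS (Hist X d k × (Fin (d k) → X))]
      fun p : Hist X d k × (Fin (d k) → X) => strategy base α p.1 p.2 := by
  classical
  have hc : Countable (Iic α) := hα.to_subtype
  have h1 : ∀ (κ : Iic α) (y : Fin (d k) → Bool),
      MeasurableSet[univMS (Hist X d k × (Fin (d k) → X))]
        {p : Hist X d k × (Fin (d k) → X) | Hist.snoc p.1 (fun i => (p.2 i, y i)) ∈ valueSet base κ (k + 1)} := by
    intro κ y
    refine AnalyticSet.measurableSet_univMS (α := Hist X d k × (Fin (d k) → X)) ?_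
    refine (analyticSet_valueSet hbase κ (hα.mono (Iic_subset_Iic.2 κ.2)) (k + 1)).preimage
      (f := fun p : Hist X d k × (Fin (d k) → X) => Hist.snoc p.1 fun i => (p.2 i, y i)) ?_
    exact Hist.continuous_snoc.comp (continuous_fst.prodMk (by fun_prop))
  have h2 : ∀ y : Fin (d k) → Bool, MeasurableSet[univMS (Hist X d k × (Fin (d k) → X))]
      {p : Hist X d k × (Fin (d k) → X) | y ∈ bestAnswers base α p.1 p.2} := by
    intro y
    have : {p : Hist X d k × (Fin (d k) → X) | y ∈ bestAnswers base α p.1 p.2} =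
        ⋂ y' : Fin (d k) → Bool, ⋂ κ : Iic α,
          {p : Hist X d k × (Fin (d k) → X) | Hist.snoc p.1 (fun i => (p.2 i, y' i)) ∈ valueSet base κ (k + 1)} ∪
          {p : Hist X d k × (Fin (d k) → X) | Hist.snoc p.1 (fun i => (p.2 i, y i)) ∈ valueSet base κ (k + 1)}ᶜ := by
      ext p
      simp only [bestAnswers, mem_iInter, mem_union, mem_compl_iff, mem_ofPred_eq]
      exact forall₂_congr fun y' κ => by tauto
    rw [this]
    exact .iInter fun y' => .iInter fun κ => (h1 κ y').union (h1 κ y).compl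
  refine @measurable_to_countable' _ _ _ _ (univMS (Hist X d k × (Fin (d k) → X))) _ fun y => ?_
  have h3 : (fun p : Hist X d k × (Fin (d k) → X) => strategy base α p.1 p.2) ⁻¹' {y} =
      ⋃ s : {s : Set (Fin (d k) → Bool) // pickAnswer s = y}, ⋂ z : Fin (d k) → Bool,
        {p : Hist X d k × (Fin (d k) → X) | z ∈ bestAnswers base α p.1 p.2 ↔ z ∈ s.1} := by
    ext p
    simp only [mem_preimage, mem_singleton_iff, mem_iUnion, mem_iInter, mem_ofPred_eq,
      ← Set.ext_iff, strategy]
    exact ⟨fun h => ⟨⟨_, h⟩, rfl⟩, fun ⟨s, hs⟩ => hs ▸ s.2⟩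
  rw [h3]
  refine .iUnion fun s => .iInter fun z => ?_
  by_cases hz : z ∈ s.1
  · simp only [hz, iff_true]
    exact h2 z
  · simp only [hz, iff_false]
    exact (h2 z).compl

end Strategy

/-- Histories which are consistent with some concept in the class. -/
def consistentHist {X : Type*} (ℋ : Set (X → Bool)) (d : ℕ → ℕ) (k : ℕ) : Set (Hist X d k) :=
  {v | ∃ h ∈ ℋ, ∀ j i, h (v j i).1 = (v j i).2}

theorem analyticSet_consistentHist {X : Type*} [TopologicalSpace X] [PolishSpace X]
    [MeasurableSpace X] [BorelSpace X] {ℋ : Set (X → Bool)} (hℋ : MeasurableClass X ℋ)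
    (d : ℕ → ℕ) (k : ℕ) : AnalyticSet (consistentHist ℋ d k) := by
  obtain ⟨w⟩ := hℋ
  let := w.tΘ
  let := w.mΘ
  have := w.polish
  have := w.borel
  have h1 : MeasurableSet {p : w.Θ × Hist X d k | ∀ j i, w.f p.1 (p.2 j i).1 = (p.2 j i).2} := by
    simp only [ofPred_forall]
    refine .iInter fun j => .iInter fun i => measurableSet_eq_fun ?_ (by fun_prop)
    refine w.meas.comp (f := fun p : w.Θ × Hist X d k => (p.1, (p.2 j i).1)) ?_
    exact measurable_fst.prodMk (by fun_prop)
  convert h1.analyticSet.image_of_continuous continuous_snd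
  ext v
  simp [consistentHist, w.range_eq]

theorem exists_good_points {X : Type*} [MeasurableSpace X] {ℋ : Set (X → Bool)}
    {P : Measure (X × Bool)} (hP : Realizable ℋ P) :
    ∃ G : Set (X × Bool), (∀ᵐ p ∂P, p ∈ G) ∧
      ∀ T : Set (X × Bool), T.Finite → T ⊆ G → ∃ h ∈ ℋ, ∀ p ∈ T, h p.1 = p.2 := by
  have h1 : ∀ m : ℕ, ∃ h ∈ ℋ, errP P h < 2⁻¹ ^ m := fun m => by
    have : (⨅ h ∈ ℋ, errP P h) < 2⁻¹ ^ m := by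
      rw [hP]
      exact ENNReal.pow_pos (by simp) m
    simpa [iInf_lt_iff] using this
  choose h hh hlt using h1
  refine ⟨{p | ∀ᶠ m in atTop, h m p.1 = p.2}, ?_, fun T hT hTG => ?_⟩
  · have : ∑' m, P {p | h m p.1 ≠ p.2} ≠ ∞ := by
      refine ne_top_of_le_ne_top ?_ (ENNReal.tsum_le_tsum fun m => (hlt m).le)
      rw [ENNReal.tsum_geometric]
      norm_num
    have h2 := measure_setOfPred_frequently_eq_zero this
    rw [ae_iff]
    simpa only [mem_ofPred_eq, not_eventually] using h2
  · have : ∀ᶠ m in atTop, ∀ p ∈ T, h m p.1 = p.2 := (eventually_all_finite hT).2 fun p hp => hTG hp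
    obtain ⟨m, hm⟩ := this.exists
    exact ⟨h m, hh m, hm⟩

section Nested

variable {X : Type*} [MeasurableSpace X] (P : Measure (X × Bool)) [IsProbabilityMeasure P]
  (d : ℕ → ℕ)

/-- The distribution of a history consisting of independent examples. -/
noncomputable abbrev histMeasure (k : ℕ) : Measure (Hist X d k) :=
  Measure.pi fun j : Fin k => Measure.pi fun _ : Fin (d j) => P

theorem measurePreserving_snoc (k : ℕ) :
    MeasurePreserving (fun p : Hist X d k × (Fin (d k) → X × Bool) => Hist.snoc p.1 p.2)
      ((histMeasure P d k).prod (Measure.pi fun _ => P)) (histMeasure P d (k + 1)) := by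
  have hm : Measurable fun p : Hist X d k × (Fin (d k) → X × Bool) => Hist.snoc p.1 p.2 := by
    refine measurable_pi_lambda _ fun j => ?_
    induction j using Fin.lastCases with
    | last => simpa using measurable_snd
    | cast j =>
      simp only [Hist.snoc_castSucc]
      exact (measurable_pi_apply j).comp measurable_fst
  refine ⟨hm, (Measure.pi_eq fun s hs => ?_).symm⟩
  rw [Measure.map_apply hm (.univ_pi hs), Fin.prod_univ_castSucc]
  have : (fun p : Hist X d k × (Fin (d k) → X × Bool) => Hist.snoc p.1 p.2) ⁻¹' univ.pi s =
      (univ.pi fun j : Fin k => s j.castSucc) ×ˢ s (Fin.last k) := by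
    ext p
    simp only [mem_preimage, mem_univ_pi, mem_prod]
    constructor
    · intro h
      exact ⟨fun j => by simpa using h j.castSucc, by simpa using h (Fin.last k)⟩
    · rintro ⟨h, h'⟩ j
      induction j using Fin.lastCases with
      | last => simpa using h'
      | cast j => simpa using h j
  rw [this, Measure.prod_prod, Measure.pi_pi]
  rfl

/-- The probability that the learner's answer to a fresh batch of examples is correct. -/
noncomputable def matchProb {n : ℕ} (g : (Fin n → X) → Fin n → Bool) : ℝ≥0∞ :=
  Measure.pi (fun _ : Fin n => P) {b | (g fun i => (b i).1) = fun i => (b i).2}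

/-- If the learner's strategy beats every consistent adversary, then after finitely many rounds of
the game, random examples exhaust the adversary with positive probability. -/
theorem exists_histMeasure_ne_zero {ℋ : Set (X → Bool)} (hP : Realizable ℋ P) (α : Ordinal.{0})
    (hroot : ∀ v : Hist X d 0, v ∉ valueSet (consistentHist ℋ d) α 0) :
    ∃ k, histMeasure P d k
      {v | matchProb P (strategy (consistentHist ℋ d) α v) = 0} ≠ 0 := by
  obtain ⟨G, hG, hGc⟩ := exists_good_points hP
  let base := consistentHist ℋ d
  let Q : ∀ k, Measure (Fin (d k) → X × Bool) := fun k => Measure.pi fun _ => P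
  have hbase : ∀ k (v : Hist X d k), (∀ j i, v j i ∈ G) → v ∈ base k := by
    intro k v hv
    obtain ⟨h, hh, hc⟩ := hGc (⋃ j, range (v j)) (finite_iUnion fun j => finite_range _)
      (iUnion_subset fun j => range_subset_iff.2 (hv j))
    exact ⟨h, hh, fun j i => hc _ (mem_iUnion.2 ⟨j, i, rfl⟩)⟩
  let pos : ℕ → ∀ k, Hist X d k → Prop := fun m => m.rec
    (fun k v => matchProb P (strategy base α v) = 0)
    (fun _ p k v => Q k {b | p (k + 1) (Hist.snoc v b)} ≠ 0)
  have hpos : ∀ m k (v : Hist X d k),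
      pos (m + 1) k v ↔ Q k {b | pos m (k + 1) (Hist.snoc v b)} ≠ 0 := fun _ _ _ => Iff.rfl
  have h1 : ∀ κ ≤ α, ∀ k (v : Hist X d k), (∀ j i, v j i ∈ G) → v ∉ valueSet base κ k →
      ∃ m, pos m k v := by
    intro κ
    induction κ using WellFoundedLT.induction with
    | ind κ ih =>
      intro hκ k v hv hvA
      by_contra! hcon
      obtain ⟨l, hl, hlA⟩ := exists_lt_strategy_notMem hκ (hbase k v hv) hvA
      refine hcon 0 ?_
      have hnull : ∀ m, ∀ᵐ b ∂Q k, ¬ pos m (k + 1) (Hist.snoc v b) := fun m => by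
        rw [ae_iff]
        simpa using (hpos m k v).not.1 (hcon (m + 1))
      have hGae : ∀ᵐ b ∂Q k, ∀ i, b i ∈ G := by
        rw [ae_all_iff]
        exact fun i => (Measure.quasiMeasurePreserving_eval (fun _ => P) i).ae hG
      have : ∀ᵐ b ∂Q k, (strategy base α v fun i => (b i).1) ≠ fun i => (b i).2 := by
        filter_upwards [hGae, ae_all_iff.2 hnull] with b hb hn heq
        obtain ⟨m, hm⟩ := ih l hl (hl.le.trans hκ) (k + 1) (Hist.snoc v b)
          (fun j => by
            induction j using Fin.lastCases with
            | last => simpa using hb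
            | cast j => simpa using hv j)
          (by
            have := hlA fun i => (b i).1
            rw [heq] at this
            exact this)
        exact hn m hm
      rw [ae_iff] at this
      simp only [not_not, ne_eq] at this
      exact this
  have h2 : ∀ m k, histMeasure P d k {v | pos m k v} ≠ 0 →
      ∃ k, histMeasure P d k {v | matchProb P (strategy base α v) = 0} ≠ 0 := by
    intro m
    induction m with
    | zero => exact fun k hk => ⟨k, hk⟩
    | succ m ih =>
      intro k hk
      refine ih (k + 1) fun h0 => hk ?_
      have := Measure.measure_ae_null_of_prod_null
        ((measurePreserving_snoc P d k).quasiMeasurePreserving.preimage_null h0)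
      exact this
  obtain ⟨m, hm⟩ := h1 α le_rfl 0 (fun j => j.elim0) (fun j => j.elim0) (hroot _)
  refine h2 m 0 ?_
  have : {v : Hist X d 0 | pos m 0 v} = univ := by
    refine eq_univ_of_forall fun v => ?_
    rwa [Subsingleton.elim v fun j => j.elim0]
  rw [this]
  simp

end Nested

/-! ### One-inclusion graphs -/

section OneInclusion

variable {n : ℕ}

/-- No `t + 1` coordinates are shattered by `V`. -/
def ShatterFree (t : ℕ) (V : Set (Fin n → Bool)) : Prop :=
  ∀ τ : Fin (t + 1) → Fin n, Function.Injective τ → ∃ w : Fin (t + 1) → Bool, ∀ u ∈ V, u ∘ τ ≠ w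

theorem ShatterFree.mono {t : ℕ} {V V' : Set (Fin n → Bool)} (h : ShatterFree t V) (hV : V' ⊆ V) :
    ShatterFree t V' := fun τ hτ => (h τ hτ).imp fun _ hw u hu => hw u (hV hu)

/-- The edges in direction `i` of the one-inclusion graph on `V`, given by their lower endpoint. -/
def cubeEdges (V : Finset (Fin n → Bool)) (i : Fin n) : Finset (Fin n → Bool) :=
  V.filter fun u => u i = false ∧ Function.update u i true ∈ V

/-- The part of `V` above the value `b` of the first coordinate. -/
def cubeSlice (V : Finset (Fin (n + 1) → Bool)) (b : Bool) : Finset (Fin n → Bool) :=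
  Finset.univ.filter fun u => Fin.cons (α := fun _ => Bool) b u ∈ V

theorem mem_cubeEdges {V : Finset (Fin n → Bool)} {i : Fin n} {u : Fin n → Bool} :
    u ∈ cubeEdges V i ↔ u ∈ V ∧ u i = false ∧ Function.update u i true ∈ V := by
  simp [cubeEdges]

theorem mem_cubeSlice {V : Finset (Fin (n + 1) → Bool)} {b : Bool} {u : Fin n → Bool} :
    u ∈ cubeSlice V b ↔ Fin.cons (α := fun _ => Bool) b u ∈ V := by
  simp [cubeSlice]

theorem card_cubeSlice_add (V : Finset (Fin (n + 1) → Bool)) :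
    (cubeSlice V false).card + (cubeSlice V true).card = V.card := by
  have h : ∀ b, (cubeSlice V b).card = (V.filter fun u => u 0 = b).card := fun b => by
    rw [← Finset.card_map ⟨_, Fin.cons_right_injective (α := fun _ : Fin (n + 1) => Bool) b⟩]
    congr 1
    ext u
    simp only [Finset.mem_map, mem_cubeSlice, Function.Embedding.coeFn_mk, Finset.mem_filter]
    constructor
    · rintro ⟨u, hu, rfl⟩
      exact ⟨hu, rfl⟩
    · rintro ⟨hu, rfl⟩
      exact ⟨Fin.tail u, by rwa [Fin.cons_self_tail], Fin.cons_self_tail u⟩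
  rw [h, h, ← Finset.card_filter_add_card_filter_not (s := V) (fun u => u 0 = false)]
  simp

theorem card_cubeEdges_zero (V : Finset (Fin (n + 1) → Bool)) :
    (cubeEdges V 0).card = (cubeSlice V false ∩ cubeSlice V true).card := by
  rw [← Finset.card_map ⟨_, Fin.cons_right_injective (α := fun _ : Fin (n + 1) => Bool) false⟩]
  congr 1
  ext u
  simp only [Finset.mem_map, Finset.mem_inter, mem_cubeSlice, Function.Embedding.coeFn_mk,
    mem_cubeEdges]
  constructor
  · rintro ⟨hu, h0, h1⟩
    refine ⟨Fin.tail u, ⟨?_, ?_⟩, ?_⟩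
    · rwa [← h0, Fin.cons_self_tail]
    · rwa [← Fin.cons_self_tail u, Fin.update_cons_zero] at h1
    · rw [← h0, Fin.cons_self_tail]
  · rintro ⟨u, ⟨h0, h1⟩, rfl⟩
    exact ⟨h0, rfl, by rwa [Fin.update_cons_zero]⟩

theorem card_cubeEdges_succ (V : Finset (Fin (n + 1) → Bool)) (i : Fin n) :
    (cubeEdges V i.succ).card ≤
      (cubeEdges (cubeSlice V false) i).card + (cubeEdges (cubeSlice V true) i).card := by
  classical
  have h : cubeEdges V i.succ ⊆
      (cubeEdges (cubeSlice V false) i).image (Fin.cons (α := fun _ => Bool) false) ∪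
      (cubeEdges (cubeSlice V true) i).image (Fin.cons (α := fun _ => Bool) true) := by
    intro u hu
    obtain ⟨b, u, rfl⟩ : ∃ b u', u = Fin.cons (α := fun _ => Bool) b u' :=
      ⟨u 0, Fin.tail u, (Fin.cons_self_tail u).symm⟩
    rw [mem_cubeEdges, Fin.cons_succ, ← Fin.cons_update] at hu
    rw [Finset.mem_union]
    cases b
    · exact .inl (Finset.mem_image_of_mem _ (by simpa [mem_cubeEdges, mem_cubeSlice] using hu))
    · exact .inr (Finset.mem_image_of_mem _ (by simpa [mem_cubeEdges, mem_cubeSlice] using hu))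
  refine (Finset.card_le_card h).trans ((Finset.card_union_le _ _).trans ?_)
  exact add_le_add Finset.card_image_le Finset.card_image_le

theorem card_cubeEdges_add_le (A B : Finset (Fin n → Bool)) (i : Fin n) :
    (cubeEdges A i).card + (cubeEdges B i).card ≤
      (cubeEdges (A ∪ B) i).card + (cubeEdges (A ∩ B) i).card := by
  rw [← Finset.card_union_add_card_inter]
  refine add_le_add (Finset.card_le_card fun u => ?_) (Finset.card_le_card fun u => ?_)
  · simp only [Finset.mem_union, mem_cubeEdges]
    tauto
  · simp only [Finset.mem_inter, mem_cubeEdges]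
    tauto

/-- Haussler–Littlestone–Warmuth: the one-inclusion graph of a set of Vapnik–Chervonenkis dimension
at most `t` has edge density at most `t`. -/
theorem sum_card_cubeEdges_le (t : ℕ) (V : Finset (Fin n → Bool)) 
    (hV : ShatterFree t {u | u ∈ V}) :
    ∑ i, (cubeEdges V i).card ≤ t * V.card := by
  induction n generalizing t with
  | zero => simp
  | succ n ih =>
    let A := cubeSlice V false
    let B := cubeSlice V true
    have hU : ShatterFree t {u | u ∈ A ∪ B} := by
      intro τ hτ
      obtain ⟨w, hw⟩ := hV (Fin.succ ∘ τ) ((Fin.succ_injective n).comp hτ)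
      refine ⟨w, fun u hu => ?_⟩
      rw [mem_ofPred_eq, Finset.mem_union, mem_cubeSlice, mem_cubeSlice] at hu
      rcases hu with hu | hu <;> exact hw _ hu
    have hI : ∑ i, (cubeEdges (A ∩ B) i).card + (A ∩ B).card ≤ t * (A ∩ B).card := by
      cases t with
      | zero =>
        have : A ∩ B = ∅ := by
          by_contra hne
          obtain ⟨u, hu⟩ := Finset.nonempty_iff_ne_empty.2 hne
          obtain ⟨w, hw⟩ := hV (fun _ => 0) (fun a b _ => Subsingleton.elim (α := Fin 1) a b)
          rw [Finset.mem_inter, mem_cubeSlice, mem_cubeSlice] at hu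
          have h1 : Fin.cons (α := fun _ => Bool) (w 0) u ∈ V := by
            cases h : w 0
            · exact hu.1
            · exact hu.2
          refine hw _ h1 (funext fun a => ?_)
          rw [Subsingleton.elim (α := Fin 1) a 0]
          rfl
        simp [this, cubeEdges]
      | succ t =>
        have h1 : ShatterFree t {u | u ∈ A ∩ B} := by
          intro τ hτ
          obtain ⟨w, hw⟩ := hV (Fin.cons (α := fun _ => Fin (n + 1)) 0 (Fin.succ ∘ τ)) (by
            rw [Fin.cons_injective_iff]
            exact ⟨by simp [Fin.succ_ne_zero], (Fin.succ_injective n).comp hτ⟩)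
          refine ⟨Fin.tail w, fun u hu h => ?_⟩
          rw [mem_ofPred_eq, Finset.mem_inter, mem_cubeSlice, mem_cubeSlice] at hu
          have h1 : Fin.cons (α := fun _ => Bool) (w 0) u ∈ V := by
            cases h : w 0
            · exact hu.1
            · exact hu.2
          refine hw _ h1 (funext fun a => ?_)
          induction a using Fin.cases with
          | zero => rfl
          | succ a => exact congrFun h a
        have := ih t _ h1
        nlinarith
    have hsum : ∑ i : Fin n, (cubeEdges V i.succ).card ≤
        ∑ i, (cubeEdges (A ∪ B) i).card + ∑ i, (cubeEdges (A ∩ B) i).card := by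
      rw [← Finset.sum_add_distrib]
      exact Finset.sum_le_sum fun i _ =>
        (card_cubeEdges_succ V i).trans (card_cubeEdges_add_le A B i)
    have hc : V.card = (A ∪ B).card + (A ∩ B).card := by
      rw [Finset.card_union_add_card_inter, card_cubeSlice_add]
    rw [Fin.sum_univ_succ, card_cubeEdges_zero, hc, mul_add]
    have := ih t _ hU
    change (A ∩ B).card + _ ≤ _
    omega

/-- The one-inclusion prediction rule. -/
theorem exists_oneInclusion_predictor (t : ℕ) (V : Set (Fin n → Bool)) (hV : ShatterFree t V) :
    ∃ pred : Fin n → (Fin n → Bool) → Bool,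
      (∀ i u b, pred i (Function.update u i b) = pred i u) ∧
      ∀ u ∈ V, (Finset.univ.filter fun i => pred i u ≠ u i).card ≤ t := by
  classical
  let W : Finset (Fin n → Bool) := V.toFinite.toFinset
  have hW : ∀ u, u ∈ W ↔ u ∈ V := fun u => by simp [W]
  let E := {e : Fin n × (Fin n → Bool) // e.2 ∈ cubeEdges W e.1}
  let ends : E → Finset (Fin n → Bool) := fun e => {e.1.2, Function.update e.1.2 e.1.1 true}
  let T : E → Finset ((Fin n → Bool) × Fin t) := fun e => ends e ×ˢ Finset.univ
  have hall : ∀ S : Finset E, S.card ≤ (S.biUnion T).card := by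
    intro S
    let U := S.biUnion ends
    have hUV : {u | u ∈ U} ⊆ V := by
      intro u hu
      obtain ⟨e, -, hu⟩ := Finset.mem_biUnion.1 hu
      have he := mem_cubeEdges.1 e.2
      rw [hW, hW] at he
      rcases Finset.mem_insert.1 hu with rfl | hu
      · exact he.1
      · rw [Finset.mem_singleton.1 hu]
        exact he.2.2
    have h1 := sum_card_cubeEdges_le t U (hV.mono hUV)
    have h2 : S.biUnion T = U ×ˢ Finset.univ := by
      ext p
      simp [T, U]
    rw [h2, Finset.card_product, Finset.card_univ, Fintype.card_fin, mul_comm]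
    refine le_trans ?_ h1
    rw [← Finset.card_sigma]
    refine Finset.card_le_card_of_injOn (fun e => ⟨e.1.1, e.1.2⟩) (fun e he => ?_) ?_
    · have hend : ∀ u ∈ ends e, u ∈ U := fun u hu => Finset.mem_biUnion.2 ⟨e, he, hu⟩
      simp only [Finset.coe_sigma, Set.mem_sigma_iff, Finset.coe_univ, mem_univ, true_and,
        Finset.mem_coe, mem_cubeEdges]
      exact ⟨hend _ (by simp [ends]), (mem_cubeEdges.1 e.2).2.1, hend _ (by simp [ends])⟩
    · intro e _ e' _ h
      simp only [Sigma.mk.injEq, heq_eq_eq] at h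
      exact Subtype.ext (Prod.ext h.1 h.2)
  obtain ⟨f, hf, hfT⟩ := (Finset.all_card_le_biUnion_card_iff_exists_injective T).1 hall
  let lo : Fin n → (Fin n → Bool) → Fin n → Bool := fun i u => Function.update u i false
  let hi : Fin n → (Fin n → Bool) → Fin n → Bool := fun i u => Function.update u i true
  let pred : Fin n → (Fin n → Bool) → Bool := fun i u =>
    if h : lo i u ∈ cubeEdges W i then decide ((f ⟨(i, lo i u), h⟩).1 = lo i u)
    else decide (hi i u ∈ W)
  refine ⟨pred, fun i u b => by simp only [pred, lo, hi, Function.update_idem], fun u hu => ?_⟩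
  have key : ∀ i, pred i u ≠ u i → ∃ h : lo i u ∈ cubeEdges W i, (f ⟨(i, lo i u), h⟩).1 = u := by
    intro i hi'
    by_cases h : lo i u ∈ cubeEdges W i
    · refine ⟨h, ?_⟩
      have hm := (Finset.mem_product.1 (hfT ⟨(i, lo i u), h⟩)).1
      simp only [ends, lo, Function.update_idem, Finset.mem_insert, Finset.mem_singleton] at hm
      simp only [pred, h, dif_pos] at hi'
      cases hb : u i with
      | false =>
        rw [hb] at hi'
        have h1 : lo i u = u := by simp [lo, ← hb]
        have h2 : (f ⟨(i, lo i u), h⟩).1 = lo i u := by simpa using hi'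
        rw [h2, h1]
      | true =>
        rw [hb] at hi'
        have h1 : hi i u = u := by simp [hi, ← hb]
        have h2 : (f ⟨(i, lo i u), h⟩).1 ≠ lo i u := by simpa using hi'
        exact (hm.resolve_left h2).trans h1
    · exfalso
      simp only [pred, h, dif_neg, not_false_eq_true] at hi'
      cases hb : u i with
      | false =>
        rw [hb] at hi'
        have h1 : lo i u = u := by simp [lo, ← hb]
        have h2 : hi i u ∈ W := by simpa using hi'
        refine h (mem_cubeEdges.2 ⟨?_, by simp [lo], ?_⟩)
        · rw [h1]
          exact (hW u).2 hu
        · simpa [lo, hi] using h2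
      | true =>
        rw [hb] at hi'
        have h1 : hi i u = u := by simp [hi, ← hb]
        rw [h1] at hi'
        simp [(hW u).2 hu] at hi'
  rw [← Fintype.card_subtype, ← Fintype.card_fin t]
  refine Fintype.card_le_of_injective (fun i => (f ⟨(i.1, lo i.1 u), (key i.1 i.2).1⟩).2) fun i j hij => ?_
  have h := hf (Prod.ext ((key i.1 i.2).2.trans (key j.1 j.2).2.symm) hij)
  exact Subtype.ext (Prod.ext_iff.1 (Subtype.ext_iff.1 h)).1

end OneInclusion

/-! ### Learning from a pattern avoiding rule -/

theorem measurePreserving_comp_injective {ι κ Ω : Type*} [Fintype ι] [Fintype κ]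
    [MeasurableSpace Ω] (P : Measure Ω) [IsProbabilityMeasure P] {τ : ι → κ}
    (hτ : Function.Injective τ) :
    MeasurePreserving (fun w : κ → Ω => w ∘ τ) (Measure.pi fun _ => P) (Measure.pi fun _ => P) := by
  have hm : Measurable fun w : κ → Ω => w ∘ τ := by fun_prop
  refine ⟨hm, (Measure.pi_eq fun s hs => ?_).symm⟩
  rw [Measure.map_apply hm (.univ_pi hs)]
  have : (fun w : κ → Ω => w ∘ τ) ⁻¹' univ.pi s =
      univ.pi (Function.extend τ s fun _ => univ) := by
    ext w
    simp only [mem_preimage, mem_univ_pi]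
    constructor
    · intro h j
      by_cases hj : ∃ i, τ i = j
      · obtain ⟨i, rfl⟩ := hj
        rw [hτ.extend_apply]
        exact h i
      · rw [Function.extend_apply' _ _ _ hj]
        trivial
    · intro h i
      have := h (τ i)
      rwa [hτ.extend_apply] at this
  rw [this, Measure.pi_pi]
  refine (Fintype.prod_of_injective τ hτ _ _ (fun j hj => ?_) fun i => ?_).symm
  · rw [Function.extend_apply' _ _ _ hj, measure_univ]
  · rw [hτ.extend_apply]

section PatternRule

variable {X : Type*} {t n : ℕ}

/-- Labellings which avoid the forbidden patterns `F`. -/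
def avoidSet (F : (Fin (t + 1) ↪ Fin n) → Fin (t + 1) → Bool) : Set (Fin n → Bool) :=
  {u | ∀ τ : Fin (t + 1) ↪ Fin n, u ∘ τ ≠ F τ}

theorem shatterFree_avoidSet (F : (Fin (t + 1) ↪ Fin n) → Fin (t + 1) → Bool) :
    ShatterFree t (avoidSet F) := fun τ hτ => ⟨F ⟨τ, hτ⟩, fun _ hu => hu ⟨τ, hτ⟩⟩

/-- The one-inclusion predictor of the labellings which avoid the forbidden patterns `F`. -/
noncomputable def oneInclusion (F : (Fin (t + 1) ↪ Fin n) → Fin (t + 1) → Bool) :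
    Fin n → (Fin n → Bool) → Bool :=
  (exists_oneInclusion_predictor t _ (shatterFree_avoidSet F)).choose

theorem oneInclusion_update (F : (Fin (t + 1) ↪ Fin n) → Fin (t + 1) → Bool) (i : Fin n)
    (u : Fin n → Bool) (b : Bool) :
    oneInclusion F i (Function.update u i b) = oneInclusion F i u :=
  (exists_oneInclusion_predictor t _ (shatterFree_avoidSet F)).choose_spec.1 i u b

theorem card_oneInclusion_ne_le (F : (Fin (t + 1) ↪ Fin n) → Fin (t + 1) → Bool)
    {u : Fin n → Bool} (hu : u ∈ avoidSet F) :
    (Finset.univ.filter fun i => oneInclusion F i u ≠ u i).card ≤ t :=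
  (exists_oneInclusion_predictor t _ (shatterFree_avoidSet F)).choose_spec.2 u hu

/-- The prediction of the label of the `i`-th point of `w` by the one-inclusion predictor for the
patterns forbidden by `g`. -/
noncomputable def leaveOneOut (g : (Fin (t + 1) → X) → Fin (t + 1) → Bool) (w : Fin n → X × Bool)
    (i : Fin n) : Bool :=
  oneInclusion (fun τ => g fun j => (w (τ j)).1) i fun j => (w j).2

theorem leaveOneOut_congr (g : (Fin (t + 1) → X) → Fin (t + 1) → Bool) {w w' : Fin n → X × Bool}
    (i : Fin n) (h : ∀ j ≠ i, w j = w' j) (hi : (w i).1 = (w' i).1) :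
    leaveOneOut g w i = leaveOneOut g w' i := by
  have h1 : ∀ j, (w j).1 = (w' j).1 := fun j => by
    by_cases hj : j = i
    · rw [hj, hi]
    · rw [h j hj]
  have h2 : (fun j => (w j).2) = Function.update (fun j => (w' j).2) i (w i).2 := by
    funext j
    by_cases hj : j = i
    · subst hj; simp
    · simp [hj, h j hj]
  simp only [leaveOneOut, h1, h2, oneInclusion_update]

/-- The majority vote of the leave-one-out predictions over all positions of the new point. -/
noncomputable def patternRule (g : (Fin (t + 1) → X) → Fin (t + 1) → Bool) (b : Fin n → X × Bool)
    (x : X) : Bool :=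
  decide (n + 1 ≤ 2 * (Finset.univ.filter fun i : Fin (n + 1) =>
    leaveOneOut g (i.insertNth (α := fun _ => X × Bool) (x, false) b) i = true).card)

theorem le_two_mul_card_of_patternRule_ne {g : (Fin (t + 1) → X) → Fin (t + 1) → Bool}
    {b : Fin n → X × Bool} {p : X × Bool} (h : patternRule g b p.1 ≠ p.2) :
    n + 1 ≤ 2 * (Finset.univ.filter fun i : Fin (n + 1) =>
      leaveOneOut g (i.insertNth (α := fun _ => X × Bool) p b) i ≠ p.2).card := by
  have h1 : ∀ i : Fin (n + 1), leaveOneOut g (i.insertNth (α := fun _ => X × Bool) p b) i =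
      leaveOneOut g (i.insertNth (α := fun _ => X × Bool) (p.1, false) b) i := fun i => by
    refine leaveOneOut_congr g i (fun j hj => ?_) (by simp)
    obtain ⟨j, rfl⟩ := Fin.exists_succAbove_eq hj
    simp
  simp only [h1]
  rw [patternRule] at h
  have h2 := Finset.card_filter_add_card_filter_not (s := (Finset.univ : Finset (Fin (n + 1))))
    (fun i => leaveOneOut g (i.insertNth (α := fun _ => X × Bool) (p.1, false) b) i = true)
  rw [Finset.card_univ, Fintype.card_fin] at h2
  cases hp : p.2 with
  | false =>
    rw [hp] at h
    simpa using h
  | true =>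
    rw [hp] at h
    have h3 : ¬ (n + 1 ≤ 2 * (Finset.univ.filter fun i : Fin (n + 1) =>
      leaveOneOut g (i.insertNth (α := fun _ => X × Bool) (p.1, false) b) i = true).card) := by
      simpa using h
    simp only [ne_eq]
    omega

variable [MeasurableSpace X]

theorem measurable_leaveOneOut {Ω : Type*} [MeasurableSpace Ω]
    {g : Ω → (Fin (t + 1) → X) → Fin (t + 1) → Bool}
    (hg : Measurable[univMS (Ω × (Fin (t + 1) → X))] fun p : Ω × (Fin (t + 1) → X) => g p.1 p.2)
    (i : Fin n) : Measurable[univMS (Ω × (Fin n → X × Bool))]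
      fun p : Ω × (Fin n → X × Bool) => leaveOneOut (g p.1) p.2 i := by
  let Φ : ((Fin (t + 1) ↪ Fin n) → Fin (t + 1) → Bool) × (Fin n → Bool) → Bool :=
    fun q => oneInclusion q.1 i q.2
  have hΦ : Measurable Φ := measurable_of_finite Φ
  have h1 : Measurable[univMS (Ω × (Fin n → X × Bool))]
      fun p : Ω × (Fin n → X × Bool) => ((fun τ : Fin (t + 1) ↪ Fin n =>
        g p.1 fun j => (p.2 (τ j)).1), fun j => (p.2 j).2) := by
    refine Measurable.prodMk (@measurable_pi_lambda _ _ _ (univMS (Ω × (Fin n → X × Bool))) _ _ fun τ => ?_) ?_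
    · exact hg.comp (Measurable.univMS (f := fun p : Ω × (Fin n → X × Bool) =>
        (p.1, fun j => (p.2 (τ j)).1)) (by fun_prop))
    · have : Measurable fun p : Ω × (Fin n → X × Bool) => fun j => (p.2 j).2 := by fun_prop
      exact fun s hs => (this hs).univMS
  exact hΦ.comp h1

theorem measurable_patternRule {Ω : Type*} [MeasurableSpace Ω]
    {g : Ω → (Fin (t + 1) → X) → Fin (t + 1) → Bool}
    (hg : Measurable[univMS (Ω × (Fin (t + 1) → X))] fun p : Ω × (Fin (t + 1) → X) => g p.1 p.2) :
    Measurable[univMS (Ω × (Fin n → X × Bool) × X)]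
      fun p : Ω × (Fin n → X × Bool) × X => patternRule (g p.1) p.2.1 p.2.2 := by
  let Φ : (Fin (n + 1) → Bool) → Bool := fun q =>
    decide (n + 1 ≤ 2 * (Finset.univ.filter fun i : Fin (n + 1) => q i = true).card)
  have hΦ : Measurable Φ := measurable_of_finite Φ
  refine hΦ.comp (@measurable_pi_lambda _ _ _ (univMS (Ω × (Fin n → X × Bool) × X)) _ _ fun i => ?_)
  refine (measurable_leaveOneOut hg i).comp (Measurable.univMS
    (f := fun p : Ω × (Fin n → X × Bool) × X =>
      (p.1, i.insertNth (α := fun _ => X × Bool) (p.2.2, false) p.2.1)) ?_)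
  refine measurable_fst.prodMk (measurable_pi_lambda _ fun j => ?_)
  induction j using Fin.succAboveCases i with
  | x => simp only [Fin.insertNth_apply_same]; fun_prop
  | p j => simp only [Fin.insertNth_apply_succAbove]; fun_prop

theorem lintegral_errP_patternRule_le (P : Measure (X × Bool)) [IsProbabilityMeasure P]
    {g : (Fin (t + 1) → X) → Fin (t + 1) → Bool} (hg : Measurable[univMS (Fin (t + 1) → X)] g)
    (h0 : matchProb P g = 0) :
    ∫⁻ b, errP P (patternRule g b) ∂(Measure.pi fun _ : Fin n => P) ≤ 2 * t / (n + 1) := by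
  let S : Fin (n + 1) → Set (Fin (n + 1) → X × Bool) := fun i => {w | leaveOneOut g w i ≠ (w i).2}
  have hSm : ∀ i, NullMeasurableSet (S i) (Measure.pi fun _ => P) := by
    intro i
    have h1 : Measurable[univMS (Fin (n + 1) → X × Bool)] fun w => leaveOneOut (n := n + 1) g w i := by
      refine (measurable_leaveOneOut (Ω := Unit) (g := fun _ => g) (hg.comp
        (Measurable.univMS measurable_snd)) i).comp
        (Measurable.univMS (f := fun w : Fin (n + 1) → X × Bool => ((), w)) (by fun_prop))
    have h2 : Measurable[univMS (Fin (n + 1) → X × Bool)] fun w : Fin (n + 1) → X × Bool => (w i).2 := by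
      have : Measurable fun w : Fin (n + 1) → X × Bool => (w i).2 := by fun_prop
      exact fun s hs => (this hs).univMS
    have h3 : MeasurableSet[univMS (Fin (n + 1) → X × Bool)] (S i)ᶜ := by
      simp only [S, ne_eq, compl_ofPred, not_not]
      exact measurableSet_eq_fun h1 h2
    exact (nullMeasurableSet_of_univMS h3 _).of_compl
  have hae : ∀ᵐ w ∂(Measure.pi fun _ : Fin (n + 1) => P), ∑ i, (S i).indicator 1 w ≤ (t : ℝ≥0∞) := by
    have : ∀ᵐ w ∂(Measure.pi fun _ : Fin (n + 1) => P), ∀ τ : Fin (t + 1) ↪ Fin (n + 1),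
        (g fun j => (w (τ j)).1) ≠ fun j => (w (τ j)).2 := by
      rw [ae_all_iff]
      intro τ
      refine (measurePreserving_comp_injective P τ.injective).quasiMeasurePreserving.ae
        (p := fun b => (g fun j => (b j).1) ≠ fun j => (b j).2) ?_
      simpa [ae_iff, matchProb] using h0
    filter_upwards [this] with w hw
    have := card_oneInclusion_ne_le (fun τ => g fun j => (w (τ j)).1)
      (u := fun j => (w j).2) (fun τ => (hw τ).symm)
    refine le_trans (le_of_eq ?_) (Nat.cast_le.2 this)
    rw [Finset.card_filter, Nat.cast_sum]
    refine Finset.sum_congr rfl fun i _ => ?_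
    simp [S, indicator_apply, leaveOneOut]
  have hsum : ∑ i, Measure.pi (fun _ => P) (S i) ≤ (t : ℝ≥0∞) := by
    calc ∑ i, Measure.pi (fun _ => P) (S i)
        = ∫⁻ w, ∑ i, (S i).indicator 1 w ∂(Measure.pi fun _ : Fin (n + 1) => P) := by
          rw [lintegral_finsetSum' (f := fun i => (S i).indicator 1) _ fun i _ =>
            (aemeasurable_const (b := (1 : ℝ≥0∞))).indicator₀ (hSm i)]
          exact Finset.sum_congr rfl fun i _ => (lintegral_indicator_one₀ (hSm i)).symm
      _ ≤ ∫⁻ w, t ∂(Measure.pi fun _ : Fin (n + 1) => P) := lintegral_mono_ae hae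
      _ = t := by simp
  let S' : Fin (n + 1) → Set ((Fin n → X × Bool) × (X × Bool)) := fun i =>
    {q | leaveOneOut g (i.insertNth (α := fun _ => X × Bool) q.2 q.1) i ≠ q.2.2}
  let ν := (Measure.pi fun _ : Fin n => P).prod P
  have hS' : ∀ i, ν (S' i) = Measure.pi (fun _ => P) (S i) := by
    intro i
    have h1 : MeasurePreserving (fun q : (Fin n → X × Bool) × (X × Bool) =>
        i.insertNth (α := fun _ => X × Bool) q.2 q.1) ν (Measure.pi fun _ => P) :=
      (measurePreserving_piFinSuccAbove (fun _ => P) i).symm.comp Measure.measurePreserving_swap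
    rw [← h1.measure_preimage (hSm i)]
    congr 1
    ext q
    simp [S', S]
  have hle : ∀ q, (((Finset.univ.filter fun i => q ∈ S' i).card : ℕ) : ℝ≥0∞) ≤
      ∑ i, (toMeasurable ν (S' i)).indicator 1 q := by
    intro q
    rw [Finset.card_filter, Nat.cast_sum]
    refine Finset.sum_le_sum fun i _ => ?_
    by_cases h : q ∈ S' i
    · simp [h, subset_toMeasurable ν (S' i) h]
    · simp [h]
  calc ∫⁻ b, errP P (patternRule g b) ∂(Measure.pi fun _ : Fin n => P)
      ≤ ∫⁻ b, P (Prod.mk b ⁻¹' toMeasurable ν {q | patternRule g q.1 q.2.1 ≠ q.2.2})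
          ∂(Measure.pi fun _ : Fin n => P) :=
        lintegral_mono fun b => measure_mono fun p hp => subset_toMeasurable ν _ hp
    _ = ν {q | patternRule g q.1 q.2.1 ≠ q.2.2} := by
        rw [← Measure.prod_apply (measurableSet_toMeasurable _ _), measure_toMeasurable]
    _ ≤ ν {q | (((n + 1 : ℕ) : ℝ≥0∞) / 2) ≤ ∑ i, (toMeasurable ν (S' i)).indicator 1 q} := by
        refine measure_mono fun q hq => ?_
        refine (ENNReal.div_le_of_le_mul' ?_).trans (hle q)
        exact_mod_cast le_two_mul_card_of_patternRule_ne hq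
    _ ≤ (∫⁻ q, ∑ i, (toMeasurable ν (S' i)).indicator 1 q ∂ν) / (((n + 1 : ℕ) : ℝ≥0∞) / 2) := by
        refine meas_ge_le_lintegral_div (Measurable.aemeasurable ?_) ?_ ?_
        · exact Finset.measurable_sum _ fun i _ =>
            measurable_one.indicator (measurableSet_toMeasurable _ _)
        · simp
        · exact ENNReal.div_ne_top (ENNReal.natCast_ne_top _) (by simp)
    _ = (∑ i, Measure.pi (fun _ => P) (S i)) / (((n + 1 : ℕ) : ℝ≥0∞) / 2) := by
        rw [lintegral_finsetSum _ fun i _ =>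
          measurable_one.indicator (measurableSet_toMeasurable _ _)]
        congr 1
        refine Finset.sum_congr rfl fun i _ => ?_
        rw [lintegral_indicator_one (measurableSet_toMeasurable _ _), measure_toMeasurable, hS']
    _ ≤ t / (((n + 1 : ℕ) : ℝ≥0∞) / 2) := by gcongr
    _ = 2 * t / (n + 1) := by
        rw [div_eq_mul_inv, ENNReal.inv_div (by simp) (by simp), ENNReal.div_eq_inv_mul,
          ENNReal.div_eq_inv_mul]
        push_cast
        ring

end PatternRule

/-! ### Tail bounds for the number of visits to a set -/

section Tail

variable {Ω : Type*} [MeasurableSpace Ω] (ν : Measure Ω) [IsProbabilityMeasure ν]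

open Classical in
theorem measure_one_le_prod_ite_le (S : Set Ω) (c e : ℝ≥0∞) (N : ℕ) :
    Measure.pi (fun _ : Fin N => ν) {v | 1 ≤ ∏ i, if v i ∈ S then c else e} ≤
      (c * ν S + e * ν Sᶜ) ^ N := by
  let box : Finset (Fin N) → Set (Fin N → Ω) := fun A => univ.pi fun i => if i ∈ A then S else Sᶜ
  let w : Finset (Fin N) → ℝ≥0∞ := fun A => ∏ i, if i ∈ A then c else e
  have hsub : {v : Fin N → Ω | 1 ≤ ∏ i, if v i ∈ S then c else e} ⊆
      ⋃ A ∈ (Finset.univ : Finset (Finset (Fin N))).filter fun A => 1 ≤ w A, box A := by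
    intro v hv
    refine mem_iUnion₂.2 ⟨Finset.univ.filter fun i => v i ∈ S, ?_, ?_⟩
    · simpa [w] using hv
    · intro i _
      by_cases h : v i ∈ S <;> simp [h]
  calc _ ≤ ∑ A ∈ (Finset.univ : Finset (Finset (Fin N))).filter fun A => 1 ≤ w A,
        Measure.pi (fun _ : Fin N => ν) (box A) :=
        (measure_mono hsub).trans (measure_biUnion_finset_le _ _)
    _ ≤ ∑ A ∈ (Finset.univ : Finset (Finset (Fin N))).filter fun A => 1 ≤ w A,
        w A * Measure.pi (fun _ : Fin N => ν) (box A) :=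
        Finset.sum_le_sum fun A hA => le_mul_of_one_le_left' (Finset.mem_filter.1 hA).2
    _ ≤ ∑ A : Finset (Fin N), w A * Measure.pi (fun _ : Fin N => ν) (box A) :=
        Finset.sum_le_sum_of_subset (Finset.filter_subset _ _)
    _ = ∑ A : Finset (Fin N), ∏ i, if i ∈ A then c * ν S else e * ν Sᶜ := by
        refine Finset.sum_congr rfl fun A _ => ?_
        rw [Measure.pi_pi, ← Finset.prod_mul_distrib]
        refine Finset.prod_congr rfl fun i _ => ?_
        split_ifs <;> rfl
    _ = (c * ν S + e * ν Sᶜ) ^ N := by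
        have := Finset.prod_add (fun _ : Fin N => c * ν S) (fun _ => e * ν Sᶜ) Finset.univ
        rw [Finset.prod_const, Finset.card_univ, Fintype.card_fin, Finset.powerset_univ] at this
        rw [this]
        refine Finset.sum_congr rfl fun A _ => ?_
        rw [Finset.prod_ite]
        congr 1 <;> refine Finset.prod_congr ?_ fun _ _ => rfl <;> ext <;> simp

open Classical in
theorem prod_ite_eq_pow {Ω : Type*} (S : Set Ω) (c e : ℝ≥0∞) {N : ℕ} (v : Fin N → Ω) :
    ∏ i, (if v i ∈ S then c * e else e) =
      c ^ (Finset.univ.filter fun i => v i ∈ S).card * e ^ N := by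
  rw [Finset.prod_congr rfl (g := fun i => (if v i ∈ S then c else 1) * e)
    fun i _ => by split_ifs <;> simp, Finset.prod_mul_distrib, Finset.prod_ite]
  simp

open Classical in
/-- The number of visits to a set of small probability is rarely a large fraction. -/
theorem measure_le_mul_card_le {S : Set Ω} {q : ℕ} (hS : ν S ≤ (2 ^ q)⁻¹ / 2) (N : ℕ) :
    Measure.pi (fun _ : Fin N => ν) {v | N ≤ q * (Finset.univ.filter fun i => v i ∈ S).card} ≤
      (3 / 4) ^ N := by
  have h2 : (2 : ℝ≥0∞)⁻¹ ≠ ⊤ := by simp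
  refine (measure_mono fun v hv => ?_).trans <|
    (measure_one_le_prod_ite_le ν S (2 ^ q * 2⁻¹) 2⁻¹ N).trans (pow_le_pow_left' ?_ N)
  · simp only [mem_ofPred_eq] at hv ⊢
    rw [prod_ite_eq_pow, ← pow_mul]
    calc (1 : ℝ≥0∞) = 2 ^ N * 2⁻¹ ^ N := by
          rw [← mul_pow, ENNReal.mul_inv_cancel (by simp) (by simp), one_pow]
      _ ≤ _ := by gcongr; norm_num
  · calc 2 ^ q * 2⁻¹ * ν S + 2⁻¹ * ν Sᶜ ≤ 2 ^ q * 2⁻¹ * ((2 ^ q)⁻¹ / 2) + 2⁻¹ * 1 := by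
          gcongr; exact prob_le_one
      _ = (2 ^ q * (2 ^ q)⁻¹) * (2⁻¹ * 2⁻¹) + 2⁻¹ := by rw [div_eq_mul_inv]; ring
      _ = 2⁻¹ * 2⁻¹ + 2⁻¹ := by
          rw [ENNReal.mul_inv_cancel (by simp) (by simp), one_mul]
      _ = 3 / 4 := by
          refine (ENNReal.toReal_eq_toReal_iff' ?_ ?_).1 ?_
          · simp [ENNReal.mul_eq_top]
          · exact ENNReal.div_ne_top (by simp) (by simp)
          · rw [ENNReal.toReal_add (by simp [ENNReal.mul_eq_top]) (by simp)]
            norm_num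
      _ ≤ _ := le_rfl

open Classical in
/-- The number of visits to a set of positive probability is rarely a small fraction. -/
theorem exists_measure_mul_card_lt_le {S : Set Ω} (hS : NullMeasurableSet S ν) (h0 : ν S ≠ 0) :
    ∃ q : ℕ, ∃ ρ : ℝ≥0∞, ρ < 1 ∧ ∀ N,
      Measure.pi (fun _ : Fin N => ν)
        {v | q * (Finset.univ.filter fun i => v i ∈ S).card < N} ≤ ρ ^ N := by
  have hb : ν Sᶜ < 1 := by
    rw [prob_compl_eq_one_sub₀ hS]
    exact ENNReal.sub_lt_self (by simp) (by simp) h0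
  have hsum : ν S = 1 - ν Sᶜ := by
    rw [prob_compl_eq_one_sub₀ hS, ENNReal.sub_sub_cancel (by simp) prob_le_one]
  set b := (ν Sᶜ).toReal with hbdef
  have hbE : ν Sᶜ = ENNReal.ofReal b := (ENNReal.ofReal_toReal hb.ne_top).symm
  have hb0 : 0 ≤ b := ENNReal.toReal_nonneg
  have hb1 : b < 1 := by
    rw [hbdef, ← ENNReal.toReal_one]
    exact (ENNReal.toReal_lt_toReal hb.ne_top (by simp)).2 hb
  have hSE : ν S = ENNReal.ofReal (1 - b) := by
    rw [hsum, hbE, ENNReal.ofReal_sub _ hb0, ENNReal.ofReal_one]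
  obtain ⟨r, hr1, hr2⟩ : ∃ r : ℝ, 1 < r ∧ r < 2 / (1 + b) :=
    exists_between (by rw [lt_div_iff₀ (by linarith)]; linarith)
  obtain ⟨q, hq⟩ := pow_unbounded_of_one_lt 2 hr1
  have hr0 : 0 ≤ r := by linarith
  refine ⟨q, ENNReal.ofReal (r * (1 + b) / 2), ?_, fun N => ?_⟩
  · rw [← ENNReal.ofReal_one]
    refine (ENNReal.ofReal_lt_ofReal_iff one_pos).2 ?_
    rw [lt_div_iff₀ (by linarith)] at hr2
    linarith
  · refine (measure_mono fun v hv => ?_).trans <|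
      (measure_one_le_prod_ite_le ν S (2⁻¹ * ENNReal.ofReal r) (ENNReal.ofReal r) N).trans_eq ?_
    · simp only [mem_ofPred_eq] at hv ⊢
      rw [prod_ite_eq_pow]
      set s := (Finset.univ.filter fun i => v i ∈ S).card
      have hle : (2 : ℝ≥0∞) ^ s ≤ ENNReal.ofReal r ^ N :=
        calc (2 : ℝ≥0∞) ^ s = ENNReal.ofReal (2 ^ s) := by
              rw [ENNReal.ofReal_pow (by norm_num)]; simp
          _ ≤ ENNReal.ofReal (r ^ N) := by
              refine ENNReal.ofReal_le_ofReal ?_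
              calc (2 : ℝ) ^ s ≤ (r ^ q) ^ s := by gcongr
                _ = r ^ (q * s) := (pow_mul ..).symm
                _ ≤ r ^ N := pow_le_pow_right₀ hr1.le hv.le
          _ = _ := ENNReal.ofReal_pow hr0 N
      calc (1 : ℝ≥0∞) = 2⁻¹ ^ s * 2 ^ s := by
            rw [← mul_pow, ENNReal.inv_mul_cancel (by simp) (by simp), one_pow]
        _ ≤ 2⁻¹ ^ s * ENNReal.ofReal r ^ N := by gcongr
    · congr 1
      have : (2⁻¹ : ℝ≥0∞) = ENNReal.ofReal 2⁻¹ := by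
        rw [ENNReal.ofReal_inv_of_pos (by norm_num)]; simp
      rw [hSE, hbE, this, ← ENNReal.ofReal_mul (by norm_num), ← ENNReal.ofReal_mul (by positivity),
        ← ENNReal.ofReal_mul hr0, ← ENNReal.ofReal_add (by nlinarith) (by positivity)]
      congr 1
      ring

end Tail

/-! ### Cutting a sample into chunks -/

section Chunk

theorem measurePreserving_curry {ι Ω : Type*} {κ : ι → Type*} [Fintype ι] [∀ i, Fintype (κ i)]
    [MeasurableSpace Ω] (P : Measure Ω) [IsProbabilityMeasure P] :
    MeasurePreserving (fun (w : (Σ i, κ i) → Ω) i k => w ⟨i, k⟩) (Measure.pi fun _ => P)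
      (Measure.pi fun i => Measure.pi fun _ : κ i => P) := by
  have hm : Measurable fun (w : (Σ i, κ i) → Ω) i k => w ⟨i, k⟩ := by fun_prop
  have hm' : Measurable fun (u : ∀ i, κ i → Ω) (a : Σ i, κ i) => u a.1 a.2 := by fun_prop
  have h : (Measure.pi fun i => Measure.pi fun _ : κ i => P).map
      (fun (u : ∀ i, κ i → Ω) (a : Σ i, κ i) => u a.1 a.2) = Measure.pi fun _ => P := by
    refine (Measure.pi_eq fun s hs => ?_).symm
    rw [Measure.map_apply hm' (.univ_pi hs)]
    have : (fun (u : ∀ i, κ i → Ω) (a : Σ i, κ i) => u a.1 a.2) ⁻¹' univ.pi s =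
        univ.pi fun i => univ.pi fun k => s ⟨i, k⟩ := by
      ext u
      simp [Sigma.forall]
    rw [this, Measure.pi_pi, Fintype.prod_sigma]
    exact Finset.prod_congr rfl fun i _ => Measure.pi_pi _ _
  refine ⟨hm, ?_⟩
  rw [← h, Measure.map_map hm hm']
  exact Measure.map_id

/-- The `i`-th of as many disjoint chunks of a sample as possible. -/
noncomputable def chunkIndex (I : Type*) [Fintype I] (m : ℕ) :
    (Σ _ : Fin (m / (Fintype.card I + 1)), I) ↪ Fin m :=
  (Function.Embedding.nonempty_of_card_le (by
    rw [Fintype.card_sigma, Finset.sum_const, Finset.card_univ, Fintype.card_fin, Fintype.card_fin,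
      smul_eq_mul]
    exact (Nat.mul_le_mul_left _ (Nat.le_succ _)).trans (Nat.div_mul_le_self _ _))).some

variable {Ω : Type*} {m : ℕ}

/-- Cut a sample into chunks indexed by `I`. -/
noncomputable def chunk (I : Type*) [Fintype I] (w : Fin m → Ω) :
    Fin (m / (Fintype.card I + 1)) → I → Ω :=
  fun i l => w (chunkIndex I m ⟨i, l⟩)

theorem measurePreserving_chunk (I : Type*) [Fintype I] [MeasurableSpace Ω] (P : Measure Ω)
    [IsProbabilityMeasure P] :
    MeasurePreserving (chunk (m := m) I) (Measure.pi fun _ => P)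
      (Measure.pi fun _ => Measure.pi fun _ : I => P) :=
  (measurePreserving_curry P).comp (measurePreserving_comp_injective P (chunkIndex I m).injective)

/-- Cut a sample into game histories. -/
noncomputable def histChunk (d : ℕ → ℕ) (K : ℕ) {X : Type*} (w : Fin m → X × Bool) :
    Fin (m / (Fintype.card (Σ j : Fin K, Fin (d j)) + 1)) → Hist X d K :=
  fun i j l => chunk (Σ j : Fin K, Fin (d j)) w i ⟨j, l⟩

theorem measurePreserving_histChunk (d : ℕ → ℕ) (K : ℕ) {X : Type*} [MeasurableSpace X]
    (P : Measure (X × Bool)) [IsProbabilityMeasure P] :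
    MeasurePreserving (histChunk (m := m) d K (X := X)) (Measure.pi fun _ => P)
      (Measure.pi fun _ => histMeasure P d K) :=
  (measurePreserving_pi _ _ fun _ => measurePreserving_curry P).comp
    (measurePreserving_chunk (Σ j : Fin K, Fin (d j)) P)

end Chunk

/-! ### Validated plurality votes -/

section Plurality

variable {X V : Type*} {D M N : ℕ}

/-- The rule `g` is never completely correct on the blocks of examples `ω`. -/
def Passes (g : (Fin D → X) → Fin D → Bool) (ω : Fin M → Fin D → X × Bool) : Prop :=
  ∀ i, (g fun l => (ω i l).1) ≠ fun l => (ω i l).2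

open Classical in
/-- The number of rules in a list which pass validation. -/
noncomputable def passCount (σ : V → (Fin D → X) → Fin D → Bool) (v : Fin N → V)
    (ω : Fin M → Fin D → X × Bool) : ℕ :=
  (Finset.univ.filter fun i => Passes (σ (v i)) ω).card

open Classical in
/-- The number of rules in a list which pass validation and answer `y` on `x`. -/
noncomputable def voteCount (σ : V → (Fin D → X) → Fin D → Bool) (v : Fin N → V)
    (ω : Fin M → Fin D → X × Bool) (x : Fin D → X) (y : Fin D → Bool) : ℕ :=
  (Finset.univ.filter fun i => Passes (σ (v i)) ω ∧ σ (v i) x = y).card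

/-- An answer with the most votes. -/
noncomputable def argmax (c : (Fin D → Bool) → ℕ) : Fin D → Bool := (Finite.exists_max c).choose

theorem le_argmax (c : (Fin D → Bool) → ℕ) (y : Fin D → Bool) : c y ≤ c (argmax c) :=
  (Finite.exists_max c).choose_spec y

/-- The plurality vote among the rules in a list which pass validation. -/
noncomputable def plurality (σ : V → (Fin D → X) → Fin D → Bool) (v : Fin N → V)
    (ω : Fin M → Fin D → X × Bool) (x : Fin D → X) : Fin D → Bool :=
  argmax (voteCount σ v ω x)

theorem passCount_le (σ : V → (Fin D → X) → Fin D → Bool) (v : Fin N → V)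
    (ω : Fin M → Fin D → X × Bool) (x : Fin D → X) :
    passCount σ v ω ≤ 2 ^ D * voteCount σ v ω x (plurality σ v ω x) := by
  classical
  have h : passCount σ v ω = ∑ y, voteCount σ v ω x y := by
    rw [passCount, Finset.card_eq_sum_card_fiberwise (f := fun i => σ (v i) x) (t := Finset.univ)
      fun _ _ => Finset.mem_coe.2 (Finset.mem_univ _)]
    exact Finset.sum_congr rfl fun y _ => by rw [voteCount, Finset.filter_filter]
  rw [h]
  refine (Finset.sum_le_card_nsmul _ _ _ fun y _ => le_argmax (voteCount σ v ω x) y).trans_eq ?_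
  simp [plurality]

variable [MeasurableSpace X]

open Classical in
/-- If many rules pass validation, but few of them are only nearly perfect, then their plurality
vote is perfect. -/
theorem matchProb_plurality_eq_zero (P : Measure (X × Bool)) (σ : V → (Fin D → X) → Fin D → Bool)
    (v : Fin N → V) (ω : Fin M → Fin D → X × Bool) {q : ℕ} {ε : ℝ≥0∞}
    (hcount : N ≤ q * passCount σ v ω)
    (hsmall : q * 2 ^ D * (Finset.univ.filter fun i =>
      v i ∈ {v | 0 < matchProb P (σ v) ∧ matchProb P (σ v) ≤ ε}).card < N)
    (hlarge : ∀ i, Passes (σ (v i)) ω → matchProb P (σ (v i)) ≤ ε) :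
    matchProb P (plurality σ v ω) = 0 := by
  have key : ∀ x, ∃ i, matchProb P (σ (v i)) = 0 ∧ σ (v i) x = plurality σ v ω x := by
    intro x
    by_contra! hcon
    refine absurd (hcount.trans (Nat.mul_le_mul_left q (passCount_le σ v ω x))) (not_le.2 ?_)
    rw [← mul_assoc]
    refine lt_of_le_of_lt (Nat.mul_le_mul_left _ (Finset.card_le_card fun i hi => ?_)) hsmall
    simp only [Finset.mem_filter, Finset.mem_univ, true_and, mem_ofPred_eq] at hi ⊢
    exact ⟨pos_iff_ne_zero.2 fun h0 => hcon i h0 hi.2, hlarge i hi.1⟩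
  refine measure_mono_null (t := ⋃ i : {i : Fin N // matchProb P (σ (v i)) = 0},
    {b | (σ (v i) fun l => (b l).1) = fun l => (b l).2}) (fun b hb => ?_)
    (measure_iUnion_null fun i => i.2)
  obtain ⟨i, hi, hix⟩ := key fun l => (b l).1
  exact mem_iUnion.2 ⟨⟨i, hi⟩, hix.trans hb⟩

section Measurability

variable [MeasurableSpace V] {Ω : Type*} [MeasurableSpace Ω]
  {σ : V → (Fin D → X) → Fin D → Bool}
  (hσ : Measurable[univMS (V × (Fin D → X))] fun p : V × (Fin D → X) => σ p.1 p.2)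

include hσ

theorem measurableSet_match :
    MeasurableSet[univMS (V × (Fin D → X × Bool))]
      {p : V × (Fin D → X × Bool) | (σ p.1 fun l => (p.2 l).1) = fun l => (p.2 l).2} := by
  have h1 : Measurable[univMS (V × (Fin D → X × Bool))]
      fun p : V × (Fin D → X × Bool) => σ p.1 fun l => (p.2 l).1 :=
    hσ.comp (Measurable.univMS (f := fun p : V × (Fin D → X × Bool) => (p.1, fun l => (p.2 l).1))
      (by fun_prop))
  have h2 : Measurable[univMS (V × (Fin D → X × Bool))]
      fun p : V × (Fin D → X × Bool) => fun l => (p.2 l).2 := by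
    have : Measurable fun p : V × (Fin D → X × Bool) => fun l => (p.2 l).2 := by fun_prop
    exact fun s hs => (this hs).univMS
  exact measurableSet_eq_fun h1 h2

theorem measurableSet_passes :
    MeasurableSet[univMS (V × (Fin M → Fin D → X × Bool))]
      {p : V × (Fin M → Fin D → X × Bool) | Passes (σ p.1) p.2} := by
  have : {p : V × (Fin M → Fin D → X × Bool) | Passes (σ p.1) p.2} =
      ⋂ i, (fun p : V × (Fin M → Fin D → X × Bool) => (p.1, p.2 i)) ⁻¹'
        {p | (σ p.1 fun l => (p.2 l).1) = fun l => (p.2 l).2}ᶜ := by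
    ext p
    simp [Passes]
  rw [this]
  exact @MeasurableSet.iInter _ _ (univMS _) _ _ fun i =>
    Measurable.univMS (by fun_prop) (@MeasurableSet.compl _ _ (univMS _) (measurableSet_match hσ))

theorem measurable_passCount :
    Measurable[univMS ((Fin N → V) × (Fin M → Fin D → X × Bool))]
      fun p : (Fin N → V) × (Fin M → Fin D → X × Bool) => passCount σ p.1 p.2 := by
  classical
  simp only [passCount, Finset.card_filter]
  refine @Finset.measurable_sum _ _ _ _ _ _ (univMS _) _ _ fun i _ => ?_
  refine Measurable.ite (m := univMS _) ?_ measurable_const measurable_const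
  exact Measurable.univMS (f := fun p : (Fin N → V) × (Fin M → Fin D → X × Bool) => (p.1 i, p.2))
    (by fun_prop) (measurableSet_passes hσ)

theorem measurable_plurality :
    Measurable[univMS (((Fin N → V) × (Fin M → Fin D → X × Bool)) × (Fin D → X))]
      fun p : ((Fin N → V) × (Fin M → Fin D → X × Bool)) × (Fin D → X) =>
        plurality σ p.1.1 p.1.2 p.2 := by
  classical
  have hA : Measurable (argmax (D := D)) := measurable_of_countable _
  refine hA.comp (@measurable_pi_lambda _ _ _ (univMS _) _ _ fun y => ?_)
  simp only [voteCount, Finset.card_filter]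
  refine @Finset.measurable_sum _ _ _ _ _ _ (univMS _) _ _ fun i _ => ?_
  refine Measurable.ite (m := univMS _) ?_ measurable_const measurable_const
  refine @MeasurableSet.inter _ (univMS _) _ _ ?_ ?_
  · exact Measurable.univMS (f := fun p : ((Fin N → V) × (Fin M → Fin D → X × Bool)) × (Fin D → X) =>
      (p.1.1 i, p.1.2)) (by fun_prop) (measurableSet_passes hσ)
  · exact (hσ.comp (Measurable.univMS
      (f := fun p : ((Fin N → V) × (Fin M → Fin D → X × Bool)) × (Fin D → X) => (p.1.1 i, p.2))
      (by fun_prop))) (measurableSet_singleton y)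

theorem aemeasurable_matchProb (ν : Measure V) [IsProbabilityMeasure ν] (P : Measure (X × Bool))
    [IsProbabilityMeasure P] : AEMeasurable (fun v => matchProb P (σ v)) ν :=
  aemeasurable_measure_slice (ν := Measure.pi fun _ : Fin D => P)
    (nullMeasurableSet_of_univMS (measurableSet_match hσ) _)

theorem measure_passes (P : Measure (X × Bool)) [IsProbabilityMeasure P] (v : V) :
    Measure.pi (fun _ : Fin M => Measure.pi fun _ : Fin D => P) {ω | Passes (σ v) ω} =
      (1 - matchProb P (σ v)) ^ M := by
  have h : {ω : Fin M → Fin D → X × Bool | Passes (σ v) ω} =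
      univ.pi fun _ => {b | (σ v fun l => (b l).1) = fun l => (b l).2}ᶜ := by
    ext ω
    simp [Passes]
  have hm : MeasurableSet[univMS (Fin D → X × Bool)]
      {b | (σ v fun l => (b l).1) = fun l => (b l).2} :=
    Measurable.univMS (f := fun b : Fin D → X × Bool => (v, b)) (by fun_prop) (measurableSet_match hσ)
  rw [h, Measure.pi_pi, Finset.prod_const, Finset.card_univ, Fintype.card_fin,
    prob_compl_eq_one_sub₀ (nullMeasurableSet_of_univMS hm _), matchProb]

/-- A rule with a noticeable chance of being completely correct rarely passes validation. -/
theorem measure_passes_of_lt_le (ν : Measure V) [IsProbabilityMeasure ν] (P : Measure (X × Bool))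
    [IsProbabilityMeasure P] (ε : ℝ≥0∞) :
    ν.prod (Measure.pi fun _ : Fin M => Measure.pi fun _ : Fin D => P)
      {p | ε < matchProb P (σ p.1) ∧ Passes (σ p.1) p.2} ≤ (1 - ε) ^ M := by
  have h1 : NullMeasurableSet {v | ε < matchProb P (σ v)} ν :=
    nullMeasurableSet_lt aemeasurable_const (aemeasurable_matchProb hσ ν P)
  have h2 : NullMeasurableSet {p : V × (Fin M → Fin D → X × Bool) | ε < matchProb P (σ p.1)}
      (ν.prod (Measure.pi fun _ => Measure.pi fun _ => P)) :=
    h1.preimage Measure.quasiMeasurePreserving_fst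
  refine (lintegral_measure_slice
    (h2.inter (nullMeasurableSet_of_univMS (measurableSet_passes hσ) _))).ge.trans ?_
  refine (lintegral_mono (g := fun _ => (1 - ε) ^ M) fun v => ?_).trans (by simp)
  by_cases hv : ε < matchProb P (σ v)
  · refine (measure_mono fun ω hω => hω.2).trans ((measure_passes hσ P v).le.trans ?_)
    exact pow_le_pow_left' (tsub_le_tsub_left hv.le 1) M
  · rw [measure_mono_null (t := ∅) (fun ω hω => hv hω.1) measure_empty]
    exact zero_le

/-- Perfect rules pass validation almost surely. -/
theorem measure_not_passes_eq_zero (ν : Measure V) [IsProbabilityMeasure ν] (P : Measure (X × Bool))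
    [IsProbabilityMeasure P] :
    ν.prod (Measure.pi fun _ : Fin M => Measure.pi fun _ : Fin D => P)
      {p | matchProb P (σ p.1) = 0 ∧ ¬ Passes (σ p.1) p.2} = 0 := by
  have h1 : NullMeasurableSet {v | matchProb P (σ v) = 0} ν :=
    (aemeasurable_matchProb hσ ν P).nullMeasurableSet_preimage (measurableSet_singleton 0)
  have h2 : NullMeasurableSet {p : V × (Fin M → Fin D → X × Bool) | matchProb P (σ p.1) = 0}
      (ν.prod (Measure.pi fun _ => Measure.pi fun _ => P)) :=
    h1.preimage Measure.quasiMeasurePreserving_fst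
  have h3 : NullMeasurableSet {p : V × (Fin M → Fin D → X × Bool) | ¬ Passes (σ p.1) p.2}
      (ν.prod (Measure.pi fun _ => Measure.pi fun _ => P)) :=
    (nullMeasurableSet_of_univMS (measurableSet_passes hσ) _).compl
  refine (lintegral_measure_slice (h2.inter h3)).symm.trans ?_
  refine (lintegral_congr (g := fun _ => 0) fun v => ?_).trans (by simp)
  by_cases hv : matchProb P (σ v) = 0
  · refine measure_mono_null (t := {ω | Passes (σ v) ω}ᶜ) (fun ω hω => hω.2) ?_
    have hm : MeasurableSet[univMS (Fin M → Fin D → X × Bool)] {ω | Passes (σ v) ω} :=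
      Measurable.univMS (f := fun ω : Fin M → Fin D → X × Bool => (v, ω)) (by fun_prop)
        (measurableSet_passes hσ)
    rw [prob_compl_eq_one_sub₀ (nullMeasurableSet_of_univMS hm _), measure_passes hσ, hv]
    simp
  · exact measure_mono_null (t := ∅) (fun ω hω => hv hω.1) measure_empty

end Measurability

/-- A nonnegative function is rarely positive but small. -/
theorem exists_measure_pos_le_le [MeasurableSpace V] (ν : Measure V) [IsProbabilityMeasure ν]
    {f : V → ℝ≥0∞} (hf : AEMeasurable f ν) {δ : ℝ≥0∞} (hδ : δ ≠ 0) :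
    ∃ ε : ℝ≥0∞, ε ≠ 0 ∧ ν {v | 0 < f v ∧ f v ≤ ε} ≤ δ := by
  have h := tendsto_measure_iInter_atTop (μ := ν) (s := fun n : ℕ => {v | 0 < f v ∧ f v ≤ (n : ℝ≥0∞)⁻¹})
    (fun n => (nullMeasurableSet_lt aemeasurable_const hf).inter
      (nullMeasurableSet_le hf aemeasurable_const))
    (fun m n hmn v hv => ⟨hv.1, hv.2.trans (by gcongr)⟩) ⟨0, by simp⟩
  have h0 : ⋂ n : ℕ, {v | 0 < f v ∧ f v ≤ (n : ℝ≥0∞)⁻¹} = ∅ := by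
    refine eq_empty_of_forall_notMem fun v hv => ?_
    rw [mem_iInter] at hv
    obtain ⟨n, hn⟩ := ENNReal.exists_inv_nat_lt (hv 0).1.ne'
    exact absurd (hv n).2 (not_le.2 hn)
  rw [h0, measure_empty] at h
  obtain ⟨n, hn⟩ := (h.eventually (gt_mem_nhds (pos_iff_ne_zero.2 hδ))).exists
  exact ⟨(n : ℝ≥0∞)⁻¹, by simp, hn.le⟩

end Plurality

/-! ### Exponentially small sequences -/

/-- The sequence `f` is dominated by an exponentially decaying one. -/
def ExpSmall (f : ℕ → ℝ≥0∞) : Prop :=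
  ∃ C > (0 : ℝ), ∃ c > (0 : ℝ), ∀ n : ℕ, f n ≤ ENNReal.ofReal (C * Real.exp (-c * n))

namespace ExpSmall

variable {f g : ℕ → ℝ≥0∞}

theorem mono (hg : ExpSmall g) (h : ∀ n, f n ≤ g n) : ExpSmall f := by
  obtain ⟨C, hC, c, hc, hb⟩ := hg
  exact ⟨C, hC, c, hc, fun n => (h n).trans (hb n)⟩

theorem add (hf : ExpSmall f) (hg : ExpSmall g) : ExpSmall fun n => f n + g n := by
  obtain ⟨C, hC, c, hc, hb⟩ := hf
  obtain ⟨C', hC', c', hc', hb'⟩ := hg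
  refine ⟨C + C', by positivity, min c c', by positivity, fun n =>
    (add_le_add (hb n) (hb' n)).trans ?_⟩
  rw [← ENNReal.ofReal_add (by positivity) (by positivity), add_mul]
  gcongr <;> simp

theorem zero : ExpSmall fun _ => 0 := ⟨1, one_pos, 1, one_pos, fun _ => zero_le⟩

theorem sum {ι : Type*} (s : Finset ι) {F : ι → ℕ → ℝ≥0∞} (h : ∀ i ∈ s, ExpSmall (F i)) :
    ExpSmall fun n => ∑ i ∈ s, F i n := by
  classical
  induction s using Finset.induction_on with
  | empty => simpa using zero
  | insert i s hi ih =>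
    simp only [Finset.sum_insert hi]
    exact (h i (Finset.mem_insert_self _ _)).add
      (ih fun j hj => h j (Finset.mem_insert_of_mem hj))

theorem natCast_mul (hf : ExpSmall f) : ExpSmall fun n => n * f n := by
  obtain ⟨C, hC, c, hc, hb⟩ := hf
  refine ⟨2 / c * C, by positivity, c / 2, by positivity, fun n => ?_⟩
  have h1 : (n : ℝ) ≤ 2 / c * Real.exp (c / 2 * n) := by
    have := (Real.add_one_le_exp (c / 2 * n)).trans' (by linarith : c / 2 * n ≤ c / 2 * n + 1)
    calc (n : ℝ) = 2 / c * (c / 2 * n) := by field_simp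
      _ ≤ _ := by gcongr
  calc (n : ℝ≥0∞) * f n ≤ ENNReal.ofReal n * ENNReal.ofReal (C * Real.exp (-c * n)) := by
        rw [ENNReal.ofReal_natCast]
        gcongr
        exact hb n
    _ = ENNReal.ofReal (n * (C * Real.exp (-c * n))) := (ENNReal.ofReal_mul (by positivity)).symm
    _ ≤ _ := by
        refine ENNReal.ofReal_le_ofReal ?_
        calc (n : ℝ) * (C * Real.exp (-c * n))
            ≤ 2 / c * Real.exp (c / 2 * n) * (C * Real.exp (-c * n)) := by gcongr
          _ = 2 / c * C * (Real.exp (c / 2 * n) * Real.exp (-c * n)) := by ring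
          _ = _ := by rw [← Real.exp_add]; congr 2; ring

theorem comp_div (hf : ExpSmall f) {B : ℕ} (hB : 0 < B) : ExpSmall fun n => f (n / B) := by
  obtain ⟨C, hC, c, hc, hb⟩ := hf
  refine ⟨C * Real.exp c, by positivity, c / B, by positivity, fun n =>
    (hb _).trans (ENNReal.ofReal_le_ofReal ?_)⟩
  rw [mul_assoc, ← Real.exp_add]
  gcongr
  have h : (n : ℝ) / B < (n / B : ℕ) + 1 := by
    rw [div_lt_iff₀ (by positivity)]
    exact_mod_cast Nat.lt_mul_of_div_lt (Nat.lt_succ_self (n / B)) hB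
  have : c * (n / B) ≤ c * ((n / B : ℕ) + 1) := by gcongr
  calc -c * ((n / B : ℕ) : ℝ) ≤ c - c * (n / B) := by linarith
    _ = _ := by ring

theorem pow {ρ : ℝ≥0∞} (hρ : ρ < 1) : ExpSmall fun n => ρ ^ n := by
  obtain ⟨r, hr, hr1⟩ := exists_between hρ
  have hr0 : 0 < r.toReal := ENNReal.toReal_pos (pos_of_gt hr).ne' hr1.ne_top
  have hrr : r.toReal < 1 := by
    rw [← ENNReal.toReal_one]
    exact (ENNReal.toReal_lt_toReal hr1.ne_top (by simp)).2 hr1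
  refine ⟨1, one_pos, -Real.log r.toReal, by simpa using Real.log_neg hr0 hrr, fun n => ?_⟩
  rw [one_mul, neg_neg, mul_comm, Real.exp_nat_mul, Real.exp_log hr0, ENNReal.ofReal_pow hr0.le,
    ENNReal.ofReal_toReal hr1.ne_top]
  exact pow_le_pow_left' hr.le n

end ExpSmall

/-! ### Selecting a game strategy from the sample -/

section Select

variable {X : Type*} {t : ℕ → ℕ}
  (σ : ∀ k, Hist X (fun k => t k + 1) k → (Fin (t k + 1) → X) → Fin (t k + 1) → Bool) {m : ℕ}

/-- The plurality vote of the strategies resulting from playing `k` rounds of the game with the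
first part of the sample, and validated with the second part. -/
noncomputable def candidate (k : ℕ) (a : (Fin m → X × Bool) × (Fin m → X × Bool)) :
    (Fin (t k + 1) → X) → Fin (t k + 1) → Bool :=
  plurality (σ k) (histChunk (fun k => t k + 1) k a.1) (chunk (Fin (t k + 1)) a.2)

/-- The `j`-th candidate is accepted if a sufficient fraction of the corresponding strategies
passes validation. The number `j` encodes a number of rounds and a threshold. -/
def Accepted (j : ℕ) (a : (Fin m → X × Bool) × (Fin m → X × Bool)) : Prop :=
  m / (Fintype.card (Σ l : Fin j.unpair.1, Fin (t l + 1)) + 1) ≤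
    j.unpair.2 * passCount (σ j.unpair.1) (histChunk (fun k => t k + 1) j.unpair.1 a.1)
      (chunk (Fin (t j.unpair.1 + 1)) a.2)

/-- The `j`-th candidate is the first accepted one. -/
def Selected (j : ℕ) (a : (Fin m → X × Bool) × (Fin m → X × Bool)) : Prop :=
  Accepted σ j a ∧ ∀ i < j, ¬ Accepted σ i a

theorem Selected.eq {σ : ∀ k, Hist X (fun k => t k + 1) k → (Fin (t k + 1) → X) → Fin (t k + 1) → Bool}
    {i j : ℕ} {a : (Fin m → X × Bool) × (Fin m → X × Bool)}
    (hi : Selected σ i a) (hj : Selected σ j a) : i = j := by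
  rcases lt_trichotomy i j with h | h | h
  · exact absurd hi.1 (hj.2 i h)
  · exact h
  · exact absurd hj.1 (hi.2 j h)

open Classical in
/-- The predictor which uses the first accepted candidate. -/
noncomputable def selectRule (a : (Fin m → X × Bool) × (Fin m → X × Bool)) (b : Fin m → X × Bool)
    (x : X) : Bool :=
  decide (∃ j, Selected σ j a ∧ patternRule (candidate σ j.unpair.1 a) b x = true)

theorem selectRule_eq {j : ℕ} {a : (Fin m → X × Bool) × (Fin m → X × Bool)} (hj : Selected σ j a) :
    selectRule σ a = patternRule (n := m) (candidate σ j.unpair.1 a) := by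
  funext b x
  have h : (∃ i, Selected σ i a ∧ patternRule (candidate σ i.unpair.1 a) b x = true) ↔
      patternRule (candidate σ j.unpair.1 a) b x = true := by
    refine ⟨fun ⟨i, hi, h⟩ => ?_, fun h => ⟨j, hj, h⟩⟩
    obtain rfl := hi.eq hj
    exact h
  simp only [selectRule, h, Bool.decide_eq_true]

variable [MeasurableSpace X]
  (hσ : ∀ k, Measurable[univMS (Hist X (fun k => t k + 1) k × (Fin (t k + 1) → X))]
    fun p : Hist X (fun k => t k + 1) k × (Fin (t k + 1) → X) => σ k p.1 p.2)

theorem measurable_chunk (I : Type*) [Fintype I] {Ω : Type*} [MeasurableSpace Ω] :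
    Measurable (chunk (m := m) (Ω := Ω) I) := by
  unfold chunk
  fun_prop

theorem measurable_histChunk (d : ℕ → ℕ) (k : ℕ) :
    Measurable (histChunk (m := m) (X := X) d k) := by
  unfold histChunk chunk
  fun_prop

include hσ

theorem measurableSet_accepted (j : ℕ) :
    MeasurableSet[univMS ((Fin m → X × Bool) × (Fin m → X × Bool))] {a | Accepted σ j a} := by
  have h := (measurable_passCount (M := m / (Fintype.card (Fin (t j.unpair.1 + 1)) + 1))
    (N := m / (Fintype.card (Σ l : Fin j.unpair.1, Fin (t l + 1)) + 1)) (hσ j.unpair.1)).comp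
    (Measurable.univMS (f := fun a : (Fin m → X × Bool) × (Fin m → X × Bool) =>
      (histChunk (fun k => t k + 1) j.unpair.1 a.1, chunk (Fin (t j.unpair.1 + 1)) a.2))
      (((measurable_histChunk _ _).comp measurable_fst).prodMk
        ((measurable_chunk _).comp measurable_snd)))
  exact h (MeasurableSet.of_discrete (s := {c | _ ≤ j.unpair.2 * c}))

theorem measurableSet_selected (j : ℕ) :
    MeasurableSet[univMS ((Fin m → X × Bool) × (Fin m → X × Bool))] {a | Selected σ j a} := by
  have : {a : (Fin m → X × Bool) × (Fin m → X × Bool) | Selected σ j a} =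
      {a | Accepted σ j a} ∩ ⋂ i, ⋂ _ : i < j, {a | Accepted σ i a}ᶜ := by
    ext a
    simp [Selected]
  rw [this]
  exact @MeasurableSet.inter _ (univMS _) _ _ (measurableSet_accepted σ hσ j)
    (@MeasurableSet.iInter _ _ (univMS _) _ _ fun i => @MeasurableSet.iInter _ _ (univMS _) _ _
      fun _ => @MeasurableSet.compl _ _ (univMS _) (measurableSet_accepted σ hσ i))

theorem measurable_candidate (k : ℕ) :
    Measurable[univMS (((Fin m → X × Bool) × (Fin m → X × Bool)) × (Fin (t k + 1) → X))]
      fun p : ((Fin m → X × Bool) × (Fin m → X × Bool)) × (Fin (t k + 1) → X) =>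
        candidate σ k p.1 p.2 :=
  (measurable_plurality (hσ k)).comp (Measurable.univMS
    (f := fun p : ((Fin m → X × Bool) × (Fin m → X × Bool)) × (Fin (t k + 1) → X) =>
      ((histChunk (fun k => t k + 1) k p.1.1, chunk (Fin (t k + 1)) p.1.2), p.2))
    ((((measurable_histChunk _ _).comp (measurable_fst.comp measurable_fst)).prodMk
      ((measurable_chunk _).comp (measurable_snd.comp measurable_fst))).prodMk measurable_snd))

theorem measurable_selectRule :
    Measurable[univMS (((Fin m → X × Bool) × (Fin m → X × Bool)) × (Fin m → X × Bool) × X)]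
      fun p : ((Fin m → X × Bool) × (Fin m → X × Bool)) × (Fin m → X × Bool) × X =>
        selectRule σ p.1 p.2.1 p.2.2 := by
  refine @measurable_to_bool _ (univMS _) _ ?_
  have : (fun p : ((Fin m → X × Bool) × (Fin m → X × Bool)) × (Fin m → X × Bool) × X =>
      selectRule σ p.1 p.2.1 p.2.2) ⁻¹' {true} = ⋃ j : ℕ, Prod.fst ⁻¹' {a | Selected σ j a} ∩
        (fun p => patternRule (candidate σ j.unpair.1 p.1) p.2.1 p.2.2) ⁻¹' {true} := by
    ext p
    simp [selectRule]
  rw [this]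
  exact @MeasurableSet.iUnion _ _ (univMS _) _ _ fun j => @MeasurableSet.inter _ (univMS _) _ _
    (Measurable.univMS measurable_fst (measurableSet_selected σ hσ j))
    (measurable_patternRule (measurable_candidate σ hσ _) (measurableSet_singleton true))

end Select

/-! ### Analysis of the predictor -/

theorem MeasureTheory.MeasurePreserving.measure_preimage_le_measure {α β : Type*}
    [MeasurableSpace α] [MeasurableSpace β] {μ : Measure α} {ν : Measure β} {f : α → β}
    (hf : MeasurePreserving f μ ν) (s : Set β) : μ (f ⁻¹' s) ≤ ν s :=
  (Measure.le_map_apply hf.aemeasurable s).trans_eq (by rw [hf.map_eq])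

theorem lintegral_le_add_measure {α : Type*} [MeasurableSpace α] {μ : Measure α}
    [IsProbabilityMeasure μ] {f : α → ℝ≥0∞} {S : Set α} {c : ℝ≥0∞} (h1 : ∀ a, f a ≤ 1)
    (hc : ∀ a, a ∉ S → f a ≤ c) : ∫⁻ a, f a ∂μ ≤ μ S + c := by
  calc ∫⁻ a, f a ∂μ ≤ ∫⁻ a, ((toMeasurable μ S).indicator 1 a + c) ∂μ := by
        refine lintegral_mono fun a => ?_
        by_cases ha : a ∈ toMeasurable μ S
        · simpa [ha] using (h1 a).trans le_self_add
        · simpa [ha] using hc a fun h => ha (subset_toMeasurable μ S h)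
    _ = μ S + c := by
        rw [lintegral_add_right _ measurable_const, lintegral_indicator_one
          (measurableSet_toMeasurable _ _), measure_toMeasurable]
        simp

section Analysis

variable {X : Type*} {t : ℕ → ℕ}
  (σ : ∀ k, Hist X (fun k => t k + 1) k → (Fin (t k + 1) → X) → Fin (t k + 1) → Bool) [MeasurableSpace X]
  (hσ : ∀ k, Measurable[univMS (Hist X (fun k => t k + 1) k × (Fin (t k + 1) → X))]
    fun p : Hist X (fun k => t k + 1) k × (Fin (t k + 1) → X) => σ k p.1 p.2)
  (P : Measure (X × Bool)) [IsProbabilityMeasure P]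

theorem measurePreserving_histChunk_chunk (d : ℕ → ℕ) (k : ℕ) (I : Type*) [Fintype I] {m : ℕ}
    (i : Fin (m / (Fintype.card (Σ l : Fin k, Fin (d l)) + 1))) :
    MeasurePreserving (fun a : (Fin m → X × Bool) × (Fin m → X × Bool) =>
        (histChunk d k a.1 i, chunk I a.2))
      ((Measure.pi fun _ => P).prod (Measure.pi fun _ => P))
      ((histMeasure P d k).prod (Measure.pi fun _ => Measure.pi fun _ => P)) :=
  ((measurePreserving_eval _ i).comp (measurePreserving_histChunk d k P)).prod
    (measurePreserving_chunk I P)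

include hσ

theorem aemeasurable_errP_selectRule {m : ℕ} (μ : Measure
    (((Fin m → X × Bool) × (Fin m → X × Bool)) × (Fin m → X × Bool))) [IsProbabilityMeasure μ] :
    AEMeasurable (fun p => errP P (selectRule σ p.1 p.2)) μ := by
  let W := (((Fin m → X × Bool) × (Fin m → X × Bool)) × (Fin m → X × Bool)) × (X × Bool)
  have hg : Measurable fun q : W => (q.1.1, q.1.2, q.2.1) := by fun_prop
  have hsel : Measurable[univMS W] fun q : W => selectRule σ q.1.1 q.1.2 q.2.1 := fun s hs =>
    hg.univMS (measurable_selectRule σ hσ hs)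
  have hlab : Measurable[univMS W] fun q : W => q.2.2 := fun s hs =>
    MeasurableSet.univMS ((measurable_snd.comp measurable_snd) hs)
  exact aemeasurable_measure_slice (s := {q : W | selectRule σ q.1.1 q.1.2 q.2.1 ≠ q.2.2})
    (nullMeasurableSet_of_univMS (measurableSet_eq_fun hsel hlab) _).compl

/-- Whether or not it gets selected, a candidate is imperfect only if too few of its strategies
pass validation, up to an event of exponentially small probability. -/
theorem exists_expSmall_not_matchProb_candidate (j : ℕ) :
    ∃ f, ExpSmall f ∧ ∀ m,
      ((Measure.pi fun _ : Fin m => P).prod (Measure.pi fun _ : Fin m => P))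
        {a | Accepted σ j a ∧ matchProb P (candidate σ j.unpair.1 a) ≠ 0} ≤ f m := by
  classical
  set k := j.unpair.1 with hk
  set q := j.unpair.2 with hq
  let d : ℕ → ℕ := fun k => t k + 1
  let B := Fintype.card (Σ l : Fin k, Fin (t l + 1)) + 1
  let D := Fintype.card (Fin (t k + 1)) + 1
  obtain ⟨ε, hε0, hε⟩ := exists_measure_pos_le_le (histMeasure P d k)
    (aemeasurable_matchProb (hσ k) (histMeasure P d k) P)
    (δ := (2 ^ (q * 2 ^ (t k + 1)))⁻¹ / 2) (by simp)
  let ρ : ℝ≥0∞ := 1 - ε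
  have hρ : ρ < 1 := ENNReal.sub_lt_self (by simp) (by simp) hε0
  refine ⟨fun m => (3 / 4) ^ (m / B) + m * ρ ^ (m / D), ?_, fun m => ?_⟩
  · refine ((ExpSmall.pow ?_).comp_div (Nat.succ_pos _)).add
      (((ExpSmall.pow hρ).comp_div (Nat.succ_pos _)).natCast_mul)
    exact ENNReal.div_lt_of_lt_mul' (by norm_num)
  set μ := (Measure.pi fun _ : Fin m => P).prod (Measure.pi fun _ : Fin m => P)
  let S : Set (Hist X d k) := {v | 0 < matchProb P (σ k v) ∧ matchProb P (σ k v) ≤ ε}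
  let E₁ : Set ((Fin m → X × Bool) × (Fin m → X × Bool)) := {a | m / B ≤ q * 2 ^ (t k + 1) *
    (Finset.univ.filter fun i => histChunk d k a.1 i ∈ S).card}
  let E₂ : Fin (m / B) → Set ((Fin m → X × Bool) × (Fin m → X × Bool)) := fun i =>
    {a | ε < matchProb P (σ k (histChunk d k a.1 i)) ∧
      Passes (σ k (histChunk d k a.1 i)) (chunk (Fin (t k + 1)) a.2)}
  have h₁ : μ E₁ ≤ (3 / 4) ^ (m / B) :=
    (((measurePreserving_histChunk d k P).comp measurePreserving_fst).measure_preimage_le_measure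
      {v | m / B ≤ q * 2 ^ (t k + 1) * (Finset.univ.filter fun i => v i ∈ S).card}).trans
      (le_of_eq_of_le (by congr!) (measure_le_mul_card_le _ hε (m / B)))
  have h₂ : ∀ i, μ (E₂ i) ≤ ρ ^ (m / D) := fun i =>
    ((measurePreserving_histChunk_chunk P d k (Fin (t k + 1)) i).measure_preimage_le_measure
      {p | ε < matchProb P (σ k p.1) ∧ Passes (σ k p.1) p.2}).trans
      (measure_passes_of_lt_le (hσ k) _ P ε)
  calc μ {a | Accepted σ j a ∧ matchProb P (candidate σ k a) ≠ 0}
      ≤ μ (E₁ ∪ ⋃ i, E₂ i) := by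
        refine measure_mono fun a ha => ?_
        by_contra hcon
        simp only [mem_union, mem_iUnion, not_or, not_exists] at hcon
        refine ha.2 (matchProb_plurality_eq_zero P (σ k) _ _ ha.1 (not_le.1 hcon.1)
          fun i hi => ?_)
        by_contra hlt
        exact hcon.2 i ⟨not_le.1 hlt, hi⟩
    _ ≤ μ E₁ + ∑ i, μ (E₂ i) :=
        (measure_union_le _ _).trans (add_le_add le_rfl (measure_iUnion_fintype_le _ _))
    _ ≤ (3 / 4) ^ (m / B) + ∑ i : Fin (m / B), ρ ^ (m / D) :=
        add_le_add h₁ (Finset.sum_le_sum fun i _ => h₂ i)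
    _ ≤ (3 / 4) ^ (m / B) + m * ρ ^ (m / D) := by
        rw [Finset.sum_const, Finset.card_univ, Fintype.card_fin, nsmul_eq_mul]
        gcongr
        exact Nat.div_le_self _ _

theorem exists_expSmall_not_accepted {k : ℕ}
    (hk : histMeasure P (fun k => t k + 1) k {v | matchProb P (σ k v) = 0} ≠ 0) :
    ∃ j f, ExpSmall f ∧ ∀ m,
      ((Measure.pi fun _ : Fin m => P).prod (Measure.pi fun _ : Fin m => P))
        {a | ¬ Accepted σ j a} ≤ f m := by
  classical
  let d : ℕ → ℕ := fun k => t k + 1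
  let B := Fintype.card (Σ l : Fin k, Fin (t l + 1)) + 1
  let S : Set (Hist X d k) := {v | matchProb P (σ k v) = 0}
  have hS : NullMeasurableSet S (histMeasure P d k) :=
    (aemeasurable_matchProb (hσ k) (histMeasure P d k) P).nullMeasurableSet_preimage
      (measurableSet_singleton 0)
  obtain ⟨q, ρ, hρ, hq⟩ := exists_measure_mul_card_lt_le (histMeasure P d k) hS hk
  refine ⟨Nat.pair k q, fun m => ρ ^ (m / B), (ExpSmall.pow hρ).comp_div (Nat.succ_pos _),
    fun m => ?_⟩
  set μ := (Measure.pi fun _ : Fin m => P).prod (Measure.pi fun _ : Fin m => P)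
  let E₁ : Set ((Fin m → X × Bool) × (Fin m → X × Bool)) :=
    {a | q * (Finset.univ.filter fun i => histChunk d k a.1 i ∈ S).card < m / B}
  let E₂ : Fin (m / B) → Set ((Fin m → X × Bool) × (Fin m → X × Bool)) := fun i =>
    {a | matchProb P (σ k (histChunk d k a.1 i)) = 0 ∧
      ¬ Passes (σ k (histChunk d k a.1 i)) (chunk (Fin (t k + 1)) a.2)}
  have h₁ : μ E₁ ≤ ρ ^ (m / B) :=
    (((measurePreserving_histChunk d k P).comp measurePreserving_fst).measure_preimage_le_measure
      {v | q * (Finset.univ.filter fun i => v i ∈ S).card < m / B}).trans (le_of_eq_of_le (by congr!) (hq (m / B)))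
  have h₂ : ∀ i, μ (E₂ i) = 0 := fun i => nonpos_iff_eq_zero.1 <|
    ((measurePreserving_histChunk_chunk P d k (Fin (t k + 1)) i).measure_preimage_le_measure
      {p | matchProb P (σ k p.1) = 0 ∧ ¬ Passes (σ k p.1) p.2}).trans_eq
      (measure_not_passes_eq_zero (hσ k) _ P)
  calc μ {a | ¬ Accepted σ (Nat.pair k q) a} ≤ μ (E₁ ∪ ⋃ i, E₂ i) := by
        refine measure_mono fun a ha => ?_
        by_contra hcon
        simp only [mem_union, mem_iUnion, not_or, not_exists] at hcon
        refine ha ?_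
        unfold Accepted
        rw [Nat.unpair_pair]
        refine (not_lt.1 hcon.1).trans (Nat.mul_le_mul_left _ (Finset.card_le_card fun i hi => ?_))
        simp only [Finset.mem_filter, Finset.mem_univ, true_and] at hi ⊢
        by_contra hp
        exact hcon.2 i ⟨hi, hp⟩
    _ ≤ μ E₁ + μ (⋃ i, E₂ i) := measure_union_le _ _
    _ = μ E₁ := by rw [measure_iUnion_null h₂, add_zero]
    _ ≤ _ := h₁

theorem exists_expSmall_not_selected {k : ℕ}
    (hk : histMeasure P (fun k => t k + 1) k {v | matchProb P (σ k v) = 0} ≠ 0) :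
    ∃ J f, ExpSmall f ∧ ∀ m,
      ((Measure.pi fun _ : Fin m => P).prod (Measure.pi fun _ : Fin m => P))
        {a | ¬ ∃ j ≤ J, Selected σ j a ∧ matchProb P (candidate σ j.unpair.1 a) = 0} ≤ f m := by
  classical
  obtain ⟨J, f, hf, hfJ⟩ := exists_expSmall_not_accepted σ hσ P hk
  choose g hg hgj using exists_expSmall_not_matchProb_candidate σ hσ P
  refine ⟨J, fun m => f m + ∑ j ∈ Finset.range (J + 1), g j m,
    hf.add (ExpSmall.sum _ fun j _ => hg j), fun m => ?_⟩
  refine (measure_mono (t := {a | ¬ Accepted σ J a} ∪ ⋃ j ∈ Finset.range (J + 1),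
    {a | Accepted σ j a ∧ matchProb P (candidate σ j.unpair.1 a) ≠ 0}) fun a ha => ?_).trans
    ((measure_union_le _ _).trans (add_le_add (hfJ m) ((measure_biUnion_finset_le _ _).trans
      (Finset.sum_le_sum fun j _ => hgj j m))))
  by_contra hcon
  simp only [mem_union, mem_iUnion, not_or, not_exists, mem_ofPred_eq, not_not, not_and,
    Finset.mem_range] at hcon
  have hex : ∃ j, Accepted σ j a := ⟨J, hcon.1⟩
  have hle : Nat.find hex ≤ J := Nat.find_min' hex hcon.1
  exact ha ⟨Nat.find hex, hle, ⟨Nat.find_spec hex, fun i hi => Nat.find_min hex hi⟩,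
    hcon.2 _ (Nat.lt_succ_of_le hle) (Nat.find_spec hex)⟩

theorem exists_lintegral_selectRule_le {k : ℕ}
    (hk : histMeasure P (fun k => t k + 1) k {v | matchProb P (σ k v) = 0} ≠ 0) :
    ∃ J f, ExpSmall f ∧ ∀ m, ∫⁻ p, errP P (selectRule σ p.1 p.2)
      ∂(((Measure.pi fun _ : Fin m => P).prod (Measure.pi fun _ : Fin m => P)).prod
        (Measure.pi fun _ : Fin m => P)) ≤
      f m + 2 * ((Finset.range (J + 1)).sup fun j => t j.unpair.1 : ℕ) / (m + 1) := by
  obtain ⟨J, f, hf, hfJ⟩ := exists_expSmall_not_selected σ hσ P hk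
  refine ⟨J, f, hf, fun m => (lintegral_prod_le _).trans ((lintegral_le_add_measure (fun a => ?_)
    fun a ha => ?_).trans (add_le_add (hfJ m) le_rfl))⟩
  · exact (lintegral_mono fun b => prob_le_one).trans (by simp)
  · simp only [mem_ofPred_eq, not_not] at ha
    obtain ⟨j, hj, hs, h0⟩ := ha
    simp only [selectRule_eq σ hs]
    have hm : Measurable[univMS (Fin (t j.unpair.1 + 1) → X)] (candidate σ j.unpair.1 a) :=
      fun s hs => (measurable_prodMk_left (x := a)).univMS (measurable_candidate σ hσ j.unpair.1 hs)
    refine (lintegral_errP_patternRule_le P hm h0).trans ?_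
    gcongr
    exact Finset.le_sup (f := fun j : ℕ => t j.unpair.1) (Finset.mem_range.2 (Nat.lt_succ_of_le hj))

end Analysis

/-! ### The learning algorithm -/

section Split

variable {Ω : Type*} {n : ℕ}

theorem measurePreserving_sumSplit {ι κ : Type*} [Fintype ι] [Fintype κ] [MeasurableSpace Ω]
    (P : Measure Ω) [IsProbabilityMeasure P] :
    MeasurePreserving (fun w : ι ⊕ κ → Ω => (w ∘ Sum.inl, w ∘ Sum.inr)) (Measure.pi fun _ => P)
      ((Measure.pi fun _ => P).prod (Measure.pi fun _ => P)) :=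
  measurePreserving_sumPiEquivProdPi fun _ : ι ⊕ κ => P

/-- An embedding of three copies of `Fin (n / 3)` into `Fin n`. -/
noncomputable def thirds (n : ℕ) : ((Fin (n / 3) ⊕ Fin (n / 3)) ⊕ Fin (n / 3)) ↪ Fin n :=
  (Function.Embedding.nonempty_of_card_le (by simp; omega)).some

/-- Split a sample into three parts of the same size. -/
noncomputable def splitSample (s : Fin n → Ω) :
    ((Fin (n / 3) → Ω) × (Fin (n / 3) → Ω)) × (Fin (n / 3) → Ω) :=
  ((s ∘ thirds n ∘ Sum.inl ∘ Sum.inl, s ∘ thirds n ∘ Sum.inl ∘ Sum.inr), s ∘ thirds n ∘ Sum.inr)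

theorem measurePreserving_splitSample [MeasurableSpace Ω] (P : Measure Ω)
    [IsProbabilityMeasure P] :
    MeasurePreserving (splitSample (n := n)) (Measure.pi fun _ => P)
      (((Measure.pi fun _ => P).prod (Measure.pi fun _ => P)).prod (Measure.pi fun _ => P)) :=
  ((measurePreserving_sumSplit P).prod (MeasurePreserving.id _)).comp
    ((measurePreserving_sumSplit P).comp (measurePreserving_comp_injective P (thirds n).injective))

end Split

/-- Run the selection rule on the three parts of the sample. -/
noncomputable def selectAlgorithm {X : Type*} [MeasurableSpace X] {t : ℕ → ℕ}
    (σ : ∀ k, Hist X (fun k => t k + 1) k → (Fin (t k + 1) → X) → Fin (t k + 1) → Bool)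
    (hσ : ∀ k, Measurable[univMS (Hist X (fun k => t k + 1) k × (Fin (t k + 1) → X))]
      fun p : Hist X (fun k => t k + 1) k × (Fin (t k + 1) → X) => σ k p.1 p.2) :
    LearningAlgorithm X where
  H n s := selectRule σ (splitSample s).1 (splitSample s).2
  meas n := universallyMeasurable_iff.2 <| by
    have hm : Measurable (splitSample (n := n) (Ω := X × Bool)) := by
      unfold splitSample
      fun_prop
    refine fun B hB => (measurable_selectRule σ hσ).comp (Measurable.univMS
      (f := fun q : (Fin n → X × Bool) × X => ((splitSample q.1).1, (splitSample q.1).2, q.2)) ?_)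
      (MeasurableSet.of_discrete (s := B))
    exact (hm.comp measurable_fst).fst.prodMk ((hm.comp measurable_fst).snd.prodMk measurable_snd)

theorem exists_expErr_selectAlgorithm_le {X : Type*} [MeasurableSpace X] {t : ℕ → ℕ}
    (σ : ∀ k, Hist X (fun k => t k + 1) k → (Fin (t k + 1) → X) → Fin (t k + 1) → Bool)
    (hσ : ∀ k, Measurable[univMS (Hist X (fun k => t k + 1) k × (Fin (t k + 1) → X))]
      fun p : Hist X (fun k => t k + 1) k × (Fin (t k + 1) → X) => σ k p.1 p.2)
    (P : Measure (X × Bool)) [IsProbabilityMeasure P] {k : ℕ}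
    (hk : histMeasure P (fun k => t k + 1) k {v | matchProb P (σ k v) = 0} ≠ 0) :
    ∃ J f, ExpSmall f ∧ ∀ n, expErr P (selectAlgorithm σ hσ) n ≤
      f (n / 3) + 2 * ((Finset.range (J + 1)).sup fun j => t j.unpair.1 : ℕ) / ((n / 3 : ℕ) + 1) := by
  obtain ⟨J, f, hf, h⟩ := exists_lintegral_selectRule_le σ hσ P hk
  refine ⟨J, f, hf, fun n => le_trans (le_of_eq ?_) (h (n / 3))⟩
  have hae := aemeasurable_errP_selectRule σ hσ P (((Measure.pi fun _ : Fin (n / 3) => P).prod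
    (Measure.pi fun _ : Fin (n / 3) => P)).prod (Measure.pi fun _ : Fin (n / 3) => P))
  rw [← (measurePreserving_splitSample P).map_eq] at hae ⊢
  rw [lintegral_map' hae (measurePreserving_splitSample P).aemeasurable]
  rfl

/-! ### Upper bounds -/

theorem exists_learningAlgorithm {X : Type*} [TopologicalSpace X] [PolishSpace X]
    [MeasurableSpace X] [BorelSpace X] [Nonempty X] {ℋ : Set (X → Bool)}
    (hℋ : MeasurableClass X ℋ) (hne : ℋ.Nonempty) (t : ℕ → ℕ)
    (hno : ¬ ∃ x : ∀ k, Lab (fun k => t k + 1) k → Fin (t k + 1) → X,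
      ∀ k (y : Lab (fun k => t k + 1) k), branch x y ∈ consistentHist ℋ (fun k => t k + 1) k) :
    ∃ A : LearningAlgorithm X, ∀ P : Measure (X × Bool), IsProbabilityMeasure P → Realizable ℋ P →
      ∃ J f, ExpSmall f ∧ ∀ n, expErr P A n ≤
        f n + 2 * ((Finset.range (J + 1)).sup fun j => t j.unpair.1 : ℕ) / ((n / 3 : ℕ) + 1) := by
  have hbase := analyticSet_consistentHist hℋ fun k => t k + 1
  obtain ⟨α, hα, hroot⟩ := exists_countable_value (fun k => t k + 1) _ hbase (fun k => by
    obtain ⟨h, hh⟩ := hne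
    exact ⟨fun j i => (Classical.arbitrary X, h (Classical.arbitrary X)), h, hh, fun _ _ => rfl⟩) hno
  refine ⟨selectAlgorithm (fun k => strategy (consistentHist ℋ fun k => t k + 1) α)
    fun k => measurable_strategy hbase hα, fun P hP hr => ?_⟩
  obtain ⟨k, hk⟩ := exists_histMeasure_ne_zero P (fun k => t k + 1) hr α hroot
  obtain ⟨J, f, hf, h⟩ := exists_expErr_selectAlgorithm_le
    (fun k => strategy (consistentHist ℋ fun k => t k + 1) α)
    (fun k => measurable_strategy hbase hα) P hk
  exact ⟨J, fun n => f (n / 3), hf.comp_div (by norm_num), h⟩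

theorem hasInfiniteLittlestoneTree_of_branch {X : Type*} {ℋ : Set (X → Bool)}
    (x : ∀ k, Lab (fun _ => 0 + 1) k → Fin (0 + 1) → X)
    (hx : ∀ k (y : Lab (fun _ => 0 + 1) k), branch x y ∈ consistentHist ℋ (fun _ => 0 + 1) k) :
    HasInfiniteLittlestoneTree ℋ := by
  refine ⟨fun l => x l.length (fun j _ => l.getD j false) 0, fun y n => ?_⟩
  obtain ⟨h, hh, hc⟩ := hx (n + 1) fun j _ => y j
  refine ⟨h, hh, fun k hk => ?_⟩
  have key : ∀ k' (_ : k' = k) (l : ℕ → Bool), (∀ j < k, l j = y j) →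
      x k' (fun j _ => l j) 0 = x k (fun j _ => y j) 0 := by
    rintro _ rfl l hl
    congr 1
    funext j _
    exact hl j j.2
  beta_reduce
  rw [key _ (List.length_ofFn ..) (fun j => (List.ofFn fun i : Fin k => y i).getD j false)
    fun j hj => by simp [List.getD_eq_getElem?_getD, hj]]
  exact hc ⟨k, Nat.lt_succ_of_le hk⟩ 0

theorem hasInfiniteVCLTree_of_branch {X : Type*} {ℋ : Set (X → Bool)}
    (x : ∀ k, Lab (fun k => k + 1) k → Fin (k + 1) → X)
    (hx : ∀ k (y : Lab (fun k => k + 1) k), branch x y ∈ consistentHist ℋ (fun k => k + 1) k) :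
    HasInfiniteVCLTree ℋ := by
  refine ⟨x, fun y n => ?_⟩
  obtain ⟨h, hh, hc⟩ := hx (n + 1) fun j => y j
  exact ⟨h, hh, fun k hk i => hc ⟨k, Nat.lt_succ_of_le hk⟩ i⟩

theorem learnableAtRate_exp {X : Type*} [TopologicalSpace X] [PolishSpace X]
    [MeasurableSpace X] [BorelSpace X] [Nonempty X] {ℋ : Set (X → Bool)}
    (hℋ : MeasurableClass X ℋ) (hne : ℋ.Nonempty) (hno : ¬ HasInfiniteLittlestoneTree ℋ) :
    LearnableAtRate ℋ fun n => Real.exp (-(n : ℝ)) := by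
  obtain ⟨A, hA⟩ := exists_learningAlgorithm hℋ hne (fun _ => 0)
    fun ⟨x, hx⟩ => hno (hasInfiniteLittlestoneTree_of_branch x hx)
  refine ⟨A, fun P hP hr => ?_⟩
  obtain ⟨J, f, ⟨C, hC, c, hc, hb⟩, hf⟩ := hA P hP hr
  refine ⟨C * Real.exp 1, by positivity, c, hc, fun n => (hf n).trans ?_⟩
  have h0 : ((Finset.range (J + 1)).sup fun _ => 0 : ℕ) = 0 := by simp
  rw [h0]
  simp only [Nat.cast_zero, mul_zero, ENNReal.zero_div, add_zero]
  refine (hb n).trans (ENNReal.ofReal_le_ofReal ?_)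
  rw [mul_assoc, ← Real.exp_add]
  gcongr
  linarith [(Nat.ceil_lt_add_one (show 0 ≤ c * n by positivity)).le]

theorem learnableAtRate_inv {X : Type*} [TopologicalSpace X] [PolishSpace X]
    [MeasurableSpace X] [BorelSpace X] [Nonempty X] {ℋ : Set (X → Bool)}
    (hℋ : MeasurableClass X ℋ) (hne : ℋ.Nonempty) (hno : ¬ HasInfiniteVCLTree ℋ) :
    LearnableAtRate ℋ fun n => 1 / max (n : ℝ) 1 := by
  obtain ⟨A, hA⟩ := exists_learningAlgorithm hℋ hne (fun k => k)
    fun ⟨x, hx⟩ => hno (hasInfiniteVCLTree_of_branch x hx)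
  refine ⟨A, fun P hP hr => ?_⟩
  obtain ⟨J, f, ⟨C, hC, c, hc, hb⟩, hf⟩ := hA P hP hr
  set T : ℕ := (Finset.range (J + 1)).sup fun j : ℕ => j.unpair.1
  refine ⟨C * max 1 (1 / c) + 6 * T, by positivity, 1, one_pos, fun n => (hf n).trans ?_⟩
  rw [one_mul, Nat.ceil_natCast, mul_one_div, add_div, ENNReal.ofReal_add (by positivity)
    (by positivity)]
  have hmax : (0 : ℝ) < max (n : ℝ) 1 := by positivity
  refine add_le_add ((hb n).trans (ENNReal.ofReal_le_ofReal ?_)) ?_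
  · rw [mul_div_assoc]
    gcongr
    rw [le_div_iff₀ hmax]
    rcases le_total (n : ℝ) 1 with h | h
    · rw [max_eq_right h, mul_one]
      exact (Real.exp_le_one_iff.2 (by nlinarith [n.cast_nonneg (α := ℝ)])).trans (le_max_left _ _)
    · rw [max_eq_left h]
      refine le_trans ?_ (le_max_right _ _)
      rw [le_div_iff₀ hc, neg_mul, Real.exp_neg, mul_assoc, inv_mul_le_iff₀ (Real.exp_pos _), mul_one]
      linarith [Real.add_one_le_exp (c * n)]
  · have : (2 * (T : ℝ≥0∞)) / ((n / 3 : ℕ) + 1) =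
        ENNReal.ofReal (2 * T / ((n / 3 : ℕ) + 1)) := by
      rw [ENNReal.ofReal_div_of_pos (by positivity), ENNReal.ofReal_mul (by norm_num),
        ENNReal.ofReal_add (by positivity) (by norm_num)]
      simp
    rw [this]
    refine ENNReal.ofReal_le_ofReal ?_
    rw [div_le_div_iff₀ (by positivity) hmax]
    have h3 : max (n : ℝ) 1 ≤ 3 * ((n / 3 : ℕ) + 1) := by
      refine max_le ?_ (by linarith [(n / 3).cast_nonneg (α := ℝ)])
      have : n ≤ 3 * (n / 3 + 1) := by omega
      exact_mod_cast this
    nlinarith [T.cast_nonneg (α := ℝ)]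

/-! ### Lower bounds from trees -/

theorem sum_comp_flip {n : ℕ} {M : Type*} [AddCommMonoid M] (i : Fin n) (f : (Fin n → Bool) → M) :
    ∑ u, f (Function.update u i (!u i)) = ∑ u, f u := by
  refine Equiv.sum_comp (Function.Involutive.toPerm (fun u => Function.update u i (!u i)) ?_) f
  intro u
  simp

/-- If the prediction of the `i`-th label does not depend on that label on an event of probability
at least `1/2`, then some labelling forces many mistakes. -/
theorem exists_labels_le_sum_measure {n : ℕ} {Ω : Type*} [MeasurableSpace Ω]
    [DiscreteMeasurableSpace Ω] {μ : Measure Ω} {G : Fin n → Set Ω} (hG : ∀ i, 2⁻¹ ≤ μ (G i))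
    {p : Fin n → (Fin n → Bool) → Ω → Bool}
    (hp : ∀ i u b, ∀ w ∈ G i, p i (Function.update u i b) w = p i u w) :
    ∃ u, (n : ℝ≥0∞) / 4 ≤ ∑ i, μ {w ∈ G i | p i u w ≠ u i} := by
  have key (i : Fin n) : (2 : ℝ≥0∞) ^ n / 4 ≤ ∑ u, μ {w ∈ G i | p i u w ≠ u i} := by
    set e : (Fin n → Bool) → ℝ≥0∞ := fun u => μ {w ∈ G i | p i u w ≠ u i}
    have h1 (u : Fin n → Bool) : 2⁻¹ ≤ e u + e (Function.update u i (!u i)) := by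
      refine (hG i).trans ((measure_mono fun w hw => ?_).trans (measure_union_le _ _))
      by_cases h : p i u w = u i
      · right
        refine ⟨hw, ?_⟩
        rw [hp i u _ w hw, h]
        simp
      · exact .inl ⟨hw, h⟩
    have h2 : ∑ _u : Fin n → Bool, (2⁻¹ : ℝ≥0∞) ≤ ∑ u, e u + ∑ u, e u := by
      nth_rewrite 2 [← sum_comp_flip i e]
      rw [← Finset.sum_add_distrib]
      exact Finset.sum_le_sum fun u _ => h1 u
    rw [Finset.sum_const, Finset.card_univ, nsmul_eq_mul, ← two_mul] at h2
    simp only [Fintype.card_pi, Fintype.card_bool, Finset.prod_const, Finset.card_univ,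
      Fintype.card_fin, Nat.cast_pow, Nat.cast_ofNat] at h2
    refine ENNReal.div_le_of_le_mul' ?_
    calc (2 : ℝ≥0∞) ^ n = 2 * (2 ^ n * 2⁻¹) := by
          rw [mul_comm, mul_assoc, ENNReal.inv_mul_cancel (by simp) (by simp), mul_one]
      _ ≤ 2 * (2 * ∑ u, e u) := by gcongr
      _ = 4 * ∑ u, e u := by rw [← mul_assoc]; norm_num
  by_contra! hlt
  have h3 : ∑ u : Fin n → Bool, ∑ i, μ {w ∈ G i | p i u w ≠ u i} <
      ∑ _u : Fin n → Bool, (n : ℝ≥0∞) / 4 :=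
    ENNReal.sum_lt_sum_of_nonempty ⟨fun _ => false, Finset.mem_univ _⟩ fun u _ => hlt u
  rw [Finset.sum_comm] at h3
  refine absurd (Finset.sum_le_sum fun i _ => key i) (not_le.2 (h3.trans_eq ?_))
  simp [ENNReal.div_eq_inv_mul]
  ring

theorem lintegral_le_expErr_map {X I : Type*} [MeasurableSpace X] [Countable I]
    [MeasurableSpace I] [DiscreteMeasurableSpace I] (π : Measure I) [IsProbabilityMeasure π]
    (z : I → X × Bool) (A : LearningAlgorithm X) (n : ℕ) :
    ∫⁻ w, π {a | A.H n (z ∘ w) (z a).1 ≠ (z a).2} ∂(Measure.pi fun _ : Fin n => π) ≤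
      expErr (π.map z) A n := by
  have hz : Measurable z := .of_discrete
  have : IsProbabilityMeasure (π.map z) := Measure.isProbabilityMeasure_map hz.aemeasurable
  have hA : NullMeasurableSet {q : (Fin n → X × Bool) × (X × Bool) | A.H n q.1 q.2.1 ≠ q.2.2}
      ((Measure.pi fun _ : Fin n => π.map z).prod (π.map z)) := by
    refine nullMeasurableSet_of_univMS ?_ _
    have h1 : Measurable[univMS _] fun q : (Fin n → X × Bool) × (X × Bool) => A.H n q.1 q.2.1 :=
      Measurable.comp (f := fun q : (Fin n → X × Bool) × (X × Bool) => (q.1, q.2.1))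
        (universallyMeasurable_iff.1 (A.meas n))
        (Measurable.univMS (by fun_prop))
    have h2 : Measurable[univMS _] fun q : (Fin n → X × Bool) × (X × Bool) => q.2.2 :=
      fun s hs => MeasurableSet.univMS (measurable_snd.comp measurable_snd hs)
    exact (@measurableSet_eq_fun _ _ (univMS _) _ _ _ _ h1 h2).compl
  have hae : AEMeasurable (fun s => π.map z {p | A.H n s p.1 ≠ p.2})
      (Measure.pi fun _ : Fin n => π.map z) := aemeasurable_measure_slice hA
  have hpi : (Measure.pi fun _ : Fin n => π.map z) =
      (Measure.pi fun _ : Fin n => π).map fun w i => z (w i) :=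
    (Measure.pi_map_pi (μ := fun _ : Fin n => π) fun _ => hz.aemeasurable).symm
  unfold expErr errP
  rw [hpi] at hae ⊢
  rw [lintegral_map' hae Measurable.of_discrete.aemeasurable]
  exact lintegral_mono fun w => Measure.le_map_apply hz.aemeasurable _

instance instDiscreteMeasurableSpaceSigmaFin (d : ℕ → ℕ) :
    DiscreteMeasurableSpace (Σ j, Fin (d j)) :=
  ⟨fun s => MeasurableSpace.measurableSet_iInf.2 fun j =>
    MeasurableSet.of_discrete (s := Sigma.mk j ⁻¹' s)⟩

/-- The probability measure on the nodes of a tree which gives the levels `≥ j` mass `q j` and is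
uniform on each level. -/
theorem exists_level_measure {d : ℕ → ℕ} (hd : ∀ j, 0 < d j) {q : ℕ → ℝ} (h0 : q 0 = 1)
    (hq : Antitone q) (hlim : Tendsto q atTop (𝓝 0)) :
    ∃ π : Measure (Σ j, Fin (d j)), IsProbabilityMeasure π ∧
      (∀ a, π {a} = ENNReal.ofReal (q a.1 - q (a.1 + 1)) / d a.1) ∧
      ∀ j, π {a | j ≤ a.1} = ENNReal.ofReal (q j) := by
  have htail (j : ℕ) : ∑' m, ENNReal.ofReal (q (m + j) - q (m + j + 1)) = ENNReal.ofReal (q j) := by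
    have h1 : HasSum (fun m => q (m + j) - q (m + j + 1)) (q j) := by
      rw [hasSum_iff_tendsto_nat_of_nonneg fun m => sub_nonneg.2 (hq (Nat.le_succ _))]
      have h2 (n : ℕ) : ∑ m ∈ Finset.range n, (q (m + j) - q (m + j + 1)) = q j - q (n + j) := by
        have := Finset.sum_range_sub' (fun m => q (m + j)) n
        simpa [add_right_comm] using this
      simp only [h2]
      simpa using ((tendsto_add_atTop_iff_nat j).2 hlim).const_sub (q j)
    rw [← ENNReal.ofReal_tsum_of_nonneg (fun m => sub_nonneg.2 (hq (Nat.le_succ _))) h1.summable,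
      h1.tsum_eq]
  set π : Measure (Σ j, Fin (d j)) := Measure.sum fun a =>
    (ENNReal.ofReal (q a.1 - q (a.1 + 1)) / d a.1) • Measure.dirac a
  have hlevel (j : ℕ) : π {a | j ≤ a.1} = ENNReal.ofReal (q j) := by
    rw [Measure.sum_apply_of_countable, ENNReal.tsum_sigma', ← htail j,
      ← ENNReal.summable.sum_add_tsum_nat_add' (k := j)]
    have h1 (l : ℕ) (i : Fin (d l)) : (Measure.dirac (⟨l, i⟩ : Σ j, Fin (d j)))
        {a | j ≤ a.1} = if j ≤ l then 1 else 0 := by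
      rw [Measure.dirac_apply' _ .of_discrete]
      simp [Set.indicator_apply]
    simp only [Measure.smul_apply, h1, smul_eq_mul, tsum_fintype, Finset.sum_const,
      Finset.card_univ, Fintype.card_fin, nsmul_eq_mul]
    rw [Finset.sum_eq_zero, zero_add]
    · refine tsum_congr fun m => ?_
      rw [if_pos (by omega), mul_one, ENNReal.mul_div_cancel]
      · simpa using (hd _).ne'
      · simp
    · intro l hl
      rw [if_neg (by simpa using hl)]
      simp
  refine ⟨π, ⟨?_⟩, fun a => ?_, hlevel⟩
  · simpa [h0] using hlevel 0
  · rw [Measure.sum_apply_of_countable, tsum_eq_single a]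
    · simp
    · intro b hb
      simp [Measure.dirac_apply', hb]

theorem exists_forall_of_local {α : ℕ → Type*} [∀ j, Nonempty (α j)]
    {Good : ∀ _ : ℕ, (∀ j, α j) → Prop}
    (hloc : ∀ j y y', (∀ l ≤ j, y l = y' l) → Good j y → Good j y')
    (hex : ∀ j y, ∃ u, Good j (Function.update y j u)) : ∃ y, ∀ j, Good j y := by
  choose c hc using hex
  let Y : ℕ → ∀ j, α j := fun k => Nat.rec (fun j => Classical.arbitrary (α j))
    (fun k y => Function.update y k (c k y)) k
  have hY (k : ℕ) : Y (k + 1) = Function.update (Y k) k (c k (Y k)) := rfl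
  have hstable (l k : ℕ) (h : l < k) : Y k l = Y (l + 1) l := by
    induction k, h using Nat.le_induction with
    | base => rfl
    | succ k h ih => rw [hY, Function.update_of_ne (by omega), ih]
  refine ⟨fun j => Y (j + 1) j, fun j => hloc j (Y (j + 1)) _ (fun l hl => ?_) ?_⟩
  · exact hstable l (j + 1) (by omega)
  · rw [hY]
    exact hc j (Y j)

section Tree

variable {X : Type*} {d : ℕ → ℕ}

/-- The labelled node of a tree at a given position along an infinite branch. -/
def treeNode (x : ∀ k, Lab d k → Fin (d k) → X) (y : ∀ j, Fin (d j) → Bool)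
    (a : Σ j, Fin (d j)) : X × Bool :=
  (x a.1 (fun l => y l) a.2, y a.1 a.2)

theorem treeNode_congr (x : ∀ k, Lab d k → Fin (d k) → X) {y y' : ∀ j, Fin (d j) → Bool}
    {a : Σ j, Fin (d j)} (h : ∀ l < a.1, y l = y' l) (h' : y a.1 a.2 = y' a.1 a.2) :
    treeNode x y a = treeNode x y' a := by
  simp only [treeNode, h', Prod.mk.injEq, and_true]
  congr 1
  funext l
  exact h l l.2

/-- Samples which meet neither the node `(j, i)` nor the levels beyond `j`. -/
def avoidNode (n j : ℕ) (i : Fin (d j)) : Set (Fin n → Σ j, Fin (d j)) :=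
  {w | ∀ r, (w r).1 ≤ j ∧ w r ≠ ⟨j, i⟩}

variable {q : ℕ → ℝ} {π : Measure (Σ j, Fin (d j))}

theorem half_le_measure_avoidNode [IsProbabilityMeasure π]
    (hπ : ∀ a, π {a} = ENNReal.ofReal (q a.1 - q (a.1 + 1)) / d a.1)
    (hπ' : ∀ j, π {a | j ≤ a.1} = ENNReal.ofReal (q j)) {n j : ℕ}
    (hn : 2 * n * (ENNReal.ofReal (q (j + 1)) + ENNReal.ofReal (q j - q (j + 1)) / d j) ≤ 1)
    (i : Fin (d j)) :
    2⁻¹ ≤ (Measure.pi fun _ : Fin n => π) (avoidNode n j i) := by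
  set S : Set (Σ j, Fin (d j)) := {a | j + 1 ≤ a.1} ∪ {⟨j, i⟩}
  have hS : π S ≤ ENNReal.ofReal (q (j + 1)) + ENNReal.ofReal (q j - q (j + 1)) / d j :=
    (measure_union_le _ _).trans_eq (by rw [hπ, hπ'])
  have h1 : (Measure.pi fun _ : Fin n => π) (avoidNode n j i)ᶜ ≤ 2⁻¹ := by
    have hsub : (avoidNode n j i)ᶜ ⊆ ⋃ r, Function.eval r ⁻¹' S := by
      intro w hw
      simp only [avoidNode, mem_compl_iff, mem_ofPred_eq, not_forall, not_and_or, not_le, not_not]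
        at hw
      obtain ⟨r, hr⟩ := hw
      exact mem_iUnion.2 ⟨r, hr⟩
    refine (measure_mono hsub).trans ((measure_iUnion_fintype_le _ _).trans ?_)
    have h2 (r : Fin n) : (Measure.pi fun _ : Fin n => π) (Function.eval r ⁻¹' S) = π S :=
      (measurePreserving_eval (fun _ : Fin n => π) r).measure_preimage
        MeasurableSet.of_discrete.nullMeasurableSet
    simp only [h2, Finset.sum_const, Finset.card_univ, Fintype.card_fin, nsmul_eq_mul]
    rw [ENNReal.le_inv_iff_mul_le, mul_comm]
    refine le_trans ?_ hn
    rw [mul_assoc]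
    gcongr
  have h3 := prob_add_prob_compl (μ := Measure.pi fun _ : Fin n => π)
    (s := avoidNode n j i) .of_discrete
  by_contra! hlt
  have := ENNReal.add_lt_add_of_lt_of_le (by simp) hlt h1
  rw [h3, ENNReal.inv_two_add_inv_two] at this
  exact this.false

/-- The labelling `y` forces many mistakes on level `j`. -/
def HardLevel (π : Measure (Σ j, Fin (d j))) (x : ∀ k, Lab d k → Fin (d k) → X) {n : ℕ}
    (H : (Fin n → X × Bool) → X → Bool) (j : ℕ) (y : ∀ j, Fin (d j) → Bool) : Prop :=
  (d j : ℝ≥0∞) / 4 ≤ ∑ i, (Measure.pi fun _ : Fin n => π)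
    {w ∈ avoidNode n j i | H (treeNode x y ∘ w) (treeNode x y ⟨j, i⟩).1 ≠ y j i}

theorem HardLevel.congr {x : ∀ k, Lab d k → Fin (d k) → X} {n : ℕ}
    {H : (Fin n → X × Bool) → X → Bool} {j : ℕ} {y y' : ∀ j, Fin (d j) → Bool}
    (hy : ∀ l ≤ j, y l = y' l) (h : HardLevel π x H j y) : HardLevel π x H j y' := by
  unfold HardLevel at h ⊢
  convert h using 5 with i _ w
  refine and_congr_right fun hw => ?_
  have h1 : treeNode x y' ∘ w = treeNode x y ∘ w := funext fun r =>
    treeNode_congr x (fun l hl => (hy l (hl.le.trans (hw r).1)).symm) (by rw [hy _ (hw r).1])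
  have h2 : treeNode x y' ⟨j, i⟩ = treeNode x y ⟨j, i⟩ :=
    treeNode_congr x (fun l hl => (hy l hl.le).symm) (by rw [hy _ le_rfl])
  rw [h1, h2, hy j le_rfl]

theorem exists_hardLevel_update [IsProbabilityMeasure π]
    (hπ : ∀ a, π {a} = ENNReal.ofReal (q a.1 - q (a.1 + 1)) / d a.1)
    (hπ' : ∀ j, π {a | j ≤ a.1} = ENNReal.ofReal (q j)) {n j : ℕ}
    (hn : 2 * n * (ENNReal.ofReal (q (j + 1)) + ENNReal.ofReal (q j - q (j + 1)) / d j) ≤ 1)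
    (x : ∀ k, Lab d k → Fin (d k) → X) (H : (Fin n → X × Bool) → X → Bool)
    (y : ∀ j, Fin (d j) → Bool) : ∃ u, HardLevel π x H j (Function.update y j u) := by
  obtain ⟨u, hu⟩ := exists_labels_le_sum_measure (μ := Measure.pi fun _ : Fin n => π)
    (G := fun i => avoidNode n j i) (half_le_measure_avoidNode hπ hπ' hn)
    (p := fun i u w => H (treeNode x (Function.update y j u) ∘ w)
      (treeNode x (Function.update y j u) ⟨j, i⟩).1) (by
    intro i u b w hw
    have h1 : treeNode x (Function.update y j (Function.update u i b)) ∘ w =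
        treeNode x (Function.update y j u) ∘ w := funext fun r => by
      refine treeNode_congr x (fun l hl => ?_) ?_
      · rw [Function.update_of_ne, Function.update_of_ne] <;> exact (hl.trans_le (hw r).1).ne
      · have h2 := (hw r).2
        generalize w r = a at h2
        obtain ⟨k, m⟩ := a
        by_cases hk : k = j
        · subst hk
          have hm : m ≠ i := fun h => h2 (h ▸ rfl)
          simp [hm]
        · simp [hk]
    have h2 : (treeNode x (Function.update y j (Function.update u i b)) ⟨j, i⟩).1 =
        (treeNode x (Function.update y j u) ⟨j, i⟩).1 := by
      simp only [treeNode]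
      congr 1
      funext l
      rw [Function.update_of_ne, Function.update_of_ne] <;> exact l.2.ne
    simp only [h1, h2])
  refine ⟨u, ?_⟩
  unfold HardLevel
  simpa using hu

theorem HardLevel.le_expErr [MeasurableSpace X] [IsProbabilityMeasure π]
    (hπ : ∀ a, π {a} = ENNReal.ofReal (q a.1 - q (a.1 + 1)) / d a.1) {n j : ℕ} (hd : 0 < d j)
    {x : ∀ k, Lab d k → Fin (d k) → X} {A : LearningAlgorithm X} {y : ∀ j, Fin (d j) → Bool}
    (h : HardLevel π x (A.H n) j y) :
    ENNReal.ofReal ((q j - q (j + 1)) / 4) ≤ expErr (π.map (treeNode x y)) A n := by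
  refine le_trans ?_ (lintegral_le_expErr_map π (treeNode x y) A n)
  set c := ENNReal.ofReal (q j - q (j + 1)) / d j
  set E : Fin (d j) → Set (Fin n → Σ j, Fin (d j)) := fun i =>
    {w ∈ avoidNode n j i | A.H n (treeNode x y ∘ w) (treeNode x y ⟨j, i⟩).1 ≠ y j i}
  calc ENNReal.ofReal ((q j - q (j + 1)) / 4)
      = c * (d j / 4) := by
        rw [ENNReal.ofReal_div_of_pos (by norm_num), ← mul_div_assoc, ENNReal.div_mul_cancel]
        · norm_num
        · simpa using hd.ne'
        · simp
    _ ≤ c * ∑ i, (Measure.pi fun _ : Fin n => π) (E i) := by gcongr; exact h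
    _ = ∫⁻ w, ∑ i, (E i).indicator (fun _ => c) w ∂(Measure.pi fun _ : Fin n => π) := by
        rw [lintegral_finsetSum _ fun _ _ => .of_discrete, Finset.mul_sum]
        exact Finset.sum_congr rfl fun i _ => (lintegral_indicator_const .of_discrete _).symm
    _ ≤ _ := by
        refine lintegral_mono fun w => ?_
        set Q := {a | A.H n (treeNode x y ∘ w) (treeNode x y a).1 ≠ (treeNode x y a).2}
        have hdisj : Pairwise (Function.onFun Disjoint fun i : Fin (d j) => Q ∩ {⟨j, i⟩}) := by
          intro i i' hi
          refine Disjoint.mono inter_subset_right inter_subset_right ?_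
          simpa using fun h => hi h
        refine le_trans (Finset.sum_le_sum (g := fun i => π (Q ∩ {⟨j, i⟩})) fun i _ => ?_) ?_
        · by_cases hw : w ∈ E i
          swap
          · simp [hw]
          rw [indicator_of_mem hw, inter_eq_self_of_subset_right, hπ]
          rw [singleton_subset_iff]
          exact hw.2
        · rw [← tsum_fintype (L := .unconditional _),
            ← measure_iUnion hdisj fun _ => .of_discrete]
          exact measure_mono (iUnion_subset fun _ => inter_subset_left)

theorem realizable_map_treeNode [MeasurableSpace X] [MeasurableSingletonClass X]
    {ℋ : Set (X → Bool)} {x : ∀ k, Lab d k → Fin (d k) → X}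
    (hx : ∀ k y, branch x y ∈ consistentHist ℋ d k) (hlim : Tendsto q atTop (𝓝 0))
    (hπ' : ∀ j, π {a | j ≤ a.1} = ENNReal.ofReal (q j)) (y : ∀ j, Fin (d j) → Bool) :
    Realizable ℋ (π.map (treeNode x y)) := by
  have hlim' : Tendsto (fun j => ENNReal.ofReal (q j)) atTop (𝓝 0) := by
    simpa using ENNReal.tendsto_ofReal hlim
  refine nonpos_iff_eq_zero.1 (ge_of_tendsto' hlim' fun J => ?_)
  obtain ⟨h, hh, hc⟩ := hx J fun j => y j
  refine (iInf₂_le h hh).trans ?_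
  have hfin : (treeNode x y '' {a | a.1 < J}).Finite := by
    refine Set.Finite.image _ ((Set.finite_iUnion fun j : Fin J =>
      Set.finite_range fun i : Fin (d j) => (⟨j, i⟩ : Σ j, Fin (d j))).subset ?_)
    exact fun a ha => mem_iUnion.2 ⟨⟨a.1, ha⟩, a.2, rfl⟩
  calc errP (π.map (treeNode x y)) h
      ≤ π.map (treeNode x y) (treeNode x y '' {a | a.1 < J})ᶜ := by
        refine measure_mono ?_
        rintro _ hp ⟨a, ha, rfl⟩
        exact hp (hc ⟨a.1, ha⟩ a.2)
    _ = π (treeNode x y ⁻¹' (treeNode x y '' {a | a.1 < J})ᶜ) :=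
        Measure.map_apply .of_discrete hfin.measurableSet.compl
    _ ≤ π {a | J ≤ a.1} := by
        refine measure_mono fun a ha => ?_
        by_contra hJ
        exact ha ⟨a, by simpa using hJ, rfl⟩
    _ = ENNReal.ofReal (q J) := hπ' J

/-- An infinite tree yields, for every learning algorithm, a realizable distribution whose learning
curve is bounded below along a given sequence of sample sizes. -/
theorem exists_realizable_le_expErr [MeasurableSpace X] [MeasurableSingletonClass X]
    {ℋ : Set (X → Bool)} {x : ∀ k, Lab d k → Fin (d k) → X}
    (hx : ∀ k y, branch x y ∈ consistentHist ℋ d k) (hd : ∀ j, 0 < d j) (h0 : q 0 = 1)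
    (hq : Antitone q) (hlim : Tendsto q atTop (𝓝 0)) {n : ℕ → ℕ}
    (hn : ∀ j, 2 * n j * (q (j + 1) + (q j - q (j + 1)) / d j) ≤ 1) (A : LearningAlgorithm X) :
    ∃ P : Measure (X × Bool), IsProbabilityMeasure P ∧ Realizable ℋ P ∧
      ∀ j, ENNReal.ofReal ((q j - q (j + 1)) / 4) ≤ expErr P A (n j) := by
  obtain ⟨π, hprob, hπ, hπ'⟩ := exists_level_measure hd h0 hq hlim
  have hq0 (j : ℕ) : 0 ≤ q j := hq.le_of_tendsto hlim j
  have hn' (j : ℕ) : 2 * n j *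
      (ENNReal.ofReal (q (j + 1)) + ENNReal.ofReal (q j - q (j + 1)) / d j) ≤ 1 := by
    have h1 : 0 ≤ q j - q (j + 1) := sub_nonneg.2 (hq (Nat.le_succ _))
    have h2 : (0 : ℝ) < d j := by exact_mod_cast hd j
    rw [← ENNReal.ofReal_natCast (d j), ← ENNReal.ofReal_div_of_pos h2,
      ← ENNReal.ofReal_add (hq0 _) (by positivity), ← ENNReal.ofReal_natCast (n j),
      ← ENNReal.ofReal_ofNat, ← ENNReal.ofReal_mul (by positivity),
      ← ENNReal.ofReal_mul (by positivity)]
    exact ENNReal.ofReal_le_one.2 (hn j)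
  obtain ⟨y, hy⟩ := exists_forall_of_local (Good := fun j y => HardLevel π x (A.H (n j)) j y)
    (fun j y y' h => HardLevel.congr h)
    (fun j y => exists_hardLevel_update hπ hπ' (hn' j) x (A.H (n j)) y)
  exact ⟨π.map (treeNode x y),
    Measure.isProbabilityMeasure_map Measurable.of_discrete.aemeasurable,
    realizable_map_treeNode hx hlim hπ' y, fun j => (hy j).le_expErr hπ (hd j)⟩

end Tree

theorem exists_ne_of_three_le_encard {X : Type*} {ℋ : Set (X → Bool)} (h : 3 ≤ ℋ.encard) :
    ∃ h₁ ∈ ℋ, ∃ h₂ ∈ ℋ, ∃ x x', h₁ x = h₂ x ∧ h₁ x' ≠ h₂ x' := by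
  obtain ⟨t, ht, hcard⟩ := Set.exists_subset_encard_eq h
  obtain ⟨f, g, k, hfg, hfk, hgk, rfl⟩ := Set.encard_eq_three.1 hcard
  simp only [Set.insert_subset_iff, Set.singleton_subset_iff] at ht
  obtain ⟨hf, hg, hk⟩ := ht
  obtain ⟨a, ha⟩ := Function.ne_iff.1 hfg
  by_cases hka : f a = k a
  · obtain ⟨b, hb⟩ := Function.ne_iff.1 hfk
    exact ⟨f, hf, k, hk, a, b, hka, hb⟩
  · obtain ⟨b, hb⟩ := Function.ne_iff.1 hgk
    refine ⟨g, hg, k, hk, a, b, ?_, hb⟩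
    cases hf : f a <;> cases hg : g a <;> cases hk : k a <;> simp_all

theorem notLearnableFasterThan_exp {X : Type*} [MeasurableSpace X] [MeasurableSingletonClass X]
    {ℋ : Set (X → Bool)} (hcard : 3 ≤ ℋ.encard) :
    NotLearnableFasterThan ℋ fun n => Real.exp (-(n : ℝ)) := by
  obtain ⟨h₁, hh₁, h₂, hh₂, x, x', hx, hx'⟩ := exists_ne_of_three_le_encard hcard
  have hb (b : Bool) : ∃ h ∈ ℋ, h x = h₁ x ∧ h x' = b := by
    by_cases h : h₁ x' = b
    · exact ⟨h₁, hh₁, rfl, h⟩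
    · refine ⟨h₂, hh₂, hx.symm, ?_⟩
      cases b <;> cases h1 : h₁ x' <;> cases h2 : h₂ x' <;> simp_all
  intro A
  set s : ∀ n, Fin n → X × Bool := fun n _ => (x, h₁ x)
  obtain ⟨b, hinf⟩ := Finite.exists_infinite_fiber fun n => !A.H n (s n) x'
  rw [Set.infinite_coe_iff] at hinf
  set P : Measure (X × Bool) :=
    (2⁻¹ : ℝ≥0∞) • Measure.dirac (x, h₁ x) + (2⁻¹ : ℝ≥0∞) • Measure.dirac (x', b)
  have hP : IsProbabilityMeasure P := ⟨by simp [P, ENNReal.inv_two_add_inv_two]⟩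
  refine ⟨P, hP, ?_, 1 / 2, by norm_num, 1, one_pos, hinf.mono fun n hn => ?_⟩
  · obtain ⟨h, hh, hhx, hhx'⟩ := hb b
    have hmeas : MeasurableSet ({(x, h₁ x), (x', b)} : Set (X × Bool)) :=
      (Set.toFinite _).measurableSet
    refine nonpos_iff_eq_zero.1 ((iInf₂_le h hh).trans ?_)
    calc errP P h ≤ P {(x, h₁ x), (x', b)}ᶜ := by
          refine measure_mono ?_
          rintro _ hp (rfl | rfl)
          · exact hp hhx
          · exact hp hhx'
      _ = 0 := by simp [P, Measure.dirac_apply' _ hmeas.compl]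
      _ ≤ 0 := le_rfl
  · have hpred : A.H n (s n) x' ≠ b := by
      have : (!A.H n (s n) x') = b := hn
      rw [← this]
      simp
    have h1 : (2⁻¹ : ℝ≥0∞) ≤ P {(x, h₁ x)} := by simp [P]
    have h2 : (2⁻¹ : ℝ≥0∞) ≤ errP P (A.H n (s n)) := by
      refine le_trans ?_ (measure_mono (s := {(x', b)}) (by simpa using hpred))
      simp [P]
    simp only [mem_ofPred_eq, one_mul, Nat.ceil_natCast]
    calc ENNReal.ofReal (1 / 2 * Real.exp (-(n : ℝ)))
        ≤ ENNReal.ofReal (2⁻¹ * 2⁻¹ ^ n) := by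
          refine ENNReal.ofReal_le_ofReal ?_
          rw [one_div, Real.exp_neg, ← mul_one (n : ℝ), Real.exp_nat_mul, ← inv_pow]
          gcongr
          linarith [Real.add_one_le_exp 1]
      _ = 2⁻¹ * 2⁻¹ ^ n := by
          rw [ENNReal.ofReal_mul (by norm_num), ENNReal.ofReal_pow (by norm_num),
            ENNReal.ofReal_inv_of_pos (by norm_num), ENNReal.ofReal_ofNat]
      _ ≤ errP P (A.H n (s n)) * (Measure.pi fun _ : Fin n => P) {s n} := by
          rw [Measure.pi_singleton]
          simp only [s, Finset.prod_const, Finset.card_univ, Fintype.card_fin]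
          gcongr
      _ = ∫⁻ t in {s n}, errP P (A.H n t) ∂(Measure.pi fun _ : Fin n => P) :=
          by rw [lintegral_singleton]
      _ ≤ expErr P A n := setLIntegral_le_lintegral _ _

theorem notLearnableFasterThan_inv {X : Type*} [MeasurableSpace X] [MeasurableSingletonClass X]
    {ℋ : Set (X → Bool)} (hT : HasInfiniteLittlestoneTree ℋ) :
    NotLearnableFasterThan ℋ fun n => 1 / max (n : ℝ) 1 := by
  obtain ⟨x, hx⟩ := hT
  intro A
  obtain ⟨P, hP, hreal, hle⟩ := exists_realizable_le_expErr (ℋ := ℋ) (d := fun _ => 1)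
    (x := fun k y _ => x (List.ofFn fun l : Fin k => y l 0)) (fun k y => by
      obtain ⟨h, hh, hc⟩ := hx (fun j => if hj : j < k then y ⟨j, hj⟩ 0 else false) k
      refine ⟨h, hh, fun j i => ?_⟩
      have := hc j j.2.le
      simp only [j.2, dite_true] at this
      rw [Subsingleton.elim i 0]
      simp only [branch]
      rw [← this]
      congr 3
      funext l
      simp [l.2.trans j.2]
      rfl) (fun _ => one_pos) (q := fun j => 2⁻¹ ^ j) (by simp)
    (pow_right_anti₀ (by norm_num) (by norm_num))
    (tendsto_pow_atTop_nhds_zero_of_lt_one (by norm_num) (by norm_num))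
    (n := fun j => 2 ^ j / 2) (fun j => by
      have h1 : ((2 ^ j / 2 : ℕ) : ℝ) ≤ 2 ^ j / 2 := by
        simpa using Nat.cast_div_le (α := ℝ) (m := 2 ^ j) (n := 2)
      calc (2 : ℝ) * (2 ^ j / 2 : ℕ) * (2⁻¹ ^ (j + 1) + (2⁻¹ ^ j - 2⁻¹ ^ (j + 1)) / (1 : ℕ))
          = 2 * (2 ^ j / 2 : ℕ) * 2⁻¹ ^ j := by simp
        _ ≤ 2 * (2 ^ j / 2) * 2⁻¹ ^ j := by gcongr
        _ = 1 := by rw [mul_div_cancel₀ _ two_ne_zero, ← mul_pow]; norm_num) A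
  refine ⟨P, hP, hreal, 1 / 16, by norm_num, 1, one_pos, (Set.infinite_range_of_injective
    (Nat.pow_right_injective le_rfl)).mono ?_⟩
  rintro _ ⟨j, rfl⟩
  have h1 := hle (j + 1)
  rw [pow_succ 2, Nat.mul_div_cancel _ two_pos] at h1
  refine le_trans (ENNReal.ofReal_le_ofReal ?_) h1
  have h2 : max (2 ^ j : ℝ) 1 = 2 ^ j := max_eq_left (one_le_pow₀ one_le_two)
  simp only [one_mul, Nat.ceil_natCast]
  simp only [Nat.cast_pow, Nat.cast_ofNat, h2]
  refine le_of_eq ?_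
  simp only [pow_succ, inv_pow]
  ring

/-- The labels of a branch of a thinned out VCL tree, as labels in the full tree. -/
noncomputable def padLabels {d s : ℕ → ℕ} {k : ℕ} (y : Lab d k) (L : ℕ) (i : Fin (L + 1)) : Bool :=
  open Classical in decide (∃ j : Fin k, ∃ h : (i : ℕ) < d j, s j = L ∧ y j ⟨i, h⟩ = true)

theorem HasInfiniteVCLTree.exists_branch {X : Type*} {ℋ : Set (X → Bool)}
    (hT : HasInfiniteVCLTree ℋ) {d : ℕ → ℕ} (hd : ∀ j, 0 < d j) :
    ∃ x : ∀ k, Lab d k → Fin (d k) → X, ∀ k y, branch x y ∈ consistentHist ℋ d k := by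
  obtain ⟨x, hx⟩ := hT
  set s : ℕ → ℕ := fun j => ∑ l ∈ Finset.range (j + 1), d l
  have hs : StrictMono s := strictMono_nat_of_lt_succ fun j => by
    simp only [s]
    rw [Finset.sum_range_succ _ (j + 1)]
    exact Nat.lt_add_of_pos_right (hd _)
  have hds (j : ℕ) : d j ≤ s j + 1 :=
    (Finset.single_le_sum (f := d) (fun _ _ => Nat.zero_le _)
      (Finset.self_mem_range_succ j)).trans (Nat.le_succ _)
  refine ⟨fun k y i => x (s k) (fun l => padLabels (s := s) y l) (Fin.castLE (hds k) i),
    fun k y => ?_⟩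
  obtain ⟨h, hh, hc⟩ := hx (padLabels (s := s) y) (s k)
  refine ⟨h, hh, fun j i => ?_⟩
  have h1 := hc (s j) (hs j.2).le (Fin.castLE (hds j) i)
  have h2 : padLabels (s := s) y (s j) (Fin.castLE (hds j) i) = y j i := by
    rw [Bool.eq_iff_iff, padLabels, decide_eq_true_iff]
    constructor
    · rintro ⟨j', hi, hj, hy⟩
      obtain rfl := Fin.ext (hs.injective hj)
      exact hy
    · exact fun hy => ⟨j, i.2, rfl, hy⟩
  rw [h2] at h1
  simp only [branch]
  rw [← h1]
  congr 2
  funext l m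
  rw [Bool.eq_iff_iff, padLabels, padLabels, decide_eq_true_iff, decide_eq_true_iff]
  constructor
  · rintro ⟨j', hi, hj, hy⟩
    exact ⟨Fin.castLE j.2.le j', hi, hj, hy⟩
  · rintro ⟨j', hi, hj, hy⟩
    have hlt : (j' : ℕ) < j := hs.lt_iff_lt.1 (hj ▸ l.2)
    exact ⟨⟨j', hlt⟩, hi, hj, hy⟩

theorem IsRate.exists_slow_sequence {R : ℕ → ℝ} (hR : IsRate R) :
    ∃ (q : ℕ → ℝ) (n : ℕ → ℕ), q 0 = 1 ∧ StrictMono n ∧ (∀ j, 0 < q j) ∧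
      (∀ j, q (j + 1) = q j / (4 * (n j + 1))) ∧ ∀ j, R (n j) ≤ q j / 2 := by
  have h1 : ∀ (c : ℝ) (m : ℕ), ∃ n, m < n ∧ (0 < c → R n ≤ c / 2) := fun c m => by
    by_cases hc : 0 < c
    · obtain ⟨n, hn, hn'⟩ := ((hR.2.eventually_le_const (half_pos hc)).and
        (eventually_gt_atTop m)).exists
      exact ⟨n, hn', fun _ => hn⟩
    · exact ⟨m + 1, by omega, fun h => absurd h hc⟩
  choose N hN hN' using h1
  let S : ℕ → ℝ × ℕ := fun j => Nat.rec (1, N 1 0)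
    (fun _ p => (p.1 / (4 * (p.2 + 1)), N (p.1 / (4 * (p.2 + 1))) p.2)) j
  have hpos (j : ℕ) : 0 < (S j).1 := by
    induction j with
    | zero => exact one_pos
    | succ j ih => exact div_pos ih (by positivity)
  refine ⟨fun j => (S j).1, fun j => (S j).2, rfl, strictMono_nat_of_lt_succ fun j => hN _ _,
    hpos, fun j => rfl, fun j => ?_⟩
  cases j with
  | zero => exact hN' 1 0 one_pos
  | succ j => exact hN' _ _ (hpos (j + 1))

theorem requiresArbitrarilySlowRates_of_hasInfiniteVCLTree {X : Type*} [MeasurableSpace X]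
    [MeasurableSingletonClass X] {ℋ : Set (X → Bool)} (hT : HasInfiniteVCLTree ℋ) :
    RequiresArbitrarilySlowRates ℋ := by
  intro R hR A
  obtain ⟨q, n, h0, hn, hpos, hq, hRq⟩ := hR.exists_slow_sequence
  have hle (j : ℕ) : q (j + 1) ≤ q j / 4 := by
    rw [hq]
    refine div_le_div_of_nonneg_left (hpos j).le (by norm_num) ?_
    have : (0 : ℝ) ≤ n j := Nat.cast_nonneg _
    linarith
  have hanti : Antitone q := antitone_nat_of_succ_le fun j => by linarith [hle j, hpos j]
  have hgeom (j : ℕ) : q j ≤ (1 / 4) ^ j := by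
    induction j with
    | zero => simp [h0]
    | succ j ih => rw [pow_succ]; linarith [hle j]
  have hlim : Tendsto q atTop (𝓝 0) := squeeze_zero (fun j => (hpos j).le) hgeom
    (tendsto_pow_atTop_nhds_zero_of_lt_one (by norm_num) (by norm_num))
  have hd (j : ℕ) : 0 < 4 * (n j + 1) := by positivity
  obtain ⟨x, hx⟩ := hT.exists_branch (d := fun j => 4 * (n j + 1)) hd
  obtain ⟨P, hP, hreal, hbound⟩ := exists_realizable_le_expErr hx hd h0 hanti hlim (n := n)
    (fun j => by
      have h1 : (0 : ℝ) ≤ n j := Nat.cast_nonneg _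
      have h2 : q j ≤ 1 := h0 ▸ hanti (Nat.zero_le j)
      have h3 := hpos (j + 1)
      push_cast
      rw [hq] at h3 ⊢
      rw [← add_div, mul_div_assoc', div_le_one (by positivity)]
      nlinarith) A
  refine ⟨P, hP, hreal, 1 / 8, by norm_num, 1, one_pos,
    (Set.infinite_range_of_injective hn.injective).mono ?_⟩
  rintro _ ⟨j, rfl⟩
  refine le_trans (ENNReal.ofReal_le_ofReal ?_) (hbound j)
  rw [one_mul, Nat.ceil_natCast]
  linarith [hRq j, hle j, hpos j]

/-- **Theorem 1.9 (characterization of universal rates).** For every measurable concept class `ℋ`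
on a Polish space with `|ℋ| ≥ 3`: if `ℋ` has no infinite Littlestone tree it is learnable with
optimal rate `e^{-n}`; if `ℋ` has an infinite Littlestone tree but no infinite VCL tree it is
learnable with optimal rate `1/max(n,1)`; if `ℋ` has an infinite VCL tree it requires arbitrarily
slow rates. -/
theorem universal_rates_characterization
    (𝒳 : Type*) [TopologicalSpace 𝒳] [PolishSpace 𝒳] [MeasurableSpace 𝒳] [BorelSpace 𝒳]
    (ℋ : Set (𝒳 → Bool)) (hmeas : MeasurableClass 𝒳 ℋ) (hcard : 3 ≤ ℋ.encard) :
    (¬ HasInfiniteLittlestoneTree ℋ →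
        LearnableWithOptimalRate ℋ (fun n => Real.exp (-(n : ℝ)))) ∧
      (HasInfiniteLittlestoneTree ℋ → ¬ HasInfiniteVCLTree ℋ →
        LearnableWithOptimalRate ℋ (fun n => 1 / max (n : ℝ) 1)) ∧
      (HasInfiniteVCLTree ℋ → RequiresArbitrarilySlowRates ℋ) := by
  obtain ⟨h, hh, -, -, x, -⟩ := exists_ne_of_three_le_encard hcard
  have : Nonempty 𝒳 := ⟨x⟩
  have hne : ℋ.Nonempty := ⟨h, hh⟩
  exact ⟨fun hL => ⟨learnableAtRate_exp hmeas hne hL, notLearnableFasterThan_exp hcard⟩,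
    fun hL hV => ⟨learnableAtRate_inv hmeas hne hV, notLearnableFasterThan_inv hL⟩,
    requiresArbitrarilySlowRates_of_hasInfiniteVCLTree⟩
end

section
/- Corollary 3.5: Let 𝒳 be a Polish space and ℋ a measurable concept class. If ℋ does not have an infinite Littlestone tree, then player P_L has a winning strategy in the Gale-Stewart game 𝔊 given by maps η_τ : 𝒳^τ → {0,1} (τ ≥ 1) each of which is universally measurable. -/
variable {𝒳 : Type*}

open MeasureTheory Set Filter Topology

/-- An open neighbourhood of a product of initial segments `Iic (k i)` contains the set of
sequences bounded by `k` on some finite set of coordinates. -/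
theorem exists_forall_lt_le_subset_of_isOpen {k : ℕ → ℕ} {V : Set (ℕ → ℕ)} (hV : IsOpen V)
    (hkV : Set.univ.pi (fun i => Iic (k i)) ⊆ V) : ∃ n, {x | ∀ i < n, x i ≤ k i} ⊆ V := by
  by_contra! hcon
  simp only [not_subset] at hcon
  choose x hx hxV using hcon
  have hK : IsCompact (Set.univ.pi (fun i => Iic (k i))) :=
    isCompact_univ_pi fun i => (finite_Iic (k i)).isCompact
  obtain ⟨a, ha, φ, hφ, hlim⟩ := hK.tendsto_subseq
    (x := fun n i => min (x n i) (k i)) (fun n i _ => min_le_right (x n i) (k i))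
  have hlim' : Tendsto (x ∘ φ) atTop (𝓝 a) := by
    rw [tendsto_pi_nhds] at hlim ⊢
    intro i
    refine (hlim i).congr' ?_
    filter_upwards [eventually_gt_atTop i] with n hn
    exact min_eq_left (hx (φ n) i (hn.trans_le (hφ.id_le n)))
  obtain ⟨n, hn⟩ := (hlim'.eventually (hV.mem_nhds (hkV ha))).exists
  exact hxV _ hn

/-- The range of a continuous function on the Baire space is approximated in measure from inside
by images of compact sets. -/
theorem exists_isCompact_le_measure_image {X : Type*} [TopologicalSpace X] [MeasurableSpace X]
    {μ : Measure X} [μ.OuterRegular] {f : (ℕ → ℕ) → X} (hf : Continuous f)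
    {c : ENNReal} (hc : c < μ (range f)) :
    ∃ K : Set (ℕ → ℕ), IsCompact K ∧ c ≤ μ (f '' K) := by
  have hstep : ∀ (n : ℕ) (S : Set (ℕ → ℕ)), c < μ (f '' S) →
      ∃ k, c < μ (f '' (S ∩ {x | x n ≤ k})) := by
    intro n S hS
    have hmono : Monotone fun k : ℕ => f '' (S ∩ {x | x n ≤ k}) := fun a b hab =>
      image_mono (inter_subset_inter_right _ fun x (hx : x n ≤ a) => hx.trans hab)
    have hunion : ⋃ k : ℕ, f '' (S ∩ {x | x n ≤ k}) = f '' S := by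
      rw [← image_iUnion, ← inter_iUnion]
      congr 1
      exact inter_eq_left.2 fun x _ => mem_iUnion.2 ⟨x n, le_refl (x n)⟩
    rw [← hunion, hmono.measure_iUnion] at hS
    exact lt_iSup_iff.1 hS
  choose! k hk using hstep
  let S : ℕ → Set (ℕ → ℕ) := fun n =>
    Nat.rec Set.univ (fun n S => S ∩ {x | x n ≤ k n S}) n
  have hS : ∀ n, c < μ (f '' S n) := by
    intro n
    induction n with
    | zero => simpa [S] using hc
    | succ n ih => exact hk n (S n) ih
  have hSsub : ∀ n, S n ⊆ {x | ∀ i < n, x i ≤ k i (S i)} := by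
    intro n
    induction n with
    | zero => simp
    | succ n ih =>
      rintro x ⟨hx, hxn⟩ i hi
      rcases Nat.lt_succ_iff_lt_or_eq.1 hi with h | rfl
      · exact ih hx i h
      · exact hxn
  refine ⟨Set.univ.pi fun i => Iic (k i (S i)),
    isCompact_univ_pi fun i => (finite_Iic _).isCompact, ?_⟩
  rw [Set.measure_eq_iInf_isOpen]
  refine le_iInf₂ fun U hU => le_iInf fun hUo => ?_
  obtain ⟨n, hn⟩ := exists_forall_lt_le_subset_of_isOpen (hUo.preimage hf) (image_subset_iff.1 hU)
  exact (hS n).le.trans (measure_mono (image_subset_iff.2 ((hSsub n).trans hn)))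

/-- Analytic sets are universally measurable. -/
theorem MeasureTheory.AnalyticSet.nullMeasurableSet {X : Type*} [TopologicalSpace X]
    [PolishSpace X] [MeasurableSpace X] [BorelSpace X] {s : Set X} (hs : AnalyticSet s)
    (μ : Measure X) [IsFiniteMeasure μ] : NullMeasurableSet s μ := by
  rw [AnalyticSet] at hs
  rcases hs with rfl | ⟨f, hf, rfl⟩
  · exact nullMeasurableSet_empty
  rcases eq_or_ne (μ (range f)) 0 with h0 | h0
  · exact .of_null h0
  obtain ⟨u, -, hu, hlim⟩ := exists_seq_strictMono_tendsto' (pos_iff_ne_zero.2 h0)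
  choose K hK hKu using fun n => exists_isCompact_le_measure_image hf (hu n).2
  have hB : NullMeasurableSet (⋃ n, f '' K n) μ :=
    .iUnion fun n => ((hK n).image hf).measurableSet.nullMeasurableSet
  refine hB.congr (ae_eq_of_subset_of_measure_ge
    (iUnion_subset fun n => image_subset_range _ _) ?_ hB (measure_ne_top _ _))
  exact le_of_tendsto' hlim fun n =>
    (hKu n).trans (measure_mono (subset_iUnion (fun n => f '' K n) n))

open scoped Ordinal

section Game

variable {X Θ : Type*}

/-- Starting from the version space `C`, player `P_A` can keep the version space nonempty for at
least `α` further rounds, where `α` is an ordinal. -/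
def GameRankGE (f : Θ → X → Bool) (α : Ordinal.{0}) (C : Set Θ) : Prop :=
  C.Nonempty ∧ ∀ β, β < α → ∃ x, ∀ y, GameRankGE f β (C ∩ {θ | f θ x = y})
termination_by α

/-- The parameters that are consistent with the history `u`, listed from the most recent label to
the oldest one, when the point queried after the history `v` is `x v`. -/
def versionSpace (f : Θ → X → Bool) (x : List Bool → X) : List Bool → Set Θ
  | [] => univ
  | b :: u => versionSpace f x u ∩ {θ | f θ (x u) = b}

variable {f : Θ → X → Bool}

theorem GameRankGE.nonempty {α : Ordinal} {C : Set Θ} (h : GameRankGE f α C) : C.Nonempty := by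
  rw [GameRankGE] at h
  exact h.1

theorem GameRankGE.exists_of_lt {α β : Ordinal} {C : Set Θ} (h : GameRankGE f α C) (hβ : β < α) :
    ∃ x, ∀ y, GameRankGE f β (C ∩ {θ | f θ x = y}) := by
  rw [GameRankGE] at h
  exact h.2 β hβ

theorem GameRankGE.mono {α β : Ordinal} {C : Set Θ} (h : GameRankGE f α C) (hβ : β ≤ α) :
    GameRankGE f β C := by
  rw [GameRankGE]
  exact ⟨h.nonempty, fun γ hγ => h.exists_of_lt (hγ.trans_le hβ)⟩

theorem gameRankGE_zero {C : Set Θ} : GameRankGE f 0 C ↔ C.Nonempty := by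
  rw [GameRankGE]
  simp

theorem Ordinal.countable_Iio_of_lt_omega_one {α : Ordinal.{0}} (hα : α < ω₁) :
    Countable (Iio α) := by
  rw [← Cardinal.mk_le_aleph0_iff, Cardinal.mk_Iio_ordinal, Cardinal.lift_le_aleph0,
    ← Cardinal.lt_aleph_one_iff]
  rwa [← Cardinal.lt_ord, Cardinal.ord_aleph]

theorem versionSpace_congr {x x' : List Bool → X} {u : List Bool}
    (h : ∀ v, v.length < u.length → x v = x' v) : versionSpace f x u = versionSpace f x' u := by
  induction u with
  | nil => rfl
  | cons b u ih =>
    simp only [versionSpace]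
    rw [ih fun v hv => h v (hv.trans (by simp)), h u (by simp)]

section Measurability

variable [MeasurableSpace X] [MeasurableSpace Θ]

theorem measurableSet_graph_inter_query {Z : Type*} [MeasurableSpace Z]
    (hf : Measurable (Function.uncurry f)) {C : Z → Set Θ}
    (hC : MeasurableSet {p : Z × Θ | p.2 ∈ C p.1}) {g : Z → X} (hg : Measurable g) (y : Bool) :
    MeasurableSet {p : Z × Θ | p.2 ∈ C p.1 ∩ {θ | f θ (g p.1) = y}} :=
  hC.inter ((hf.comp (measurable_snd.prodMk (hg.comp measurable_fst))) (measurableSet_singleton y))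

theorem measurableSet_graph_versionSpace {Z : Type*} [MeasurableSpace Z]
    (hf : Measurable (Function.uncurry f)) {x : Z → List Bool → X}
    (hx : ∀ v, Measurable fun z => x z v) (u : List Bool) :
    MeasurableSet {p : Z × Θ | p.2 ∈ versionSpace f (x p.1) u} := by
  induction u with
  | nil => simp [versionSpace]
  | cons b u ih => exact measurableSet_graph_inter_query (C := fun z => versionSpace f (x z) u) hf ih (hx u) b

end Measurability

section Analytic

universe u

variable {X : Type u} {Θ : Type*} {f : Θ → X → Bool}
  [TopologicalSpace X] [PolishSpace X] [MeasurableSpace X] [BorelSpace X]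
  [TopologicalSpace Θ] [PolishSpace Θ] [MeasurableSpace Θ] [BorelSpace Θ]

theorem analyticSet_gameRankGE (hf : Measurable (Function.uncurry f)) {α : Ordinal.{0}}
    (hα : α < ω₁) {Z : Type u} [TopologicalSpace Z] [PolishSpace Z] [MeasurableSpace Z]
    [BorelSpace Z] {C : Z → Set Θ} (hC : MeasurableSet {p : Z × Θ | p.2 ∈ C p.1}) :
    AnalyticSet {z | GameRankGE f α (C z)} := by
  induction α using WellFoundedLT.induction generalizing Z with
  | ind α ih =>
  have hne : AnalyticSet {z | (C z).Nonempty} := by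
    convert hC.analyticSet.image_of_continuous continuous_fst using 1
    ext z
    simp [Set.Nonempty]
  have hstep : ∀ β : Iio α,
      AnalyticSet {z | ∃ x, ∀ y, GameRankGE f β (C z ∩ {θ | f θ x = y})} := by
    rintro ⟨β, hβ⟩
    have hy : ∀ y : Bool,
        AnalyticSet {p : Z × X | GameRankGE f β (C p.1 ∩ {θ | f θ p.2 = y})} := fun y =>
      ih β hβ (hβ.trans hα) (measurableSet_graph_inter_query (C := fun p : Z × X => C p.1) hf
        (hC.preimage ((measurable_fst.comp measurable_fst).prodMk measurable_snd))
        measurable_snd y)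
    convert (AnalyticSet.iInter hy).image_of_continuous continuous_fst using 1
    ext z
    simp
  have := Ordinal.countable_Iio_of_lt_omega_one hα
  have hall : AnalyticSet
      (⋂ b : Option (Iio α), b.elim {z | (C z).Nonempty}
        fun β => {z | ∃ x, ∀ y, GameRankGE f β (C z ∩ {θ | f θ x = y})}) :=
    .iInter fun b => by
      cases b
      · exact hne
      · exact hstep _
  convert hall using 1
  ext z
  rw [mem_ofPred_eq, GameRankGE]
  simp [iInter_option]

end Analytic

section Unfolding

variable {g : ℕ → (ℕ → ℕ) → List Bool → X}

/-- For the family `g` of codings of points by sequences of integers, there are a tree `x` and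
codes `w` such that all version spaces of level `k` have rank at least `α`, the first `k` codes
describe the corresponding levels of `x`, and these codes agree with `s` up to `k`. -/
def HasCodedTree (f : Θ → X → Bool) (g : ℕ → (ℕ → ℕ) → List Bool → X) (k : ℕ) (s : ℕ → ℕ → ℕ)
    (α : Ordinal.{0}) : Prop :=
  ∃ (x : List Bool → X) (w : ℕ → ℕ → ℕ),
    (∀ u : List Bool, u.length = k → GameRankGE f α (versionSpace f x u)) ∧
    (∀ n < k, ∀ v : List Bool, v.length < n → g n (w n) v = x v) ∧
    ∀ n < k, ∀ i < k, w n i = s n i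

theorem HasCodedTree.mono {k : ℕ} {s : ℕ → ℕ → ℕ} {α β : Ordinal} (h : HasCodedTree f g k s α)
    (hβ : β ≤ α) : HasCodedTree f g k s β := by
  obtain ⟨x, w, hx, h⟩ := h
  exact ⟨x, w, fun u hu => (hx u hu).mono hβ, h⟩

theorem HasCodedTree.exists_succ_of_lt
    (hg : ∀ n, {x : List Bool → X | ∀ u : List Bool, u.length = n →
      (versionSpace f x u).Nonempty} ⊆ range (g n))
    {k : ℕ} {s : ℕ → ℕ → ℕ} {α β : Ordinal} (h : HasCodedTree f g k s α) (hβ : β < α) :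
    ∃ s', (∀ n < k, ∀ i < k, s' n i = s n i) ∧ HasCodedTree f g (k + 1) s' β := by
  obtain ⟨x, w, hx, hgw, hws⟩ := h
  have : Nonempty X := ⟨x []⟩
  choose! ξ hξ using fun u (hu : u.length = k) => (hx u hu).exists_of_lt hβ
  obtain ⟨c, hc⟩ := hg k (fun u hu => (hx u hu).nonempty)
  let x' : List Bool → X := fun v => if v.length = k then ξ v else x v
  have hxx' : ∀ v, v.length < k → x v = x' v := fun v hv => by simp [x', hv.ne]
  let w' : ℕ → ℕ → ℕ := Function.update w k c
  have hw' : ∀ n < k, w' n = w n := fun n hn => Function.update_of_ne hn.ne _ _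
  refine ⟨w', fun n hn i hi => by rw [hw' n hn, hws n hn i hi], x', w', ?_, ?_, fun _ _ _ _ => rfl⟩
  · intro u hu
    cases u with
    | nil => simp at hu
    | cons b u =>
      have hu' : u.length = k := by simpa using hu
      have hξu := hξ u hu' b
      rw [versionSpace_congr (x' := x') fun v hv => hxx' v (hv.trans_eq hu')] at hξu
      simpa [versionSpace, x', hu'] using hξu
  · intro n hn v hv
    rcases Nat.lt_succ_iff_lt_or_eq.1 hn with h | rfl
    · rw [hw' n h, hgw n h v hv, hxx' v (hv.trans h)]
    · rw [← hxx' v hv, ← hc]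
      simp [w']

/-- By the pigeonhole principle, a tree coded up to level `k` whose version spaces have arbitrarily
large countable ranks extends to one coded up to level `k + 1`. -/
theorem exists_succ_forall_hasCodedTree
    (hg : ∀ n, {x : List Bool → X | ∀ u : List Bool, u.length = n →
      (versionSpace f x u).Nonempty} ⊆ range (g n))
    {k : ℕ} {s : ℕ → ℕ → ℕ} (h : ∀ α < ω₁, HasCodedTree f g k s α) :
    ∃ s', (∀ n < k, ∀ i < k, s' n i = s n i) ∧ ∀ α < ω₁, HasCodedTree f g (k + 1) s' α := by
  by_contra! hcon
  let e : (Fin (k + 1) → Fin (k + 1) → ℕ) → ℕ → ℕ → ℕ := fun c n i =>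
    if hn : n < k + 1 then if hi : i < k + 1 then c ⟨n, hn⟩ ⟨i, hi⟩ else 0 else 0
  have hbound : ∀ c, ∃ α < ω₁,
      (∀ n < k, ∀ i < k, e c n i = s n i) → ¬ HasCodedTree f g (k + 1) (e c) α := by
    intro c
    by_cases hc : ∀ n < k, ∀ i < k, e c n i = s n i
    · obtain ⟨α, hα, hαc⟩ := hcon (e c) hc
      exact ⟨α, hα, fun _ => hαc⟩
    · exact ⟨0, Ordinal.omega_pos 1, fun h => absurd h hc⟩
  choose a ha hac using hbound
  have hsup : ⨆ c, a c < ω₁ := Ordinal.iSup_lt_omega_one ha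
  have hsucc : Order.succ (⨆ c, a c) < ω₁ := (Cardinal.isSuccLimit_omega 1).succ_lt hsup
  obtain ⟨s', hs', hs⟩ := (h _ hsucc).exists_succ_of_lt hg (Order.lt_succ _)
  let c : Fin (k + 1) → Fin (k + 1) → ℕ := fun n i => s' n i
  have hec : ∀ n < k + 1, ∀ i < k + 1, e c n i = s' n i := fun n hn i hi => by
    simp only [e, c, hn, hi, dif_pos]
  refine hac c (fun n hn i hi => ?_) ?_
  · rw [hec n (by lia) i (by lia), hs' n hn i hi]
  · obtain ⟨x, w, hx, hgw, hws⟩ := hs.mono (Ordinal.le_iSup a c)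
    exact ⟨x, w, hx, hgw, fun n hn i hi => by rw [hws n hn i hi, hec n hn i hi]⟩

theorem exists_forall_versionSpace_nonempty [TopologicalSpace X] [T2Space X]
    (hgc : ∀ n, Continuous (g n))
    (hg : ∀ n, {x : List Bool → X | ∀ u : List Bool, u.length = n →
      (versionSpace f x u).Nonempty}.Nonempty → range (g n) = {x : List Bool → X |
        ∀ u : List Bool, u.length = n → (versionSpace f x u).Nonempty})
    (h : ∀ α < ω₁, GameRankGE f α Set.univ) :
    ∃ x : List Bool → X, ∀ u, (versionSpace f x u).Nonempty := by
  have hg' : ∀ n, {x : List Bool → X | ∀ u : List Bool, u.length = n →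
      (versionSpace f x u).Nonempty} ⊆ range (g n) := fun n x hx => by
    rw [hg n ⟨x, hx⟩]
    exact hx
  have hX : Nonempty X :=
    ((h 1 (Ordinal.one_lt_omega0.trans Ordinal.omega0_lt_omega_one)).exists_of_lt
      zero_lt_one).nonempty
  let T : ℕ → Type := fun k => {s : ℕ → ℕ → ℕ // ∀ α < ω₁, HasCodedTree f g k s α}
  choose! next hnext hnextT using fun k (t : T k) => exists_succ_forall_hasCodedTree hg' t.2
  let t : ∀ k, T k := fun k => Nat.rec
    ⟨fun _ _ => 0, fun α hα => ⟨fun _ => hX.some, fun _ _ => 0, fun u hu => by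
      rw [List.eq_nil_of_length_eq_zero hu]
      exact h α hα, by simp, by simp⟩⟩
    (fun k t => ⟨next k t, hnextT k t⟩) k
  have ht : ∀ k, ∀ n < k, ∀ i < k, (t (k + 1)).1 n i = (t k).1 n i := fun k => hnext k (t k)
  let W : ℕ → ℕ → ℕ := fun n i => (t (max n i + 1)).1 n i
  have hW : ∀ k, ∀ n < k, ∀ i < k, (t k).1 n i = W n i := by
    intro k n hn i hi
    have hk : max n i + 1 ≤ k := by lia
    induction k, hk using Nat.le_induction with
    | base => rfl
    | succ k hk ih => rw [ht k n (by lia) i (by lia), ih (by lia) (by lia)]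
  choose x w hx hgw hws using fun k => (t k).2 0 (Ordinal.omega_pos 1)
  have hlim : ∀ n, Tendsto (fun k => w k n) atTop (𝓝 (W n)) := by
    intro n
    rw [tendsto_pi_nhds]
    intro i
    refine tendsto_const_nhds.congr' ?_
    filter_upwards [eventually_gt_atTop n, eventually_gt_atTop i] with k hn hi
    rw [hws k n hn i hi, hW k n hn i hi]
  have hlimg : ∀ n v, v.length < n → Tendsto (fun k => x k v) atTop (𝓝 (g n (W n) v)) := by
    intro n v hv
    refine Tendsto.congr' ?_
      (((continuous_apply v).comp (hgc n)).continuousAt.tendsto.comp (hlim n))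
    filter_upwards [eventually_gt_atTop n] with k hk
    exact hgw k n hk v hv
  refine ⟨fun v => g (v.length + 1) (W (v.length + 1)) v, fun u => ?_⟩
  have hne : {x : List Bool → X | ∀ v : List Bool, v.length = u.length →
      (versionSpace f x v).Nonempty}.Nonempty := ⟨x u.length, fun v hv => (hx _ v hv).nonempty⟩
  have hmem : g u.length (W u.length) ∈ {x : List Bool → X | ∀ v : List Bool,
      v.length = u.length → (versionSpace f x v).Nonempty} := hg _ hne ▸ mem_range_self _
  rw [versionSpace_congr (x' := g u.length (W u.length)) fun v hv =>
    tendsto_nhds_unique (hlimg _ v (Nat.lt_succ_self _)) (hlimg _ v hv)]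
  exact hmem u rfl

end Unfolding

end Game

section Strategy

open scoped Classical in
/-- The label played by `P_L` when the version space is `C` and the queried point is `x`: it is
`true` if and only if `true` decreases the rank of the version space, for ranks below `κ`. -/
noncomputable def rankDecreasingLabel {X Θ : Type*} (f : Θ → X → Bool) (κ : Ordinal.{0})
    (C : Set Θ) (x : X) : Bool :=
  decide (∃ β < κ, GameRankGE f β C ∧ ¬ GameRankGE f β (C ∩ {θ | f θ x = true}))

/-- The labels played by `P_L` in the first `n` rounds against `ξ`, from the most recent one to
the oldest one. -/
noncomputable def labelHistory {X Θ : Type*} (f : Θ → X → Bool) (κ : Ordinal.{0}) (ξ : ℕ → X) :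
    ℕ → List Bool
  | 0 => []
  | n + 1 => rankDecreasingLabel f κ
      (versionSpace f (fun v => ξ v.length) (labelHistory f κ ξ n)) (ξ n) :: labelHistory f κ ξ n

/-- The label played by `P_L` in round `n` against `ξ`. -/
noncomputable def playedLabel {X Θ : Type*} (f : Θ → X → Bool) (κ : Ordinal.{0}) (ξ : ℕ → X)
    (n : ℕ) : Bool :=
  rankDecreasingLabel f κ (versionSpace f (fun v => ξ v.length) (labelHistory f κ ξ n)) (ξ n)

section Winning

variable {X Θ : Type*} {f : Θ → X → Bool} {κ : Ordinal.{0}}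

theorem exists_gameRankGE_and_not_gameRankGE_inter {C : Set Θ} (hC : C.Nonempty)
    (hκ : ¬ GameRankGE f κ C) (x : X) :
    ∃ β < κ, GameRankGE f β C ∧
      ¬ GameRankGE f β (C ∩ {θ | f θ x = rankDecreasingLabel f κ C x}) := by
  obtain ⟨α, hα, hmin⟩ := WellFounded.has_min (wellFounded_lt (α := Ordinal.{0}))
    {α | ¬ GameRankGE f α C} ⟨κ, hκ⟩
  have hακ : α ≤ κ := not_lt.1 (hmin κ hκ)
  have hα' : ∃ β < α, ∀ x, ∃ y, ¬ GameRankGE f β (C ∩ {θ | f θ x = y}) := by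
    by_contra! hcon
    refine hα ?_
    rw [GameRankGE]
    exact ⟨hC, hcon⟩
  obtain ⟨β, hβα, hβ⟩ := hα'
  have hβC : GameRankGE f β C := by
    by_contra hcon
    exact hmin β hcon hβα
  obtain ⟨y, hy⟩ := hβ x
  by_cases hlabel : ∃ β < κ, GameRankGE f β C ∧ ¬ GameRankGE f β (C ∩ {θ | f θ x = true})
  · simp [rankDecreasingLabel, hlabel]
  · have hlabel' : rankDecreasingLabel f κ C x = false := by
      simpa [rankDecreasingLabel] using hlabel
    rw [hlabel']
    cases y with
    | true => exact absurd ⟨β, hβα.trans_le hακ, hβC, hy⟩ hlabel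
    | false => exact ⟨β, hβα.trans_le hακ, hβC, hy⟩

theorem length_labelHistory (ξ : ℕ → X) (n : ℕ) : (labelHistory f κ ξ n).length = n := by
  induction n with
  | zero => rfl
  | succ n ih => simp [labelHistory, ih]

theorem versionSpace_labelHistory_succ (ξ : ℕ → X) (n : ℕ) :
    versionSpace f (fun v => ξ v.length) (labelHistory f κ ξ (n + 1)) =
      versionSpace f (fun v => ξ v.length) (labelHistory f κ ξ n) ∩
        {θ | f θ (ξ n) = playedLabel f κ ξ n} := by
  simp only [labelHistory, versionSpace, length_labelHistory, playedLabel]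

theorem mem_versionSpace_labelHistory {ξ : ℕ → X} {n : ℕ} {θ : Θ} :
    θ ∈ versionSpace f (fun v => ξ v.length) (labelHistory f κ ξ n) ↔
      ∀ i < n, f θ (ξ i) = playedLabel f κ ξ i := by
  induction n with
  | zero => simp [labelHistory, versionSpace]
  | succ n ih =>
    rw [versionSpace_labelHistory_succ, mem_inter_iff, ih, mem_ofPred_eq]
    exact Nat.forall_lt_succ_right.symm

theorem exists_forall_exists_ne_playedLabel (hκ : ¬ GameRankGE f κ (Set.univ : Set Θ))
    (ξ : ℕ → X) : ∃ n, ∀ θ, ∃ i ≤ n, f θ (ξ i) ≠ playedLabel f κ ξ i := by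
  by_contra! hcon
  let V : ℕ → Set Θ := fun n => versionSpace f (fun v => ξ v.length) (labelHistory f κ ξ n)
  have hV : ∀ n, (V n).Nonempty := fun n => by
    obtain ⟨θ, hθ⟩ := hcon n
    exact ⟨θ, mem_versionSpace_labelHistory.2 fun i hi => hθ i hi.le⟩
  have hdesc : ∀ α ≤ κ, ∀ n, GameRankGE f α (V n) := by
    intro α
    induction α using WellFoundedLT.induction with
    | ind α ih =>
      intro hα n
      by_contra hn
      obtain ⟨β, hβ, hβn, hβn'⟩ := exists_gameRankGE_and_not_gameRankGE_inter (hV n)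
        (fun h => hn (h.mono hα)) (ξ n)
      have hβα : β < α := by
        by_contra! hle
        exact hn (hβn.mono hle)
      refine hβn' ?_
      have := ih β hβα hβ.le (n + 1)
      rwa [show V (n + 1) = _ from versionSpace_labelHistory_succ ξ n] at this
  exact hκ (hdesc κ le_rfl 0)

theorem labelHistory_congr {ξ ξ' : ℕ → X} {n : ℕ} (h : ∀ i < n, ξ i = ξ' i) :
    labelHistory f κ ξ n = labelHistory f κ ξ' n := by
  induction n with
  | zero => rfl
  | succ n ih =>
    have hn := ih fun i hi => h i (hi.trans n.lt_succ_self)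
    simp only [labelHistory]
    rw [hn, h n n.lt_succ_self, versionSpace_congr (x' := fun v => ξ' v.length) fun v hv =>
      h _ (hv.trans (by simp [length_labelHistory]))]

theorem playedLabel_congr {ξ ξ' : ℕ → X} {n : ℕ} (h : ∀ i ≤ n, ξ i = ξ' i) :
    playedLabel f κ ξ n = playedLabel f κ ξ' n := by
  have := labelHistory_congr (f := f) (κ := κ) (n := n + 1) fun i hi => h i (Nat.lt_succ_iff.1 hi)
  exact (List.cons.inj this).1

end Winning

section Measurability

universe u

variable {X : Type u} {Θ : Type*} {f : Θ → X → Bool} {κ : Ordinal.{0}}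
  [TopologicalSpace X] [PolishSpace X] [MeasurableSpace X] [BorelSpace X]
  [TopologicalSpace Θ] [PolishSpace Θ] [MeasurableSpace Θ] [BorelSpace Θ]

theorem nullMeasurableSet_rankDecreasingLabel_eq (hf : Measurable (Function.uncurry f))
    (hκ : κ < ω₁) {Z : Type u} [TopologicalSpace Z] [PolishSpace Z] [MeasurableSpace Z]
    [BorelSpace Z] {C : Z → Set Θ} (hC : MeasurableSet {p : Z × Θ | p.2 ∈ C p.1})
    {g : Z → X} (hg : Measurable g) (b : Bool) (μ : Measure Z) [IsFiniteMeasure μ] :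
    NullMeasurableSet {z | rankDecreasingLabel f κ (C z) (g z) = b} μ := by
  have := Ordinal.countable_Iio_of_lt_omega_one hκ
  have htrue : NullMeasurableSet {z | rankDecreasingLabel f κ (C z) (g z) = true} μ := by
    have : {z | rankDecreasingLabel f κ (C z) (g z) = true} =
        ⋃ β : Iio κ, {z | GameRankGE f β (C z)} \
          {z | GameRankGE f β (C z ∩ {θ | f θ (g z) = true})} := by
      ext z
      simp [rankDecreasingLabel, and_left_comm]
    rw [this]
    exact .iUnion fun β => ((analyticSet_gameRankGE hf (β.2.trans hκ) hC).nullMeasurableSet μ).diff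
      ((analyticSet_gameRankGE hf (β.2.trans hκ)
        (measurableSet_graph_inter_query hf hC hg true)).nullMeasurableSet μ)
  cases b with
  | true => exact htrue
  | false =>
    convert htrue.compl using 1
    ext z
    simp

theorem nullMeasurableSet_labelHistory_eq (hf : Measurable (Function.uncurry f)) (hκ : κ < ω₁)
    (n : ℕ) (u : List Bool) (μ : Measure (ℕ → X)) [IsFiniteMeasure μ] :
    NullMeasurableSet {ξ | labelHistory f κ ξ n = u} μ := by
  induction n generalizing u with
  | zero => simp [labelHistory]
  | succ n ih =>
    cases u with
    | nil => simp [labelHistory]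
    | cons b u =>
      have hset : {ξ | labelHistory f κ ξ (n + 1) = b :: u} = {ξ | labelHistory f κ ξ n = u} ∩
          {ξ | rankDecreasingLabel f κ (versionSpace f (fun v => ξ v.length) u) (ξ n) = b} := by
        ext ξ
        simp only [labelHistory, List.cons.injEq, mem_inter_iff, mem_ofPred_eq]
        constructor
        · rintro ⟨h, rfl⟩
          exact ⟨rfl, h⟩
        · rintro ⟨rfl, h⟩
          exact ⟨h, rfl⟩
      rw [hset]
      exact (ih u).inter (nullMeasurableSet_rankDecreasingLabel_eq hf hκ
        (measurableSet_graph_versionSpace hf (x := fun (ξ : ℕ → X) v => ξ v.length)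
          (fun v => measurable_pi_apply _) u) (measurable_pi_apply n) b μ)

theorem nullMeasurable_playedLabel (hf : Measurable (Function.uncurry f)) (hκ : κ < ω₁)
    (n : ℕ) (μ : Measure (ℕ → X)) [IsFiniteMeasure μ] :
    NullMeasurable (fun ξ => playedLabel f κ ξ n) μ := by
  intro s _
  have : (fun ξ => playedLabel f κ ξ n) ⁻¹' s =
      ⋃ u ∈ {u : List Bool | ∃ b v, u = b :: v ∧ b ∈ s},
        {ξ : ℕ → X | labelHistory f κ ξ (n + 1) = u} := by
    ext ξ
    simp only [mem_preimage, mem_iUnion, mem_ofPred_eq, exists_prop]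
    constructor
    · exact fun h => ⟨_, ⟨_, _, rfl, h⟩, rfl⟩
    · rintro ⟨_, ⟨b, v, rfl, hb⟩, h⟩
      rwa [show playedLabel f κ ξ n = b from (List.cons.inj h).1]
  rw [this]
  exact .biUnion (to_countable _) fun u _ => nullMeasurableSet_labelHistory_eq hf hκ _ u μ

end Measurability

end Strategy

theorem mem_versionSpace_reverse_ofFn {X Θ : Type*} {f : Θ → X → Bool} {x : List Bool → X}
    {y : ℕ → Bool} {n : ℕ} {θ : Θ} :
    θ ∈ versionSpace f x (List.ofFn fun i : Fin n => y i).reverse ↔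
      ∀ k < n, f θ (x (List.ofFn fun i : Fin k => y i).reverse) = y k := by
  induction n with
  | zero => simp [versionSpace]
  | succ n ih =>
    rw [List.ofFn_succ', List.concat_eq_append, List.reverse_append, Nat.forall_lt_succ_right, ← ih]
    simp [versionSpace]

theorem hasInfiniteLittlestoneTree_range {X Θ : Type*} {f : Θ → X → Bool} {x : List Bool → X}
    (hx : ∀ u, (versionSpace f x u).Nonempty) : HasInfiniteLittlestoneTree (range f) := by
  refine ⟨fun u => x u.reverse, fun y n => ?_⟩
  obtain ⟨θ, hθ⟩ := hx (List.ofFn fun i : Fin (n + 1) => y i).reverse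
  exact ⟨f θ, mem_range_self θ, fun k hk =>
    mem_versionSpace_reverse_ofFn.1 hθ k (Nat.lt_succ_of_le hk)⟩

/-- If a measurable class has no infinite Littlestone tree, then the rank of its game is
countable. -/
theorem exists_lt_omega_one_not_gameRankGE {X Θ : Type*} {f : Θ → X → Bool}
    [TopologicalSpace X] [PolishSpace X] [MeasurableSpace X] [BorelSpace X] [Nonempty X]
    [TopologicalSpace Θ] [PolishSpace Θ] [MeasurableSpace Θ] [BorelSpace Θ]
    (hf : Measurable (Function.uncurry f)) (htree : ¬ HasInfiniteLittlestoneTree (range f)) :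
    ∃ κ < ω₁, ¬ GameRankGE f κ Set.univ := by
  by_contra! hcon
  have hanalytic : ∀ n, AnalyticSet
      {x : List Bool → X | ∀ u : List Bool, u.length = n → (versionSpace f x u).Nonempty} := by
    intro n
    have : Nonempty {u : List Bool // u.length = n} := ⟨⟨.replicate n true, by simp⟩⟩
    convert AnalyticSet.iInter fun u : {u : List Bool // u.length = n} =>
      analyticSet_gameRankGE (C := fun x => versionSpace f x u) hf (Ordinal.omega_pos 1)
        (measurableSet_graph_versionSpace hf (x := fun x : List Bool → X => x)
          (fun v => measurable_pi_apply v) u) using 1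
    ext x
    simp [gameRankGE_zero]
  have hcode : ∀ n, ∃ g : (ℕ → ℕ) → List Bool → X, Continuous g ∧
      ({x : List Bool → X | ∀ u : List Bool, u.length = n →
        (versionSpace f x u).Nonempty}.Nonempty → range g = {x : List Bool → X |
          ∀ u : List Bool, u.length = n → (versionSpace f x u).Nonempty}) := by
    intro n
    have := hanalytic n
    rw [AnalyticSet] at this
    rcases this with h | ⟨g, hg, hgr⟩
    · exact ⟨fun _ _ => Classical.arbitrary X, continuous_const, fun hne =>
        absurd h hne.ne_empty⟩
    · exact ⟨g, hg, fun _ => hgr⟩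
  choose g hgc hg using hcode
  obtain ⟨x, hx⟩ := exists_forall_versionSpace_nonempty hgc hg hcon
  exact htree (hasInfiniteLittlestoneTree_range hx)

/-- **Corollary 3.5.** If a measurable concept class `ℋ` on a Polish space has no infinite
Littlestone tree, then player `P_L` has a winning strategy in the Gale-Stewart game `𝔊` given
by universally measurable maps `η_τ : 𝒳^τ → {0,1}`: against any sequence of plays `ξ` of `P_A`,
at some finite round `τ` the class `ℋ_{ξ_1,η_1,…,ξ_τ,η_τ}` becomes empty. -/
theorem pl_has_universally_measurable_winning_strategy
    (𝒳 : Type*) [TopologicalSpace 𝒳] [PolishSpace 𝒳] [MeasurableSpace 𝒳] [BorelSpace 𝒳]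
    (ℋ : Set (𝒳 → Bool)) (hmeas : MeasurableClass 𝒳 ℋ)
    (htree : ¬ HasInfiniteLittlestoneTree ℋ) :
    ∃ η : ∀ τ : ℕ, (Fin (τ + 1) → 𝒳) → Bool,
      (∀ τ : ℕ, UniversallyMeasurable (η τ)) ∧
      ∀ ξ : ℕ → 𝒳, ∃ τ : ℕ, ∀ h ∈ ℋ,
        ∃ s ≤ τ, h (ξ s) ≠ η s (fun i : Fin (s + 1) => ξ i) := by
  obtain ⟨w⟩ := hmeas
  obtain ⟨Θ, f, hf, rfl⟩ := w
  rcases isEmpty_or_nonempty 𝒳 with hX | ⟨⟨x₀⟩⟩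
  · exact ⟨fun _ _ => true, fun _ _ _ => measurable_const.nullMeasurable,
      fun ξ => isEmptyElim (ξ 0)⟩
  have : Nonempty 𝒳 := ⟨x₀⟩
  obtain ⟨κ, hκ, hrank⟩ := exists_lt_omega_one_not_gameRankGE hf htree
  let pad : ∀ τ : ℕ, (Fin (τ + 1) → 𝒳) → ℕ → 𝒳 := fun τ v i =>
    if hi : i < τ + 1 then v ⟨i, hi⟩ else x₀
  have hext : ∀ τ, Measurable (pad τ) := fun τ => measurable_pi_lambda _ fun i => by
    by_cases hi : i < τ + 1
    · simpa only [pad, hi, dif_pos] using measurable_pi_apply _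
    · simpa only [pad, hi, dif_neg, not_false_eq_true] using measurable_const
  refine ⟨fun τ v => playedLabel f κ (pad τ v) τ, fun τ μ hμ => ?_, fun ξ => ?_⟩
  · intro s hs
    have := Measure.isProbabilityMeasure_map (μ := μ) (hext τ).aemeasurable
    exact (nullMeasurable_playedLabel hf hκ τ (μ.map (pad τ)) hs).preimage
      ((hext τ).measurePreserving μ).quasiMeasurePreserving
  · obtain ⟨n, hn⟩ := exists_forall_exists_ne_playedLabel hrank ξ
    refine ⟨n, ?_⟩
    rintro _ ⟨θ, rfl⟩
    obtain ⟨i, hi, hne⟩ := hn θ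
    refine ⟨i, hi, hne.trans_eq (playedLabel_congr fun j hj => ?_)⟩
    simp only [pad, Nat.lt_succ_of_le hj, dif_pos]
end
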